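/- arXiv:math/0608372 — 2 statements merged into one kernel-verified Lean document; each statement's English description precedes it below -/
import Mathlib

section
/- Let w ≥ 6 be an even integer and d_w = ⌊(w−2)/4⌋ ≥ 1. Then each of the families of functions (R_{2,w,2i})_{i=1,…,d_w} and (R_{2,w,w−2i})_{i=1,…,d_w} is a basis of S_{w+2}(Γ₀(2)): in each family the functions are linearly independent over ℂ, and for every cusp form f ∈ S_{w+2}(Γ₀(2)) there exist complex numbers c₁,…,c_{d_w} such that f(z) = Σ_{i=1}^{d_w} c_i · (the i-th member of the family)(z) for all z ∈ ℍ. -/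
open MeasureTheory

noncomputable section

/-- The constant `c_{w,n} = (-1)^n · 2πi · C(w,n)`. -/
def cwn (w n : ℕ) : ℂ := (-1) ^ n * (2 * (Real.pi : ℂ) * Complex.I) * (w.choose n : ℂ)

/-- The Poincaré-type series `R_{N,w,n}`, viewed as a function on `ℂ`. -/
def RG (N w n : ℕ) (z : ℂ) : ℂ :=
  (cwn w n)⁻¹ * ∑' γ : CongruenceSubgroup.Gamma0 N,
    ((γ.1.1 0 0 : ℂ) * z + (γ.1.1 0 1 : ℂ)) ^ (-((w : ℤ) - n + 1)) *
      ((γ.1.1 1 0 : ℂ) * z + (γ.1.1 1 1 : ℂ)) ^ (-((n : ℤ) + 1))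

section PartC1
open Complex Filter Topology Set

lemma aux_halfplane (G : ℂ → ℂ) (hG : ∀ z : ℂ, 0 ≤ z.im → DifferentiableAt ℂ G z)
    (hb : ∀ z : ℂ, 0 ≤ z.im → 1 ≤ ‖z‖ → ‖G z‖ ≤ (‖z‖ ^ 2)⁻¹)
    (hGint : Integrable (fun x : ℝ => G x)) : ∫ x : ℝ, G x = 0 := by
  have h1 : Tendsto (fun T : ℝ => ∫ x in (-T)..T, G x) atTop (𝓝 (∫ x : ℝ, G x)) :=
    intervalIntegral_tendsto_integral hGint tendsto_neg_atTop_atBot tendsto_id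
  have h2 : Tendsto (fun T : ℝ => ∫ x in (-T)..T, G x) atTop (𝓝 0) := by
    have h3 : Tendsto (fun T : ℝ => 4 * T⁻¹) atTop (𝓝 0) := by
      simpa using tendsto_inv_atTop_zero.const_mul (4:ℝ)
    refine squeeze_zero_norm' ?_ h3
    filter_upwards [eventually_ge_atTop 1] with T hT
    have hT0 : 0 < T := by linarith
    have key := Complex.integral_boundary_rect_eq_zero_of_differentiableOn G (-T : ℂ) (T + T * I) (by
      intro z hz
      refine (hG z ?_).differentiableWithinAt
      have := hz.2
      simp [uIcc_of_le hT0.le] at this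
      exact this.1)
    simp only [neg_re, ofReal_re, add_re, mul_re, I_re, mul_zero, ofReal_im, I_im, sub_zero,
      zero_mul, add_zero, neg_im, neg_zero, add_im, mul_im, mul_one, zero_add, ofReal_neg,
      ofReal_zero, sub_self] at key
    have bound : ∀ z : ℂ, 0 ≤ z.im → T ≤ ‖z‖ → ‖G z‖ ≤ (T ^ 2)⁻¹ := fun z hz hTz =>
      (hb z hz (hT.trans hTz)).trans (by gcongr)
    have b1 : ‖∫ x in (-T)..T, G (x + T * I)‖ ≤ (T ^ 2)⁻¹ * |T - (-T)| := by
      refine intervalIntegral.norm_integral_le_of_norm_le_const fun x hx => bound _ (by simpa using hT0.le) ?_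
      refine le_trans ?_ (Complex.abs_im_le_norm _)
      simp [abs_of_pos hT0]
    have b2 : ‖∫ y in (0:ℝ)..T, G (T + y * I)‖ ≤ (T ^ 2)⁻¹ * |T - 0| := by
      refine intervalIntegral.norm_integral_le_of_norm_le_const fun x hx => bound _ ?_ ?_
      · rw [uIoc_of_le hT0.le] at hx; simpa using hx.1.le
      refine le_trans ?_ (Complex.abs_re_le_norm _)
      simp [abs_of_pos hT0]
    have b3 : ‖∫ y in (0:ℝ)..T, G (-T + y * I)‖ ≤ (T ^ 2)⁻¹ * |T - 0| := by
      refine intervalIntegral.norm_integral_le_of_norm_le_const fun x hx => bound _ ?_ ?_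
      · rw [uIoc_of_le hT0.le] at hx; simpa using hx.1.le
      refine le_trans ?_ (Complex.abs_re_le_norm _)
      simp [abs_of_pos hT0]
    have e : ∫ x in (-T)..T, G x = (∫ x in (-T)..T, G (x + T * I))
        - I • (∫ y in (0:ℝ)..T, G (T + y * I)) + I • ∫ y in (0:ℝ)..T, G (-T + y * I) := by
      linear_combination key
    rw [e]
    refine (norm_add_le _ _).trans ((add_le_add (norm_sub_le _ _) le_rfl).trans ?_)
    rw [norm_smul, norm_smul, norm_I, one_mul, one_mul]
    rw [sub_neg_eq_add, abs_of_pos (by linarith)] at b1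
    rw [sub_zero, abs_of_pos hT0] at b2 b3
    have : (T^2)⁻¹ * T = T⁻¹ := by field_simp
    nlinarith
  exact tendsto_nhds_unique h1 h2

/-- integrability on the line from decay -/
lemma aux_integrable_line (g : ℝ → ℂ) (hc : Continuous g)
    (hb : ∀ x : ℝ, 1 ≤ |x| → ‖g x‖ ≤ (|x| ^ 2)⁻¹) : Integrable g := by
  have key : ∀ x : ℝ, 1 ≤ |x| → ‖g x‖ ≤ 2 * ‖(1 + x ^ 2)⁻¹‖ := by
    intro x hx
    refine (hb x hx).trans ?_
    have h1 : 1 ≤ x ^ 2 := by rw [← sq_abs]; nlinarith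
    rw [sq_abs, Real.norm_of_nonneg (by positivity), ← div_eq_mul_inv,
      inv_le_comm₀ (by positivity) (by positivity), inv_div]
    linarith
  have hl : LocallyIntegrable g := hc.locallyIntegrable
  refine hl.integrable_of_isBigO_atBot_atTop (g := fun x => (1 + x ^ 2)⁻¹)
     (g' := fun x => (1 + x ^ 2)⁻¹) ?_ (integrable_inv_one_add_sq.integrableAtFilter _)
     ?_ (integrable_inv_one_add_sq.integrableAtFilter _)
  · refine Asymptotics.IsBigO.of_bound 2 ?_
    filter_upwards [eventually_le_atBot (-1 : ℝ)] with x hx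
    exact key x (by rw [abs_of_nonpos (by linarith)]; linarith)
  · refine Asymptotics.IsBigO.of_bound 2 ?_
    filter_upwards [eventually_ge_atTop (1 : ℝ)] with x hx
    exact key x (by rw [abs_of_nonneg (by linarith)]; linarith)

lemma aux_halfplane' (G : ℂ → ℂ) (hG : ∀ z : ℂ, 0 ≤ z.im → DifferentiableAt ℂ G z)
    (hb : ∀ z : ℂ, 0 ≤ z.im → 1 ≤ ‖z‖ → ‖G z‖ ≤ (‖z‖ ^ 2)⁻¹) : ∫ x : ℝ, G x = 0 := by
  refine aux_halfplane G hG hb (aux_integrable_line _ ?_ ?_)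
  · rw [continuous_iff_continuousAt]
    intro x
    exact ContinuousAt.comp (f := fun x : ℝ => (x : ℂ)) (g := G) (hG x (by simp)).continuousAt
      Complex.continuous_ofReal.continuousAt
  · intro x hx
    have := hb x (by simp) (by simpa using hx)
    simpa using this

lemma aux_norm_lin (a b : ℤ) (z : ℂ) (hz : 0 ≤ z.im) (hab : a * b ≤ 0) :
    |(a : ℝ)| * ‖z‖ ≤ ‖(a : ℂ) * (z * I) + b‖ ∧ |(b : ℝ)| ≤ ‖(a : ℂ) * (z * I) + b‖ := by
  have hab' : (a : ℝ) * b ≤ 0 := by exact_mod_cast hab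
  have e : ‖(a : ℂ) * (z * I) + b‖ ^ 2 = (b - a * z.im) ^ 2 + (a * z.re) ^ 2 := by
    rw [← Complex.normSq_eq_norm_sq, Complex.normSq_apply]
    simp
    ring
  have e2 : ‖z‖ ^ 2 = z.re ^ 2 + z.im ^ 2 := by
    rw [← Complex.normSq_eq_norm_sq, Complex.normSq_apply]; ring
  have h3 : (a : ℝ) * b * z.im ≤ 0 := mul_nonpos_of_nonpos_of_nonneg hab' hz
  constructor
  · refine le_of_sq_le_sq ?_ (norm_nonneg _)
    rw [e, mul_pow, sq_abs, e2]
    nlinarith [sq_nonneg (b : ℝ)]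
  · refine le_of_sq_le_sq ?_ (norm_nonneg _)
    rw [e, sq_abs]
    nlinarith [sq_nonneg ((a : ℝ) * z.im), sq_nonneg ((a : ℝ) * z.re)]

lemma aux_line_zero (a b c d : ℤ) (m p q : ℕ) (ha : a ≠ 0) (hc : c ≠ 0)
    (hab : a * b < 0 ∨ (b = 0 ∧ p + 1 ≤ m)) (hcd : c * d < 0) (hm : m + 2 ≤ p + q) :
    ∫ t : ℝ, (t : ℂ) ^ m * (((a : ℂ) * (t * I) + b) ^ p)⁻¹ * (((c : ℂ) * (t * I) + d) ^ q)⁻¹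
      = 0 := by
  have hab' : a * b ≤ 0 := by rcases hab with h | h; exact h.le; simp [h.1]
  have hbound : ∀ z : ℂ, 0 ≤ z.im → 1 ≤ ‖z‖ →
      ‖z ^ m * (((a : ℂ) * (z * I) + b) ^ p)⁻¹ * (((c : ℂ) * (z * I) + d) ^ q)⁻¹‖
        ≤ (‖z‖ ^ 2)⁻¹ := by
    intro z hz h1
    have h1a : (1 : ℝ) ≤ |(a : ℝ)| := by exact_mod_cast Int.one_le_abs ha
    have h1c : (1 : ℝ) ≤ |(c : ℝ)| := by exact_mod_cast Int.one_le_abs hc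
    have hA : ‖z‖ ≤ ‖(a : ℂ) * (z * I) + b‖ :=
      (by nlinarith : ‖z‖ ≤ |(a : ℝ)| * ‖z‖).trans (aux_norm_lin a b z hz hab').1
    have hC : ‖z‖ ≤ ‖(c : ℂ) * (z * I) + d‖ :=
      (by nlinarith : ‖z‖ ≤ |(c : ℝ)| * ‖z‖).trans (aux_norm_lin c d z hz hcd.le).1
    have hz0 : 0 < ‖z‖ := by linarith
    rw [norm_mul, norm_mul, norm_inv, norm_inv, norm_pow, norm_pow, norm_pow]
    calc ‖z‖ ^ m * (‖(a : ℂ) * (z * I) + b‖ ^ p)⁻¹ * (‖(c : ℂ) * (z * I) + d‖ ^ q)⁻¹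
        ≤ ‖z‖ ^ m * (‖z‖ ^ p)⁻¹ * (‖z‖ ^ q)⁻¹ := by gcongr
      _ ≤ (‖z‖ ^ 2)⁻¹ := by
        rw [mul_assoc, ← mul_inv, ← pow_add, ← div_eq_mul_inv, div_le_iff₀ (by positivity),
          ← div_eq_inv_mul, le_div_iff₀ (by positivity), ← pow_add]
        exact pow_le_pow_right₀ h1 hm
  have hCne : ∀ z : ℂ, 0 ≤ z.im → (((c : ℂ) * (z * I) + d) ^ q) ≠ 0 := by
    intro z hz
    apply pow_ne_zero
    have hd : d ≠ 0 := by rintro rfl; simp at hcd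
    have h1d : (1 : ℝ) ≤ |(d : ℝ)| := by exact_mod_cast Int.one_le_abs hd
    rw [← norm_pos_iff]
    linarith [(aux_norm_lin c d z hz hcd.le).2]
  rcases hab with hab | ⟨rfl, hp⟩
  · refine aux_halfplane' (fun z => z ^ m * (((a : ℂ) * (z * I) + b) ^ p)⁻¹ *
      (((c : ℂ) * (z * I) + d) ^ q)⁻¹) ?_ hbound
    intro z hz
    have hA : (((a : ℂ) * (z * I) + b) ^ p) ≠ 0 := by
      apply pow_ne_zero
      have hd : b ≠ 0 := by rintro rfl; simp at hab
      have h1d : (1 : ℝ) ≤ |(b : ℝ)| := by exact_mod_cast Int.one_le_abs hd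
      rw [← norm_pos_iff]
      linarith [(aux_norm_lin a b z hz hab.le).2]
    have hC := hCne z hz
    fun_prop (disch := assumption)
  · have e : ∀ z : ℂ, z ^ m * (((a : ℂ) * (z * I) + (0 : ℤ)) ^ p)⁻¹ *
      (((c : ℂ) * (z * I) + d) ^ q)⁻¹ =
        z ^ (m - p) * (((a : ℂ) * I) ^ p)⁻¹ * (((c : ℂ) * (z * I) + d) ^ q)⁻¹ := by
      intro z
      congr 1
      rcases eq_or_ne z 0 with rfl | hz
      · rw [zero_pow (by lia), zero_pow (by lia)]; simp
      · obtain ⟨k, rfl⟩ : ∃ k, m = p + k := ⟨m - p, by lia⟩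
        rw [show (a : ℂ) * (z * I) + (0 : ℤ) = z * (a * I) by push_cast; ring, mul_pow, mul_inv,
          pow_add, Nat.add_sub_cancel_left]
        field_simp
    have := aux_halfplane' (fun z => z ^ m * (((a : ℂ) * (z * I) + (0 : ℤ)) ^ p)⁻¹ *
      (((c : ℂ) * (z * I) + d) ^ q)⁻¹) (fun z hz => ?_) hbound
    · exact this
    · simp_rw [e]
      have hC := hCne z hz
      fun_prop (disch := assumption)

lemma aux_line_zero' (a b c d : ℤ) (m p q : ℕ) (ha : a ≠ 0) (hc : c ≠ 0) (hd : d ≠ 0)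
    (hdet : a * d - b * c = 1) (hp : p + 1 ≤ m) (hm : m + 2 ≤ p + q) :
    ∫ t : ℝ, (t : ℂ) ^ m * (((a : ℂ) * (t * I) + b) ^ p)⁻¹ * (((c : ℂ) * (t * I) + d) ^ q)⁻¹
      = 0 := by
  have hcd0 : c * d ≠ 0 := mul_ne_zero hc hd
  have hsign : b = 0 ∨ (a * b < 0 ∧ c * d < 0) ∨ (0 < a * b ∧ 0 < c * d) := by
    by_cases hb : b = 0
    · exact Or.inl hb
    right
    have hab0 : a * b ≠ 0 := mul_ne_zero ha hb
    have : 0 < (a * b) * (c * d) := by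
      have h1 : (a * b) * (c * d) = (b * c + 1) * (b * c) := by
        have : a * d = b * c + 1 := by lia
        rw [← this]; ring
      have h2 : b * c ≠ 0 := mul_ne_zero hb hc
      have h3 : b * c + 1 ≠ 0 := by
        have : b * c + 1 = a * d := by lia
        rw [this]; exact mul_ne_zero ha hd
      rw [h1]
      rcases lt_or_gt_of_ne h2 with h | h
      · have : b * c + 1 < 0 := by lia
        nlinarith
      · nlinarith
    rcases lt_or_gt_of_ne hcd0 with h | h
    · left; exact ⟨by nlinarith, h⟩
    · right; exact ⟨by nlinarith, h⟩
  have pos : (b = 0 ∨ 0 < a * b) → 0 < c * d → ∫ t : ℝ, (t : ℂ) ^ m *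
      (((a : ℂ) * (t * I) + b) ^ p)⁻¹ * (((c : ℂ) * (t * I) + d) ^ q)⁻¹ = 0 := by
    intro hab hcd
    have := aux_line_zero (-a) b (-c) d m p q (by simpa) (by simpa)
      (by rcases hab with h | h; exact Or.inr ⟨h, hp⟩; left; linarith) (by linarith) hm
    rw [← integral_neg_eq_self] 
    have e : ∀ t : ℝ, (((-t : ℝ)) : ℂ) ^ m * (((a : ℂ) * (((-t : ℝ)) * I) + b) ^ p)⁻¹ *
        (((c : ℂ) * (((-t : ℝ) : ℂ) * I) + d) ^ q)⁻¹ = (-1) ^ m * ((t : ℂ) ^ m *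
        ((((-a : ℤ) : ℂ) * (t * I) + b) ^ p)⁻¹ * ((((-c : ℤ) : ℂ) * (t * I) + d) ^ q)⁻¹) := by
      intro t
      rw [ofReal_neg, neg_pow (t : ℂ)]
      push_cast
      ring_nf
    simp_rw [e]
    rw [integral_const_mul, this, mul_zero]
  rcases hsign with h | h | h
  · rcases lt_or_gt_of_ne hcd0 with h' | h'
    · exact aux_line_zero a b c d m p q ha hc (Or.inr ⟨h, hp⟩) h' hm
    · exact pos (Or.inl h) h'
  · exact aux_line_zero a b c d m p q ha hc (Or.inl h.1) h.2 hm
  · exact pos (Or.inr h.1) h.2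
end PartC1

section PartC2
open Complex Filter Topology Set

/-- term of the series -/
def tm (p q : ℕ) (g : Matrix.SpecialLinearGroup (Fin 2) ℤ) (z : ℂ) : ℂ :=
  (((g 0 0 : ℤ) * z + (g 0 1 : ℤ) : ℂ) ^ p)⁻¹ * (((g 1 0 : ℤ) * z + (g 1 1 : ℤ) : ℂ) ^ q)⁻¹

def ss (x : ℝ) : ℝ := √|x| ^ 3

lemma ss_nonneg (x : ℝ) : 0 ≤ ss x := by unfold ss; positivity

lemma ss_mul (x y : ℝ) : ss (x * y) = ss x * ss y := by
  unfold ss; rw [abs_mul, Real.sqrt_mul (abs_nonneg _), mul_pow]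

lemma ss_sq (x : ℝ) (hx : 0 ≤ x) : ss x * ss x = x ^ 3 := by
  unfold ss
  rw [abs_of_nonneg hx, ← mul_pow, Real.mul_self_sqrt hx]

lemma ss_mono {x y : ℝ} (h : |x| ≤ |y|) : ss x ≤ ss y := by
  unfold ss; gcongr

lemma ss_le_pow {x : ℝ} (hx : 1 ≤ x) {q : ℕ} (hq : 2 ≤ q) : ss x ≤ x ^ q := by
  have h0 : 0 ≤ x := by linarith
  have h1 : x ^ 2 ≤ x ^ q := pow_le_pow_right₀ hx hq
  refine le_trans ?_ h1
  unfold ss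
  rw [abs_of_nonneg h0]
  have h2 : 1 ≤ √x := Real.one_le_sqrt.2 hx
  have h3 : x ^ 2 = √x ^ 4 := by
    rw [show √x ^ 4 = (√x ^ 2) ^ 2 by ring, Real.sq_sqrt h0]
  rw [h3]
  exact pow_le_pow_right₀ h2 (by norm_num)

lemma ss_ge_sq {x : ℝ} (h0 : 0 ≤ x) (hx : x ≤ 1) : x ^ 2 ≤ ss x := by
  unfold ss
  rw [abs_of_nonneg h0]
  have h2 : √x ≤ 1 := Real.sqrt_le_one.2 hx
  have h3 : x ^ 2 = √x ^ 4 := by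
    rw [show √x ^ 4 = (√x ^ 2) ^ 2 by ring, Real.sq_sqrt h0]
  rw [h3]
  exact pow_le_pow_of_le_one (Real.sqrt_nonneg _) h2 (by norm_num)

lemma ss_one_le {x : ℝ} (h : 1 ≤ |x|) : 1 ≤ ss x := by
  unfold ss
  exact one_le_pow₀ (Real.one_le_sqrt.2 h)

lemma ss_pow_ge {X u v : ℝ} (hX : 1 ≤ X) (hu : |u| ≤ X) (hv : |v| ≤ X) {p : ℕ} (hp : 3 ≤ p) :
    ss u * ss v ≤ X ^ p := by
  have h0 : 0 ≤ X := by linarith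
  calc ss u * ss v ≤ ss X * ss X := by
        exact mul_le_mul (ss_mono (by rwa [abs_of_nonneg h0])) (ss_mono (by rwa [abs_of_nonneg h0]))
          (ss_nonneg _) (ss_nonneg _)
    _ = X ^ 3 := ss_sq X h0
    _ ≤ X ^ p := pow_le_pow_right₀ hX hp

def phi (t : ℝ) : ℝ := if t ≤ 1 then 1 else (ss t)⁻¹

lemma phi_integrable : IntegrableOn phi (Ioi 0) := by
  rw [← Ioc_union_Ioi_eq_Ioi (zero_le_one' ℝ)]
  refine IntegrableOn.union ?_ ?_
  · refine (integrableOn_const (C := (1:ℝ)) (by simp) (by simp)).congr_fun ?_ measurableSet_Ioc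
    intro x hx
    simp [phi, hx.2]
  · refine (integrableOn_Ioi_rpow_of_lt (a := -(3/2)) (by norm_num) zero_lt_one).congr_fun ?_ measurableSet_Ioi
    intro x hx
    have hx' : 1 < x := hx
    have : 0 < x := by linarith
    simp only [phi, not_le.2 hx', if_false, ss, abs_of_pos this]
    rw [Real.rpow_neg this.le, Real.sqrt_eq_rpow, ← Real.rpow_natCast, ← Real.rpow_mul this.le]
    norm_num

def bd (a b c d : ℝ) : ℝ := (ss a)⁻¹ * (ss (max |b| 1))⁻¹ * (ss c)⁻¹ + (ss (max |b| 1))⁻¹ * (ss c)⁻¹ * (ss d)⁻¹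

lemma bd_nonneg (a b c d : ℝ) : 0 ≤ bd a b c d := by
  unfold bd
  have := ss_nonneg a
  have := ss_nonneg c
  have := ss_nonneg d
  have := ss_nonneg (max |b| 1)
  positivity

lemma aux_norm_ge (a b t : ℝ) (ht : 0 < t) : |a| * t ≤ ‖(a : ℂ) * (t * I) + b‖ ∧ |b| ≤ ‖(a : ℂ) * (t * I) + b‖ := by
  constructor
  · have := abs_im_le_norm ((a : ℂ) * (t * I) + b)
    simpa [abs_mul, abs_of_pos ht] using this
  · have := abs_re_le_norm ((a : ℂ) * (t * I) + b)
    simpa using this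

lemma aux_bound (a b c d : ℤ) (m p q : ℕ) (ha : a ≠ 0) (hc : c ≠ 0) (hd : d ≠ 0)
    (hdet : a * d - b * c = 1) (hp3 : 3 ≤ p) (hq3 : 3 ≤ q) (hp : p + 2 ≤ m) (hm : m + 3 ≤ p + q) (t : ℝ) (ht : 0 < t) :
    ‖(t : ℂ) ^ m * ((((a : ℂ) * (t * I) + b) ^ p)⁻¹ * (((c : ℂ) * (t * I) + d) ^ q)⁻¹)‖
      ≤ bd a b c d * phi t := by
  have ha1 : (1:ℝ) ≤ |(a:ℝ)| := by exact_mod_cast Int.one_le_abs ha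
  have hc1 : (1:ℝ) ≤ |(c:ℝ)| := by exact_mod_cast Int.one_le_abs hc
  have hd1 : (1:ℝ) ≤ |(d:ℝ)| := by exact_mod_cast Int.one_le_abs hd
  obtain ⟨hX1, hX2⟩ := aux_norm_ge a b t ht
  obtain ⟨hY1, hY2⟩ := aux_norm_ge c d t ht
  simp only [ofReal_intCast] at hX1 hX2 hY1 hY2
  rw [norm_mul, norm_mul, norm_inv, norm_inv, norm_pow, norm_pow, norm_pow, norm_real, Real.norm_eq_abs, abs_of_pos ht]
  set X := ‖(a : ℂ) * (t * I) + b‖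
  set Y := ‖(c : ℂ) * (t * I) + d‖
  have sa := ss_one_le ha1
  have sc := ss_one_le hc1
  have sd := ss_one_le hd1
  have hb1 : (1:ℝ) ≤ |max |(b:ℝ)| 1| := le_trans (le_max_right _ _) (le_abs_self _)
  have hb2 : |max |(b:ℝ)| 1| = max |(b:ℝ)| 1 := abs_of_nonneg (le_trans zero_le_one (le_max_right _ _))
  have sb := ss_one_le hb1
  have hXpos : 0 < X := lt_of_lt_of_le (by positivity) hX1
  have hYpos : 0 < Y := lt_of_lt_of_le (by positivity) hY1
  have hkey : ∀ s u v w : ℝ, 1 ≤ s → 1 ≤ u → 1 ≤ v → 0 < w → t ^ m * (s * u * v) ≤ X ^ p * Y ^ q * w → 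
      t ^ m * ((X ^ p)⁻¹ * (Y ^ q)⁻¹) ≤ s⁻¹ * u⁻¹ * v⁻¹ * w := by
    intro s u v w hs hu hv hw h
    rw [← mul_inv, ← mul_inv, ← mul_inv, ← div_eq_mul_inv, inv_mul_eq_div, div_le_div_iff₀ (by positivity) (by positivity)]
    linarith
  by_cases h1 : t ≤ 1
  · have : t ^ m * ((X ^ p)⁻¹ * (Y ^ q)⁻¹) ≤ (ss (max |(b:ℝ)| 1))⁻¹ * (ss c)⁻¹ * (ss d)⁻¹ * 1 := by
      refine hkey _ _ _ _ sb sc sd one_pos ?_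
      have hYq : t ^ 2 * (ss c * ss d) ≤ Y ^ q := by
        calc t ^ 2 * (ss c * ss d) ≤ ss t * (ss c * ss d) := by gcongr; exact ss_ge_sq ht.le h1
          _ = ss (c * t) * ss d := by rw [ss_mul]; ring
          _ ≤ Y ^ q := ss_pow_ge (hd1.trans hY2) (by rwa [abs_mul, abs_of_pos ht]) hY2 hq3
      have h2 : t ^ m ≤ t ^ (p + 2) := pow_le_pow_of_le_one ht.le h1 hp
      by_cases hb : b = 0
      · have hss : ss (max |((0:ℤ):ℝ)| 1) = 1 := by simp [ss]
        have hXp : t ^ p ≤ X ^ p := by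
          gcongr
          nlinarith
        subst hb
        rw [hss, mul_one, one_mul]
        calc t ^ m * (ss c * ss d) ≤ t ^ (p + 2) * (ss c * ss d) := by gcongr
          _ = t ^ p * (t ^ 2 * (ss c * ss d)) := by ring
          _ ≤ X ^ p * Y ^ q := by gcongr
      · have hb3 : (1:ℝ) ≤ |(b:ℝ)| := by exact_mod_cast Int.one_le_abs hb
        have hXp : ss (max |(b:ℝ)| 1) ≤ X ^ p := by
          rw [max_eq_left hb3]
          have := ss_pow_ge (u := 1) (v := b) (hb3.trans hX2) (by simpa using hb3.trans hX2) hX2 hp3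
          simpa [ss] using this
        have h3 : t ^ m ≤ t ^ 2 := pow_le_pow_of_le_one ht.le h1 (by omega)
        calc t ^ m * (ss (max |(b:ℝ)| 1) * ss c * ss d) ≤ t ^ 2 * (ss (max |(b:ℝ)| 1) * ss c * ss d) := by gcongr
          _ = ss (max |(b:ℝ)| 1) * (t ^ 2 * (ss c * ss d)) := by ring
          _ ≤ X ^ p * Y ^ q := by gcongr
          _ = _ := by ring
    rw [phi, if_pos h1]
    refine this.trans ?_
    gcongr
    unfold bd
    have : 0 ≤ (ss a)⁻¹ * (ss (max |(b:ℝ)| 1))⁻¹ * (ss c)⁻¹ := by positivity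
    linarith
  · have h1' : 1 < t := not_le.1 h1
    have st : 1 ≤ ss t := ss_one_le (by rw [abs_of_pos ht]; exact h1'.le)
    have : t ^ m * ((X ^ p)⁻¹ * (Y ^ q)⁻¹) ≤ (ss a)⁻¹ * (ss (max |(b:ℝ)| 1))⁻¹ * (ss c)⁻¹ * (ss t)⁻¹ := by
      refine hkey _ _ _ _ sa sb sc (by positivity) ?_
      rw [← div_eq_mul_inv, le_div_iff₀ (by positivity)]
      have htX : t ≤ X := by nlinarith
      have hX1' : 1 ≤ X := by linarith
      have hXp : t ^ (p - 3) * (ss a * ss t * ss (max |(b:ℝ)| 1)) ≤ X ^ p := by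
        have := ss_pow_ge (u := a * t) (v := max |(b:ℝ)| 1) hX1' (by rwa [abs_mul, abs_of_pos ht]) (by rw [hb2]; exact max_le hX2 hX1') le_rfl
        rw [ss_mul] at this
        calc _ ≤ X ^ (p - 3) * X ^ 3 := by gcongr
          _ = X ^ p := by rw [← pow_add]; congr 1; omega
      have hYq : t ^ q * ss c ≤ Y ^ q := by
        calc t ^ q * ss c ≤ t ^ q * |(c:ℝ)| ^ q := by
              gcongr
              have := ss_le_pow hc1 (q := q) (by omega)
              simpa [ss] using this
          _ = (|(c:ℝ)| * t) ^ q := by ring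
          _ ≤ Y ^ q := by gcongr
      have h2 : t ^ m ≤ t ^ (p - 3 + q) := pow_le_pow_right₀ h1'.le (by omega)
      calc t ^ m * (ss a * ss (max |(b:ℝ)| 1) * ss c) * ss t ≤ t ^ (p - 3 + q) * (ss a * ss (max |(b:ℝ)| 1) * ss c) * ss t := by gcongr
        _ = (t ^ (p - 3) * (ss a * ss t * ss (max |(b:ℝ)| 1))) * (t ^ q * ss c) := by ring
        _ ≤ X ^ p * Y ^ q := by gcongr
    rw [phi, if_neg h1]
    refine this.trans ?_
    gcongr
    unfold bd
    have : 0 ≤ (ss (max |(b:ℝ)| 1))⁻¹ * (ss c)⁻¹ * (ss d)⁻¹ := by positivity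
    linarith
end PartC2

section PartC3
open Complex Filter Topology Set
open CongruenceSubgroup

lemma summ_ss : Summable fun n : ℤ => (ss n)⁻¹ := by
  refine (Real.summable_abs_int_rpow (b := 3/2) (by norm_num)).congr ?_
  intro n
  unfold ss
  rw [Real.rpow_neg (abs_nonneg _), Real.sqrt_eq_rpow, ← Real.rpow_natCast, ← Real.rpow_mul (abs_nonneg _)]
  norm_num

lemma summ_ss' : Summable fun n : ℤ => (ss (max |(n:ℝ)| 1))⁻¹ := by
  refine (summable_congr_cofinite ?_).1 summ_ss
  have : ∀ᶠ n : ℤ in cofinite, n ≠ 0 := by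
    rw [Filter.eventually_cofinite]; simp
  filter_upwards [this] with n hn
  have : (1:ℝ) ≤ |(n:ℝ)| := by exact_mod_cast Int.one_le_abs hn
  rw [max_eq_left this]; simp [ss]

lemma summ_3 : Summable fun x : ℤ × ℤ × ℤ => (ss x.1)⁻¹ * ((ss (max |(x.2.1:ℝ)| 1))⁻¹ * (ss x.2.2)⁻¹) := by
  have h0 : ∀ x : ℝ, 0 ≤ (ss x)⁻¹ := fun x => inv_nonneg.2 (ss_nonneg x)
  refine summ_ss.mul_of_nonneg (summ_ss'.mul_of_nonneg summ_ss (fun _ => h0 _) (fun _ => h0 _)) (fun _ => h0 _) ?_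
  intro x
  exact mul_nonneg (h0 _) (h0 _)

lemma g02_c (γ : Gamma0 2) : (2:ℤ) ∣ γ.1 1 0 := by
  have := γ.2
  rw [Gamma0_mem] at this
  exact (ZMod.intCast_zmod_eq_zero_iff_dvd _ 2).1 this

lemma sl_det (g : Matrix.SpecialLinearGroup (Fin 2) ℤ) : g 0 0 * g 1 1 - g 0 1 * g 1 0 = 1 := by
  have := g.det_coe
  rwa [Matrix.det_fin_two] at this

lemma g02_a (γ : Gamma0 2) : γ.1 0 0 ≠ 0 := by
  intro h
  have h1 := sl_det γ.1
  obtain ⟨k, hk⟩ := g02_c γ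
  rw [h, hk] at h1
  have : 2 * (γ.1 0 1 * k) = -1 := by linarith
  omega

lemma g02_d (γ : Gamma0 2) : γ.1 1 1 ≠ 0 := by
  intro h
  have h1 := sl_det γ.1
  obtain ⟨k, hk⟩ := g02_c γ
  rw [h, hk] at h1
  have : 2 * (γ.1 0 1 * k) = -1 := by linarith
  omega

/-- the elements with nonzero lower left entry -/
abbrev NC : Set (Gamma0 2) := {γ | γ.1 1 0 ≠ 0}

instance countSL : Countable (Matrix.SpecialLinearGroup (Fin 2) ℤ) :=
  @Function.Injective.countable _ (Fin 2 → Fin 2 → ℤ) inferInstance (fun g => g.1) Subtype.val_injective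

lemma sl_ext (g h : Matrix.SpecialLinearGroup (Fin 2) ℤ) (h00 : g 0 0 = h 0 0) (h01 : g 0 1 = h 0 1)
    (h10 : g 1 0 = h 1 0) (h11 : g 1 1 = h 1 1) : g = h := by
  ext i j
  fin_cases i <;> fin_cases j <;> assumption

lemma summ_bd : Summable fun γ : NC => bd (γ.1.1 0 0 : ℤ) (γ.1.1 0 1 : ℤ) (γ.1.1 1 0 : ℤ) (γ.1.1 1 1 : ℤ) := by
  unfold bd
  refine Summable.add ?_ ?_
  · have hinj : Function.Injective fun γ : NC => ((γ.1.1 0 0, γ.1.1 0 1, γ.1.1 1 0) : ℤ × ℤ × ℤ) := by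
      intro g h hgh
      simp only [Prod.mk.injEq] at hgh
      obtain ⟨h1, h2, h3⟩ := hgh
      apply Subtype.ext; apply Subtype.ext
      refine sl_ext _ _ h1 h2 h3 ?_
      have e1 := sl_det g.1.1
      have e2 := sl_det h.1.1
      rw [← h1, ← h2, ← h3] at e2
      have : g.1.1 0 0 * (g.1.1 1 1 - h.1.1 1 1) = 0 := by linarith
      rcases mul_eq_zero.1 this with h | h
      · exact absurd h (g02_a _)
      · linarith
    refine (summ_3.comp_injective hinj).congr ?_
    intro γ
    simp only [Function.comp]
    ring
  · have hinj : Function.Injective fun γ : NC => ((γ.1.1 1 0, γ.1.1 0 1, γ.1.1 1 1) : ℤ × ℤ × ℤ) := by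
      intro g h hgh
      simp only [Prod.mk.injEq] at hgh
      obtain ⟨h3, h2, h1⟩ := hgh
      apply Subtype.ext; apply Subtype.ext
      refine sl_ext _ _ ?_ h2 h3 h1
      have e1 := sl_det g.1.1
      have e2 := sl_det h.1.1
      rw [← h1, ← h2, ← h3] at e2
      have : (g.1.1 0 0 - h.1.1 0 0) * g.1.1 1 1 = 0 := by linarith
      rcases mul_eq_zero.1 this with h | h
      · linarith
      · exact absurd h (g02_d _)
    refine (summ_3.comp_injective hinj).congr ?_
    intro γ
    simp only [Function.comp]
    ring

def epsg (g : Matrix.SpecialLinearGroup (Fin 2) ℤ) : Matrix.SpecialLinearGroup (Fin 2) ℤ :=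
  ⟨!![g 0 0, -g 0 1; -g 1 0, g 1 1], by
    rw [Matrix.det_fin_two_of]; have := sl_det g; linarith⟩

lemma epsg_epsg (g) : epsg (epsg g) = g := by
  apply sl_ext <;> simp [epsg]

def epsNC : NC ≃ NC where
  toFun γ := ⟨⟨epsg γ.1.1, by
    rw [Gamma0_mem]; have := γ.1.2; rw [Gamma0_mem] at this; simp [epsg, this]⟩, by
    have h := γ.2; change -(γ.1.1 1 0) ≠ 0; exact neg_ne_zero.2 h⟩
  invFun γ := ⟨⟨epsg γ.1.1, by
    rw [Gamma0_mem]; have := γ.1.2; rw [Gamma0_mem] at this; simp [epsg, this]⟩, by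
    have h := γ.2; change -(γ.1.1 1 0) ≠ 0; exact neg_ne_zero.2 h⟩
  left_inv γ := by apply Subtype.ext; apply Subtype.ext; exact epsg_epsg _
  right_inv γ := by apply Subtype.ext; apply Subtype.ext; exact epsg_epsg _

def um (m p q : ℕ) (γ : Gamma0 2) (t : ℝ) : ℂ := (t : ℂ) ^ m * tm p q γ.1 (t * I)

lemma um_measurable (m p q : ℕ) (γ : Gamma0 2) : Measurable (um m p q γ) := by
  unfold um tm; fun_prop

lemma um_bound (m p q : ℕ) (hp3 : 3 ≤ p) (hq3 : 3 ≤ q) (hp : p + 2 ≤ m) (hm : m + 3 ≤ p + q) (γ : NC) (t : ℝ) (ht : 0 < t) :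
    ‖um m p q γ.1 t‖ ≤ bd (γ.1.1 0 0 : ℤ) (γ.1.1 0 1 : ℤ) (γ.1.1 1 0 : ℤ) (γ.1.1 1 1 : ℤ) * phi t :=
  aux_bound _ _ _ _ m p q (g02_a γ.1) γ.2 (g02_d γ.1) (sl_det _) hp3 hq3 hp hm t ht

lemma um_integrable (m p q : ℕ) (hp3 : 3 ≤ p) (hq3 : 3 ≤ q) (hp : p + 2 ≤ m) (hm : m + 3 ≤ p + q) (γ : NC) :
    IntegrableOn (um m p q γ.1) (Ioi 0) := by
  refine Integrable.mono' (phi_integrable.const_mul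
    (bd (γ.1.1 0 0 : ℤ) (γ.1.1 0 1 : ℤ) (γ.1.1 1 0 : ℤ) (γ.1.1 1 1 : ℤ)))
    (um_measurable _ _ _ _).aestronglyMeasurable ?_
  · filter_upwards [ae_restrict_mem measurableSet_Ioi] with t ht
    exact um_bound m p q hp3 hq3 hp hm γ t ht

lemma um_pair (m p q : ℕ) (hp3 : 3 ≤ p) (hq3 : 3 ≤ q) (hp : p + 2 ≤ m) (hm : m + 3 ≤ p + q)
    (hpo : Odd p) (hmo : Odd m) (γ : NC) :
    (∫ t in Ioi (0:ℝ), um m p q γ.1 t) + ∫ t in Ioi (0:ℝ), um m p q (epsNC γ).1 t = 0 := by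
  have hneg : ∀ t : ℝ, um m p q (epsNC γ).1 t = um m p q γ.1 (-t) := by
    intro t
    simp only [um, tm, epsNC, epsg, Equiv.coe_fn_mk]
    simp only [Matrix.of_apply, Matrix.cons_val', Matrix.cons_val_zero, Matrix.cons_val_one, Matrix.cons_val_fin_one, Int.cast_neg, ofReal_neg]
    rw [hmo.neg_pow]
    have : (((γ.1.1 0 0 : ℤ) : ℂ) * (-(t:ℂ) * I) + (γ.1.1 0 1 : ℤ)) = -(((γ.1.1 0 0 : ℤ) : ℂ) * ((t:ℂ) * I) + -(γ.1.1 0 1 : ℤ)) := by ring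
    rw [this, hpo.neg_pow, inv_neg]
    have : (((γ.1.1 1 0 : ℤ) : ℂ) * (-(t:ℂ) * I)) = (-((γ.1.1 1 0 : ℤ) : ℂ) * ((t:ℂ) * I)) := by ring
    rw [this]
    ring
  have hI := um_integrable m p q hp3 hq3 hp hm γ
  have hI2 := um_integrable m p q hp3 hq3 hp hm (epsNC γ)
  have hz := aux_line_zero' _ _ _ _ m p q (g02_a γ.1) γ.2 (g02_d γ.1) (sl_det _) (by omega) (by omega)
  simp_rw [hneg]
  rw [integral_comp_neg_Ioi, neg_zero, add_comm, intervalIntegral.integral_Iic_add_Ioi _ hI]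
  · simp only [um, tm]
    simp only [mul_assoc] at hz ⊢
    exact hz
  · have : IntegrableOn (fun t => um m p q γ.1 (-t)) (Ioi 0) := by
      simpa only [← hneg] using hI2
    have h2 := this.comp_neg
    rw [integrableOn_Iic_iff_integrableOn_Iio]
    simpa using h2

lemma NC_integral (m p q : ℕ) (hp3 : 3 ≤ p) (hq3 : 3 ≤ q) (hp : p + 2 ≤ m) (hm : m + 3 ≤ p + q)
    (hpo : Odd p) (hmo : Odd m) : IntegrableOn (fun t => ∑' γ : NC, um m p q γ.1 t) (Ioi 0) ∧
    ∫ t in Ioi (0:ℝ), ∑' γ : NC, um m p q γ.1 t = 0 := by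
  have hsum : Summable fun γ : NC => ∫ t in Ioi (0:ℝ), ‖um m p q γ.1 t‖ := by
    refine Summable.of_nonneg_of_le (fun γ => integral_nonneg fun _ => norm_nonneg _) ?_
      (summ_bd.mul_right (∫ t in Ioi (0:ℝ), phi t))
    intro γ
    rw [← integral_const_mul]
    refine setIntegral_mono_on (um_integrable m p q hp3 hq3 hp hm γ).norm (phi_integrable.const_mul _) measurableSet_Ioi ?_
    intro t ht
    exact um_bound m p q hp3 hq3 hp hm γ t ht
  have h := hasSum_integral_of_summable_integral_norm (um_integrable m p q hp3 hq3 hp hm ·) hsum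
  constructor
  · have hs : ∀ t > 0, Summable fun γ : NC => ‖um m p q γ.1 t‖ := by
      intro t ht
      refine Summable.of_nonneg_of_le (fun _ => norm_nonneg _) (fun γ => um_bound m p q hp3 hq3 hp hm γ t ht) 
        (summ_bd.mul_right (phi t))
    refine Integrable.mono' (phi_integrable.const_mul (∑' γ : NC, bd (γ.1.1 0 0 : ℤ) (γ.1.1 0 1 : ℤ) (γ.1.1 1 0 : ℤ) (γ.1.1 1 1 : ℤ))) ?_ ?_
    · refine (Measurable.tsum ?_).aestronglyMeasurable
      intro γ
      exact um_measurable _ _ _ _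
    · filter_upwards [ae_restrict_mem measurableSet_Ioi] with t ht
      refine (norm_tsum_le_tsum_norm (hs t ht)).trans ?_
      rw [← tsum_mul_right]
      exact (hs t ht).tsum_le_tsum (fun γ => um_bound m p q hp3 hq3 hp hm γ t ht) (summ_bd.mul_right (phi t))
  · have h' := (epsNC.hasSum_iff (f := fun γ : NC => ∫ t in Ioi (0:ℝ), um m p q γ.1 t)).2 h
    have h2 := h.add h'
    have h3 : (fun γ : NC => (∫ t in Ioi (0:ℝ), um m p q γ.1 t) + ((fun γ : NC => ∫ t in Ioi (0:ℝ), um m p q γ.1 t) ∘ epsNC) γ) = fun _ => 0 := by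
      funext γ
      exact um_pair m p q hp3 hq3 hp hm hpo hmo γ
    rw [h3] at h2
    have := h2.unique hasSum_zero
    have h4 : (2:ℂ) * (∫ t in Ioi (0:ℝ), ∑' γ : NC, um m p q γ.1 t) = 0 := by rw [two_mul]; exact this
    simpa using h4
end PartC3

section PartB1
open Complex Filter Topology Set UpperHalfPlane EisensteinSeries
open CongruenceSubgroup
open scoped MatrixGroups ModularForm

def row (g : SL(2, ℤ)) (i : Fin 2) : Fin 2 → ℤ := fun j => g i j

lemma row_ne (g : SL(2, ℤ)) (i : Fin 2) : row g i ≠ 0 := by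
  intro h
  have h0 : g i 0 = 0 := congrFun h 0
  have h1 : g i 1 = 0 := congrFun h 1
  have := sl_det g
  fin_cases i <;> simp_all

lemma row_norm (g : SL(2, ℤ)) (i : Fin 2) : 1 ≤ ‖row g i‖ := by
  rw [norm_eq_max_natAbs]
  have := row_ne g i
  have h : 1 ≤ max (row g i 0).natAbs (row g i 1).natAbs := by
    by_contra hh
    apply this
    funext j
    fin_cases j <;> simp <;> omega
  exact_mod_cast h

lemma summ_rows (p q : ℕ) (hp : 3 ≤ p) (hq : 3 ≤ q) :
    Summable fun g : SL(2, ℤ) => (‖row g 0‖ ^ p)⁻¹ * (‖row g 1‖ ^ q)⁻¹ := by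
  have h : ∀ p : ℕ, 3 ≤ p → Summable fun x : Fin 2 → ℤ => (‖x‖ ^ p)⁻¹ := by
    intro p hp
    refine (summable_one_div_norm_rpow (k := p) (by exact_mod_cast hp)).congr ?_
    intro x
    rw [Real.rpow_neg (norm_nonneg _), Real.rpow_natCast]
  have h0 : ∀ (p : ℕ) (x : Fin 2 → ℤ), 0 ≤ (‖x‖ ^ p)⁻¹ := fun p x => inv_nonneg.2 (pow_nonneg (norm_nonneg x) p)
  have h2 := (h p hp).mul_of_nonneg (h q hq) (h0 p) (h0 q)
  have hinj : Function.Injective fun g : SL(2, ℤ) => (row g 0, row g 1) := by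
    intro g h hgh
    simp only [Prod.mk.injEq] at hgh
    exact sl_ext g h (congrFun hgh.1 0) (congrFun hgh.1 1) (congrFun hgh.2 0) (congrFun hgh.2 1)
  have h3 := h2.comp_injective hinj
  simpa only [Function.comp_def] using h3

lemma lin_ge {A B : ℝ} (hB : 0 < B) (z : ℍ) (hz : z ∈ verticalStrip A B) (g : SL(2, ℤ)) (i : Fin 2) :
    r ⟨⟨A, B⟩, hB⟩ * ‖row g i‖ ≤ ‖((g i 0 : ℤ) : ℂ) * z + (g i 1 : ℤ)‖ := by
  refine le_trans ?_ (r_mul_max_le z (row_ne g i))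
  exact mul_le_mul_of_nonneg_right (r_lower_bound_on_verticalStrip z hB hz) (norm_nonneg _)

lemma tm_bound (p q : ℕ) {A B : ℝ} (hB : 0 < B) (z : ℍ) (hz : z ∈ verticalStrip A B) (g : SL(2, ℤ)) :
    ‖tm p q g z‖ ≤ ((r ⟨⟨A, B⟩, hB⟩ ^ p)⁻¹ * (r ⟨⟨A, B⟩, hB⟩ ^ q)⁻¹) * ((‖row g 0‖ ^ p)⁻¹ * (‖row g 1‖ ^ q)⁻¹) := by
  have hr := r_pos ⟨⟨A, B⟩, hB⟩
  have h0 := row_norm g 0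
  have h1 := row_norm g 1
  have : ((r ⟨⟨A, B⟩, hB⟩ ^ p)⁻¹ * (r ⟨⟨A, B⟩, hB⟩ ^ q)⁻¹) * ((‖row g 0‖ ^ p)⁻¹ * (‖row g 1‖ ^ q)⁻¹)
    = ((r ⟨⟨A, B⟩, hB⟩ * ‖row g 0‖) ^ p)⁻¹ * ((r ⟨⟨A, B⟩, hB⟩ * ‖row g 1‖) ^ q)⁻¹ := by
    rw [mul_pow, mul_pow, mul_inv, mul_inv]; ring
  rw [this, tm, norm_mul, norm_inv, norm_inv, norm_pow, norm_pow]
  gcongr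
  · exact lin_ge hB z hz g 0
  · exact lin_ge hB z hz g 1

lemma tm_summable (p q : ℕ) (hp : 3 ≤ p) (hq : 3 ≤ q) (z : ℍ) : Summable fun g : SL(2, ℤ) => ‖tm p q g z‖ := by
  have hz : z ∈ verticalStrip |z.re| z.im := by simp [mem_verticalStrip_iff]
  exact Summable.of_nonneg_of_le (fun _ => norm_nonneg _) (fun g => tm_bound p q z.im_pos z hz g)
    ((summ_rows p q hp hq).mul_left _)

/-- partial series over a subset -/
def PS (S : Set SL(2, ℤ)) (p q : ℕ) (z : ℂ) : ℂ := ∑' g : S, tm p q g.1 z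

lemma tm_diff (p q : ℕ) (g : SL(2, ℤ)) : DifferentiableOn ℂ (tm p q g) {z : ℂ | 0 < z.im} := by
  have h := div_linear_zpow_differentiableOn p (row g 0)
  have h' := div_linear_zpow_differentiableOn q (row g 1)
  refine (h.mul h').congr ?_
  intro z _
  simp [tm, row, zpow_neg]

lemma PS_diff (S : Set SL(2, ℤ)) (p q : ℕ) (hp : 3 ≤ p) (hq : 3 ≤ q) :
    DifferentiableOn ℂ (PS S p q) {z : ℂ | 0 < z.im} := by
  have h1 : TendstoLocallyUniformlyOn (fun (s : Finset S) (z : ℂ) => ∑ g ∈ s, tm p q g.1 z) (PS S p q) atTop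
      {z : ℂ | 0 < z.im} := by
    rw [tendstoLocallyUniformlyOn_iff_forall_isCompact isOpen_upperHalfPlaneSet]
    intro K hK hKc
    have hKc' : IsCompact ((fun z : ℍ => (z : ℂ)) ⁻¹' K) := by
      refine (isEmbedding_coe.isCompact_iff).2 ?_
      rwa [image_preimage_eq_of_subset]
      intro z hz
      exact ⟨⟨z, hK hz⟩, rfl⟩
    obtain ⟨A, B, hB, HABK⟩ := subset_verticalStrip_of_isCompact hKc'
    refine tendstoUniformlyOn_tsum (u := fun g : S => ((r ⟨⟨A, B⟩, hB⟩ ^ p)⁻¹ * (r ⟨⟨A, B⟩, hB⟩ ^ q)⁻¹) *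
      ((‖row g.1 0‖ ^ p)⁻¹ * (‖row g.1 1‖ ^ q)⁻¹)) ?_ ?_
    · exact ((summ_rows p q hp hq).mul_left _).subtype S
    · intro g z hz
      exact tm_bound p q hB ⟨z, hK hz⟩ (HABK hz) g.1
  exact h1.differentiableOn (Eventually.of_forall fun s => DifferentiableOn.fun_sum fun g _ => tm_diff p q g.1)
    isOpen_upperHalfPlaneSet

lemma tm_smul (p q : ℕ) (h γ : SL(2, ℤ)) (z : ℍ) :
    tm p q h ((γ • z : ℍ) : ℂ) = tm p q (h * γ) z * denom γ z ^ (p + q) := by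
  have hd : denom γ z ≠ 0 := denom_ne_zero γ z
  have hsm : ((γ • z : ℍ) : ℂ) = num γ z / denom γ z := by
    rw [UpperHalfPlane.specialLinearGroup_apply]
    simp [num, denom]
  have key : ∀ i : Fin 2, ((h i 0 : ℤ) : ℂ) * ((γ • z : ℍ) : ℂ) + (h i 1 : ℤ)
      = ((((h * γ) i 0 : ℤ) : ℂ) * z + ((h * γ) i 1 : ℤ)) * (denom γ z)⁻¹ := by
    intro i
    rw [hsm]
    field_simp
    simp only [num, denom, Matrix.SpecialLinearGroup.coe_mul, Matrix.mul_apply, Fin.sum_univ_two]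
    simp
    ring
  unfold tm
  rw [key 0, key 1, mul_pow, mul_pow, mul_inv, mul_inv, inv_pow, inv_pow, inv_inv, inv_inv, pow_add]
  ring

lemma PS_smul (S : Set SL(2, ℤ)) (p q : ℕ) (γ : SL(2, ℤ)) (z : ℍ) :
    PS S p q ((γ • z : ℍ) : ℂ) = PS {h | h * γ⁻¹ ∈ S} p q z * denom γ z ^ (p + q) := by
  unfold PS
  rw [← tsum_mul_right]
  let e : S ≃ {h | h * γ⁻¹ ∈ S} :=
    { toFun := fun h => ⟨h.1 * γ, by simp⟩
      invFun := fun h => ⟨h.1 * γ⁻¹, h.2⟩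
      left_inv := fun h => by simp
      right_inv := fun h => by simp }
  rw [← e.tsum_eq]
  refine tsum_congr fun h => ?_
  exact tm_smul p q h.1 γ z

lemma PS_slash (S : Set SL(2, ℤ)) (p q : ℕ) (γ : SL(2, ℤ)) :
    (fun z : ℍ => PS S p q z) ∣[((p + q : ℕ) : ℤ)] γ = fun z : ℍ => PS {h | h * γ⁻¹ ∈ S} p q z := by
  funext z
  rw [ModularForm.SL_slash_apply]
  rw [PS_smul, mul_assoc, zpow_neg, zpow_natCast, mul_inv_cancel₀, mul_one]
  exact pow_ne_zero _ (denom_ne_zero γ z)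

lemma PS_T (S : Set SL(2, ℤ)) (hS : ∀ (n : ℤ) (h : SL(2, ℤ)), h ∈ S → h * ModularGroup.T ^ (2 * n) ∈ S) (p q : ℕ) (n : ℤ)
    (z : ℍ) : PS S p q ((ModularGroup.T ^ (2 * n) • z : ℍ) : ℂ) = PS S p q z := by
  rw [PS_smul]
  have h1 : denom (ModularGroup.T ^ (2 * n) : SL(2, ℤ)) z = 1 := by
    have h10 : (ModularGroup.T ^ (2 * n) : SL(2, ℤ)) 1 0 = 0 := by rw [ModularGroup.coe_T_zpow]; simp
    have h11 : (ModularGroup.T ^ (2 * n) : SL(2, ℤ)) 1 1 = 1 := by rw [ModularGroup.coe_T_zpow]; simp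
    rw [ModularGroup.denom_apply, h10, h11]; simp
  have h2 : {h | h * (ModularGroup.T ^ (2 * n))⁻¹ ∈ S} = S := by
    ext h
    constructor
    · intro hh
      have := hS n _ hh
      simpa using this
    · intro hh
      have := hS (-n) _ hh
      simpa using this
  rw [h1, h2]; simp

lemma PS_zero (S : Set SL(2, ℤ)) (hS : ∀ (n : ℤ) (h : SL(2, ℤ)), h ∈ S → h * ModularGroup.T ^ (2 * n) ∈ S) (p q : ℕ)
    (hp : 3 ≤ p) (hq : 3 ≤ q) : IsZeroAtImInfty (fun z : ℍ => PS S p q z) := by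
  choose n hn using fun z : ℍ => ModularGroup_T_zpow_mem_verticalStrip z (N := 2) (by norm_num)
  let s : ℍ → ℍ := fun z => ModularGroup.T ^ (2 * n z) • z
  have him : ∀ z, (s z).im = z.im := by intro z; simp only [s]; rw [modular_T_zpow_smul]; simp
  have e : (fun z : ℍ => PS S p q z) = fun z : ℍ => PS S p q (s z) := by
    funext z; exact (PS_T S hS p q (n z) z).symm
  have hs : ∀ z : ℍ, 1 ≤ z.im → s z ∈ verticalStrip 2 1 := by
    intro z hz
    have := hn z
    exact verticalStrip_anti_right _ hz (by exact_mod_cast this)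
  rw [e]
  unfold IsZeroAtImInfty ZeroAtFilter PS
  set r0 := r ⟨⟨2, 1⟩, one_pos⟩ with hr0
  have hr0p : 0 < r0 := r_pos _
  have hev : ∀ᶠ z : ℍ in atImInfty, 1 ≤ z.im := by
    exact tendsto_comap.eventually (eventually_ge_atTop 1)
  rw [show (0:ℂ) = ∑' g : S, (0:ℂ) by simp]
  refine tendsto_tsum_of_dominated_convergence (bound := fun g : S => ((r0 ^ p)⁻¹ * (r0 ^ q)⁻¹) *
      ((‖row g.1 0‖ ^ p)⁻¹ * (‖row g.1 1‖ ^ q)⁻¹)) (((summ_rows p q hp hq).mul_left _).subtype S) ?_ ?_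
  · intro g
    have hlim : Tendsto (fun z : ℍ => (z.im ^ p)⁻¹ * (r0 ^ q)⁻¹ + (r0 ^ p)⁻¹ * (z.im ^ q)⁻¹) atImInfty (𝓝 0) := by
      have hi : Tendsto (fun z : ℍ => z.im) atImInfty atTop := tendsto_comap
      have a1 : Tendsto (fun z : ℍ => (z.im ^ p)⁻¹) atImInfty (𝓝 0) :=
        tendsto_inv_atTop_zero.comp ((tendsto_pow_atTop (by omega)).comp hi)
      have a2 : Tendsto (fun z : ℍ => (z.im ^ q)⁻¹) atImInfty (𝓝 0) :=
        tendsto_inv_atTop_zero.comp ((tendsto_pow_atTop (by omega)).comp hi)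
      simpa using (a1.mul_const _).add (a2.const_mul _)
    refine squeeze_zero_norm' ?_ hlim
    filter_upwards [hev] with z hz
    have b : ∀ i, r0 ≤ ‖((g.1 i 0 : ℤ) : ℂ) * (s z : ℂ) + (g.1 i 1 : ℤ)‖ := by
      intro i
      have := lin_ge one_pos (s z) (hs z hz) g.1 i
      have h1 := row_norm g.1 i
      refine le_trans ?_ this
      exact le_mul_of_one_le_right hr0p.le h1
    have b' : ∀ i, g.1 i 0 ≠ 0 → z.im ≤ ‖((g.1 i 0 : ℤ) : ℂ) * (s z : ℂ) + (g.1 i 1 : ℤ)‖ := by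
      intro i hi
      have h1 : (1:ℝ) ≤ |((g.1 i 0 : ℤ) : ℝ)| := by exact_mod_cast Int.one_le_abs hi
      have := abs_im_le_norm (((g.1 i 0 : ℤ) : ℂ) * (s z : ℂ) + (g.1 i 1 : ℤ))
      refine le_trans ?_ this
      simp only [add_im, mul_im, intCast_re, intCast_im, zero_mul, add_zero, abs_mul, coe_im, him]
      rw [abs_of_pos z.im_pos]
      exact le_mul_of_one_le_left z.im_pos.le h1
    have hzp := z.im_pos
    rw [tm, norm_mul, norm_inv, norm_inv, norm_pow, norm_pow]
    have hb0 := b 0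
    have hb1 := b 1
    have : g.1 0 0 ≠ 0 ∨ g.1 1 0 ≠ 0 := by
      by_contra! hh
      have := sl_det g.1
      rw [hh.1, hh.2] at this
      simp at this
    rcases this with h | h
    · have h1 := b' 0 h
      have : 0 ≤ (r0 ^ p)⁻¹ * (z.im ^ q)⁻¹ := by positivity
      refine le_add_of_le_of_nonneg ?_ this
      gcongr
    · have h1 := b' 1 h
      have : 0 ≤ (z.im ^ p)⁻¹ * (r0 ^ q)⁻¹ := by positivity
      refine le_add_of_nonneg_of_le this ?_
      gcongr
  · filter_upwards [hev] with z hz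
    intro g
    exact tm_bound p q one_pos (s z) (hs z hz) g.1

lemma g02_T (γ : SL(2, ℤ)) (n : ℤ) (h : SL(2, ℤ)) (hh : h * γ⁻¹ ∈ Gamma0 2) :
    (h * ModularGroup.T ^ (2 * n)) * γ⁻¹ ∈ Gamma0 2 := by
  have e : (h * ModularGroup.T ^ (2 * n)) * γ⁻¹ = (h * γ⁻¹) * (γ * ModularGroup.T ^ (2 * n) * γ⁻¹) := by group
  rw [e]
  refine mul_mem hh ?_
  have h2 : ModularGroup.T ^ (2 * n) ∈ CongruenceSubgroup.Gamma 2 := by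
    rw [Gamma_mem]
    simp only [ModularGroup.coe_T_zpow]
    have : (2 : ZMod 2) = 0 := by decide
    simp [this]
  have h3 : γ * ModularGroup.T ^ (2 * n) * γ⁻¹ ∈ CongruenceSubgroup.Gamma 2 := (Gamma_normal 2).conj_mem _ h2 γ
  rw [Gamma_mem] at h3
  rw [Gamma0_mem]
  exact h3.2.2.1

/-- the cusp form -/
def PCF (p q : ℕ) (hp : 3 ≤ p) (hq : 3 ≤ q) (k : ℤ) (hk : k = ((p + q : ℕ) : ℤ)) : CuspForm (Gamma0 2) k where
  toFun := fun z : ℍ => PS (Gamma0 2 : Subgroup SL(2, ℤ)) p q z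
  slash_action_eq' := by
    intro γ hγ
    obtain ⟨g, hg, rfl⟩ := hγ
    subst hk
    refine (PS_slash (Gamma0 2 : Subgroup SL(2, ℤ)) p q g).trans ?_
    have : {h : SL(2, ℤ) | h * g⁻¹ ∈ ((Gamma0 2 : Subgroup SL(2, ℤ)) : Set SL(2, ℤ))} = (Gamma0 2 : Subgroup SL(2, ℤ)) := by
      ext h
      exact Subgroup.mul_mem_cancel_right _ (inv_mem hg)
    rw [this]
  holo' := by
    rw [UpperHalfPlane.mdifferentiable_iff]
    refine (PS_diff (Gamma0 2 : Subgroup SL(2, ℤ)) p q hp hq).congr ?_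
    intro z hz
    simp [ofComplex_apply_of_im_pos hz]
  zero_at_cusps' := by
    intro c hc
    subst hk
    rw [Subgroup.IsArithmetic.isCusp_iff_isCusp_SL2Z] at hc
    rw [OnePoint.isZeroAt_iff_forall_SL2Z hc]
    intro γ _
    rw [PS_slash]
    exact PS_zero _ (fun n h hh => g02_T γ n h hh) p q hp hq

lemma PCF_apply (p q : ℕ) (hp : 3 ≤ p) (hq : 3 ≤ q) (k : ℤ) (hk : k = ((p + q : ℕ) : ℤ)) (z : ℍ) :
    PCF p q hp hq k hk z = PS (Gamma0 2 : Subgroup SL(2, ℤ)) p q z := rfl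
end PartB1

section PartC4
open Complex Filter Topology Set
open UpperHalfPlane hiding I
open CongruenceSubgroup
open scoped MatrixGroups

def upg (x : ℤˣ × ℤ) : SL(2, ℤ) := ⟨!![(x.1 : ℤ), x.1 * x.2; 0, x.1], by
  rw [Matrix.det_fin_two_of]; simp [← Units.val_mul]⟩

def upE : ℤˣ × ℤ ≃ (NCᶜ : Set (Gamma0 2)) where
  toFun x := ⟨⟨upg x, by rw [Gamma0_mem]; simp [upg]⟩, by
    show ¬ (upg x 1 0 ≠ 0)
    simp [upg]⟩
  invFun γ := ⟨⟨γ.1.1 0 0, γ.1.1 1 1, by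
      have h : γ.1.1 1 0 = 0 := not_not.1 γ.2
      have := sl_det γ.1.1
      rw [h] at this; linarith, by
      have h : γ.1.1 1 0 = 0 := not_not.1 γ.2
      have := sl_det γ.1.1
      rw [h] at this; linarith⟩, γ.1.1 0 0 * γ.1.1 0 1⟩
  left_inv x := by
    refine Prod.ext ?_ ?_
    · apply Units.ext; simp [upg]
    · simp [upg, ← mul_assoc, ← Units.val_mul]
  right_inv γ := by
    have h : γ.1.1 1 0 = 0 := not_not.1 γ.2
    have hd := sl_det γ.1.1
    rw [h, mul_zero, sub_zero] at hd
    have hd' : γ.1.1 0 0 = γ.1.1 1 1 := by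
      rcases Int.eq_one_or_neg_one_of_mul_eq_one' hd with h | h <;> rw [h.1, h.2]
    apply Subtype.ext; apply Subtype.ext
    refine sl_ext _ _ ?_ ?_ ?_ ?_
    · simp [upg]
    · simp only [upg, Matrix.of_apply, Matrix.cons_val', Matrix.cons_val_zero, Matrix.cons_val_one, Matrix.cons_val_fin_one]
      rw [← mul_assoc]
      nth_rw 2 [hd']
      rw [hd, one_mul]
    · simp [upg, h]
    · simp [upg, hd']

lemma tm_up (p q : ℕ) (hp : Odd p) (hq : Odd q) (x : ℤˣ × ℤ) (z : ℂ) :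
    tm p q (upE x).1.1 z = ((z + x.2) ^ p)⁻¹ := by
  have hu : ((x.1 : ℤ) : ℂ) = 1 ∨ ((x.1 : ℤ) : ℂ) = -1 := by
    rcases Int.units_eq_one_or x.1 with h | h <;> simp [h]
  have e : tm p q (upE x).1.1 z = ((((x.1 : ℤ) : ℂ) * z + ((x.1 : ℤ) : ℂ) * x.2) ^ p)⁻¹ * ((((x.1 : ℤ) : ℂ)) ^ q)⁻¹ := by
    simp [tm, upE, upg]
  rw [e]
  rcases hu with h | h
  · rw [h]; simp
  · rw [h, hq.neg_pow, one_pow, show (-1 : ℂ) * z + -1 * x.2 = -(z + x.2) by ring, hp.neg_pow]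
    rw [inv_neg, inv_neg, inv_one]; ring

lemma PS_split (p q : ℕ) (hp3 : 3 ≤ p) (hq3 : 3 ≤ q) (hp : Odd p) (hq : Odd q) (z : ℍ) :
    PS (Gamma0 2 : Subgroup SL(2, ℤ)) p q z = (∑' γ : NC, tm p q γ.1.1 z) + 2 * ∑' b : ℤ, (((z : ℂ) + b) ^ p)⁻¹ := by
  have hs : Summable fun g : Gamma0 2 => tm p q g.1 z :=
    (tm_summable p q hp3 hq3 z).of_norm.subtype (Gamma0 2 : Set SL(2, ℤ))
  have h1 := hs.tsum_subtype_add_tsum_subtype_compl NC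
  have h2 : ∑' γ : (NCᶜ : Set (Gamma0 2)), tm p q γ.1.1 z = 2 * ∑' b : ℤ, (((z : ℂ) + b) ^ p)⁻¹ := by
    rw [← upE.tsum_eq]
    simp_rw [tm_up p q hp hq]
    have hs' : Summable fun x : ℤˣ × ℤ => (((z : ℂ) + x.2) ^ p)⁻¹ := by
      have := upE.summable_iff.2 (hs.subtype (NCᶜ : Set (Gamma0 2)))
      refine this.congr fun x => ?_
      exact tm_up p q hp hq x z
    rw [hs'.tsum_prod]
    simp
  rw [← h2]
  exact h1.symm

def lip (n : ℕ) : ℂ := (-2 * Real.pi * I) ^ (n + 1) / n.factorial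

lemma lip_ne (n : ℕ) : lip n ≠ 0 := by
  unfold lip
  have : (n.factorial : ℂ) ≠ 0 := by exact_mod_cast n.factorial_ne_zero
  have : (Real.pi : ℂ) ≠ 0 := by exact_mod_cast Real.pi_ne_zero
  have hI := I_ne_zero
  simp [*]

lemma lip_sum (n : ℕ) (hn : 1 ≤ n) (t : ℝ) (ht : 0 < t) :
    ∑' b : ℤ, (((t * I : ℂ) + b) ^ (n + 1))⁻¹ = lip n * ∑' r : ℕ, (((r : ℝ) ^ n * Real.exp (-(2 * Real.pi * r) * t) : ℝ) : ℂ) := by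
  have := EisensteinSeries.qExpansion_identity hn ⟨t * I, by simpa using ht⟩
  simp only [one_div] at this
  refine this.trans ?_
  unfold lip
  congr 1
  refine tsum_congr fun r => ?_
  rw [← Complex.exp_nat_mul]
  push_cast
  congr 2
  linear_combination (2 * Real.pi * r * t) * I_sq

lemma exp_int (m : ℕ) (r : ℕ) (hr : 0 < r) :
    ∫ t in Ioi (0:ℝ), t ^ m * Real.exp (-(2 * Real.pi * r) * t) = m.factorial / (2 * Real.pi) ^ (m + 1) * ((r : ℝ) ^ (m + 1))⁻¹ := by
  have hpi := Real.pi_pos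
  have hr' : (0:ℝ) < r := by exact_mod_cast hr
  have := Real.integral_rpow_mul_exp_neg_mul_Ioi (a := m + 1) (r := 2 * Real.pi * r) (by positivity) (by positivity)
  rw [Real.Gamma_nat_eq_factorial] at this
  simp only [add_sub_cancel_right, Real.rpow_natCast] at this
  simp only [neg_mul]
  rw [this, show (m : ℝ) + 1 = ((m + 1 : ℕ) : ℝ) by push_cast; ring, Real.rpow_natCast, div_pow, mul_pow, one_pow, mul_pow]
  field_simp

lemma lip_part (n m : ℕ) (hn : 1 ≤ n) (hm : n + 1 ≤ m) :
    IntegrableOn (fun t : ℝ => (t : ℂ) ^ m * ∑' b : ℤ, (((t * I : ℂ) + b) ^ (n + 1))⁻¹) (Ioi 0) ∧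
    ∫ t in Ioi (0:ℝ), (t : ℂ) ^ m * ∑' b : ℤ, (((t * I : ℂ) + b) ^ (n + 1))⁻¹ =
      lip n * ((m.factorial / (2 * Real.pi) ^ (m + 1) : ℝ) : ℂ) * ((∑' r : ℕ, (r : ℝ) ^ n * ((r : ℝ) ^ (m + 1))⁻¹ : ℝ) : ℂ) := by
  have hpi := Real.pi_pos
  let F : ℕ → ℝ → ℝ := fun r t => t ^ m * ((r : ℝ) ^ n * Real.exp (-(2 * Real.pi * r) * t))
  have hF : ∀ r, ∫ t in Ioi (0:ℝ), F r t = m.factorial / (2 * Real.pi) ^ (m + 1) * ((r : ℝ) ^ n * ((r : ℝ) ^ (m + 1))⁻¹) := by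
    intro r
    rcases Nat.eq_zero_or_pos r with rfl | hr
    · simp [F, show n ≠ 0 by omega]
    · have : ∀ t, F r t = (r : ℝ) ^ n * (t ^ m * Real.exp (-(2 * Real.pi * r) * t)) := by intro t; simp only [F]; ring
      simp_rw [this]
      rw [integral_const_mul, exp_int m r hr]; ring
  have hFi : ∀ r, IntegrableOn (F r) (Ioi 0) := by
    intro r
    rcases Nat.eq_zero_or_pos r with rfl | hr
    · simp [F, show n ≠ 0 by omega]
    · by_contra hcon
      have h0 := integral_undef hcon
      rw [hF r] at h0
      have hr' : (0:ℝ) < r := by exact_mod_cast hr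
      have : 0 < m.factorial / (2 * Real.pi) ^ (m + 1) * ((r : ℝ) ^ n * ((r : ℝ) ^ (m + 1))⁻¹) := by positivity
      linarith
  have hFpos : ∀ r, ∀ t ∈ Ioi (0:ℝ), 0 ≤ F r t := by
    intro r t ht
    have : 0 < t := ht
    simp only [F]; positivity
  have hsr : Summable fun r : ℕ => (r : ℝ) ^ n * ((r : ℝ) ^ (m + 1))⁻¹ := by
    have h2 : Summable fun r : ℕ => ((r : ℝ) ^ 2)⁻¹ := Real.summable_nat_pow_inv.2 (by norm_num)
    refine Summable.of_nonneg_of_le (fun r => by positivity) ?_ h2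
    intro r
    rcases Nat.eq_zero_or_pos r with rfl | hr
    · simp [show n ≠ 0 by omega]
    · have hr' : (1:ℝ) ≤ r := by exact_mod_cast hr
      rw [← div_eq_mul_inv, div_le_iff₀ (by positivity), inv_mul_eq_div, le_div_iff₀ (by positivity), ← pow_add]
      exact pow_le_pow_right₀ hr' (by omega)
  let G : ℕ → ℝ → ℂ := fun r t => (F r t : ℂ)
  have hGi : ∀ r, IntegrableOn (G r) (Ioi 0) := fun r => (hFi r).ofReal
  have hGn : ∀ r, ∫ t in Ioi (0:ℝ), ‖G r t‖ = m.factorial / (2 * Real.pi) ^ (m + 1) * ((r : ℝ) ^ n * ((r : ℝ) ^ (m + 1))⁻¹) := by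
    intro r
    rw [← hF r]
    refine setIntegral_congr_fun measurableSet_Ioi ?_
    intro t ht
    simp only [G, norm_real, Real.norm_eq_abs]
    exact abs_of_nonneg (hFpos r t ht)
  have hsum : Summable fun r => ∫ t in Ioi (0:ℝ), ‖G r t‖ := by
    simp_rw [hGn]
    exact hsr.mul_left _
  have key := hasSum_integral_of_summable_integral_norm hGi hsum
  have hEq : ∀ t ∈ Ioi (0:ℝ), (t : ℂ) ^ m * ∑' b : ℤ, (((t * I : ℂ) + b) ^ (n + 1))⁻¹ = lip n * ∑' r, G r t := by
    intro t ht
    rw [lip_sum n hn t ht, ← mul_assoc, mul_comm (_ ^ m), mul_assoc, ← tsum_mul_left]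
    congr 1
    refine tsum_congr fun r => ?_
    simp only [G, F]
    push_cast
    ring
  have hval : ∫ t in Ioi (0:ℝ), (t : ℂ) ^ m * ∑' b : ℤ, (((t * I : ℂ) + b) ^ (n + 1))⁻¹ =
      lip n * ((m.factorial / (2 * Real.pi) ^ (m + 1) : ℝ) : ℂ) * ((∑' r : ℕ, (r : ℝ) ^ n * ((r : ℝ) ^ (m + 1))⁻¹ : ℝ) : ℂ) := by
    rw [setIntegral_congr_fun measurableSet_Ioi hEq, integral_const_mul, ← key.tsum_eq, mul_assoc, ← ofReal_mul]
    congr 1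
    rw [← tsum_mul_left, ofReal_tsum]
    refine tsum_congr fun r => ?_
    rw [← hF r]
    exact integral_ofReal
  refine ⟨?_, hval⟩
  by_contra hcon
  have h0 := integral_undef hcon
  rw [hval] at h0
  have h1 : 0 < ∑' r : ℕ, (r : ℝ) ^ n * ((r : ℝ) ^ (m + 1))⁻¹ :=
    hsr.tsum_pos (fun r => by positivity) 1 (by simp)
  have h2 : (0:ℝ) < m.factorial / (2 * Real.pi) ^ (m + 1) := by positivity
  have h3 : ((m.factorial / (2 * Real.pi) ^ (m + 1) : ℝ) : ℂ) ≠ 0 := by exact_mod_cast h2.ne'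
  have h4 : ((∑' r : ℕ, (r : ℝ) ^ n * ((r : ℝ) ^ (m + 1))⁻¹ : ℝ) : ℂ) ≠ 0 := by exact_mod_cast h1.ne'
  exact mul_ne_zero (mul_ne_zero (lip_ne n) h3) h4 h0

lemma PS_integral (n q m : ℕ) (hn2 : 2 ≤ n) (hq3 : 3 ≤ q) (hne : Even n) (hq : Odd q) (hmo : Odd m)
    (hm1 : n + 3 ≤ m) (hm2 : m + 2 ≤ n + q) :
    IntegrableOn (fun t : ℝ => (t : ℂ) ^ m * PS (Gamma0 2 : Subgroup SL(2, ℤ)) (n + 1) q (t * I)) (Ioi 0) ∧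
    ∫ t in Ioi (0:ℝ), (t : ℂ) ^ m * PS (Gamma0 2 : Subgroup SL(2, ℤ)) (n + 1) q (t * I) =
     2 * (lip n * ((m.factorial / (2 * Real.pi) ^ (m + 1) : ℝ) : ℂ) * ((∑' r : ℕ, (r : ℝ) ^ n * ((r : ℝ) ^ (m + 1))⁻¹ : ℝ) : ℂ)) := by
  have hpo : Odd (n + 1) := hne.add_one
  obtain ⟨i1, e1⟩ := NC_integral m (n + 1) q (by omega) hq3 (by omega) (by omega) hpo hmo
  obtain ⟨i2, e2⟩ := lip_part n m (by omega) (by omega)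
  have i2' := i2.const_mul 2
  have hEq : ∀ t ∈ Ioi (0:ℝ), (t : ℂ) ^ m * PS (Gamma0 2 : Subgroup SL(2, ℤ)) (n + 1) q (t * I) =
      (∑' γ : NC, um m (n + 1) q γ.1 t) + 2 * ((t : ℂ) ^ m * ∑' b : ℤ, (((t * I : ℂ) + b) ^ (n + 1))⁻¹) := by
    intro t ht
    have := PS_split (n + 1) q (by omega) hq3 hpo hq ⟨t * I, by simpa using ht⟩
    simp only at this
    rw [this, mul_add]
    simp only [um]
    rw [tsum_mul_left]
    ring
  constructor
  · refine (i1.add i2').congr_fun ?_ measurableSet_Ioi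
    intro t ht
    exact (hEq t ht).symm
  · rw [setIntegral_congr_fun measurableSet_Ioi hEq, integral_add i1 i2', e1, zero_add, integral_const_mul, e2]
end PartC4

section PartC5
open Complex Filter Topology Set
open UpperHalfPlane hiding I
open CongruenceSubgroup
open scoped MatrixGroups

lemma summable_pw (n k : ℕ) (hn : n + 2 ≤ k) (hn0 : n ≠ 0) :
    Summable fun r : ℕ => ((r : ℝ) ^ n * ((r : ℝ) ^ k)⁻¹) := by
  have h2 : Summable fun r : ℕ => ((r : ℝ) ^ 2)⁻¹ := Real.summable_nat_pow_inv.2 (by norm_num)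
  refine Summable.of_nonneg_of_le (fun r => by positivity) ?_ h2
  intro r
  rcases Nat.eq_zero_or_pos r with rfl | hr
  · simp [hn0]
  · have hr' : (1:ℝ) ≤ r := by exact_mod_cast hr
    rw [← div_eq_mul_inv, div_le_iff₀ (by positivity), inv_mul_eq_div, le_div_iff₀ (by positivity), ← pow_add]
    exact pow_le_pow_right₀ hr' (by omega)

lemma gram_zero (d : ℕ) (C : Fin d → ℂ)
    (h : ∀ j : Fin d, ∑ i : Fin d, C i *
      ((∑' r : ℕ, (r : ℝ) ^ (2 * (i.1 + 1)) * ((r : ℝ) ^ (4 * d + 2 - 2 * j.1))⁻¹ : ℝ) : ℂ) = 0) :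
    ∀ i, C i = 0 := by
  let g : ℕ → ℂ := fun r => ∑ i : Fin d, C i * (r : ℂ) ^ (2 * (i.1 + 1))
  have hs : ∀ i j : Fin d, Summable fun r : ℕ => (r : ℝ) ^ (2 * (i.1 + 1)) * ((r : ℝ) ^ (4 * d + 2 - 2 * j.1))⁻¹ := by
    intro i j
    exact summable_pw _ _ (by omega) (by omega)
  have hHS : ∀ j : Fin d, HasSum (fun r : ℕ => g r * ((r : ℂ) ^ (4 * d + 2 - 2 * j.1))⁻¹) 0 := by
    intro j
    rw [← h j]
    have : ∀ r : ℕ, g r * ((r : ℂ) ^ (4 * d + 2 - 2 * j.1))⁻¹ = ∑ i : Fin d, C i *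
      (((r : ℝ) ^ (2 * (i.1 + 1)) * ((r : ℝ) ^ (4 * d + 2 - 2 * j.1))⁻¹ : ℝ) : ℂ) := by
      intro r
      simp only [g, Finset.sum_mul]
      refine Finset.sum_congr rfl fun i _ => ?_
      push_cast; ring
    simp_rw [this]
    refine hasSum_sum fun i _ => ?_
    exact (Complex.hasSum_ofReal.2 (hs i j).hasSum).mul_left _
  have hq : HasSum (fun r : ℕ => ((‖g r‖ ^ 2 * ((r : ℝ) ^ (4 * d + 4))⁻¹ : ℝ) : ℂ)) 0 := by
    have h1 : HasSum (fun r : ℕ => ∑ j : Fin d, (starRingEnd ℂ) (C j) * (g r * ((r : ℂ) ^ (4 * d + 2 - 2 * j.1))⁻¹)) (∑ j : Fin d, (starRingEnd ℂ) (C j) * 0) :=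
      hasSum_sum fun j _ => (hHS j).mul_left _
    simp only [mul_zero, Finset.sum_const_zero] at h1
    refine h1.congr_fun ?_
    intro r
    rcases Nat.eq_zero_or_pos r with rfl | hr
    · simp [g]
    · have hr' : (r : ℂ) ≠ 0 := by exact_mod_cast hr.ne'
      push_cast
      rw [← Complex.mul_conj']
      have : (starRingEnd ℂ) (g r) = ∑ j : Fin d, (starRingEnd ℂ) (C j) * (r : ℂ) ^ (2 * (j.1 + 1)) := by
        simp [g]
      rw [this, Finset.mul_sum, Finset.sum_mul]
      refine Finset.sum_congr rfl fun j _ => ?_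
      have e : (r : ℂ) ^ (4 * d + 4) = r ^ (2 * (j.1 + 1)) * r ^ (4 * d + 2 - 2 * j.1) := by
        rw [← pow_add]; congr 1; omega
      rw [e]
      field_simp
  have hq' : HasSum (fun r : ℕ => ‖g r‖ ^ 2 * ((r : ℝ) ^ (4 * d + 4))⁻¹) 0 := by
    exact Complex.hasSum_ofReal.1 (by simpa using hq)
  have hz := (hasSum_zero_iff_of_nonneg (fun r => by positivity)).1 hq'
  have hg : ∀ r : ℕ, g r = 0 := by
    intro r
    rcases Nat.eq_zero_or_pos r with rfl | hr
    · simp [g]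
    · have := congrFun hz r
      have hr' : (r : ℝ) ≠ 0 := by exact_mod_cast hr.ne'
      simpa [hr'] using this
  let P : Polynomial ℂ := ∑ i : Fin d, Polynomial.monomial (2 * (i.1 + 1)) (C i)
  have hP : P = 0 := by
    refine Polynomial.eq_zero_of_infinite_isRoot P ?_
    refine (Set.infinite_range_of_injective (Nat.cast_injective (R := ℂ))).mono ?_
    rintro _ ⟨r, rfl⟩
    show P.eval _ = 0
    simp only [P, Polynomial.eval_finset_sum, Polynomial.eval_monomial]
    exact hg r
  intro i
  have := congrArg (fun Q => Q.coeff (2 * (i.1 + 1))) hP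
  simp only [P, Polynomial.finset_sum_coeff, Polynomial.coeff_monomial, Polynomial.coeff_zero] at this
  rw [Finset.sum_eq_single i] at this
  · simpa using this
  · intro j _ hj
    rw [if_neg]
    intro hh; apply hj; apply Fin.ext; omega
  · simp

lemma PS_indep (w d : ℕ) (hwe : Even w) (hd : 4 * d + 2 ≤ w) (C : Fin d → ℂ)
    (h : ∀ z : ℂ, 0 < z.im → ∑ i, C i * PS (Gamma0 2 : Subgroup SL(2, ℤ)) (2 * (i.1 + 1) + 1) (w - 2 * (i.1 + 1) + 1) z = 0) :
    ∀ i, C i = 0 := by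
  have key : ∀ i, C i * lip (2 * (i.1 + 1)) = 0 := by
    refine gram_zero d _ ?_
    intro j
    let m := 4 * d + 1 - 2 * j.1
    have hm : m + 1 = 4 * d + 2 - 2 * j.1 := by simp only [m]; omega
    have hPI : ∀ i : Fin d, _ := fun i => PS_integral (2 * (i.1 + 1)) (w - 2 * (i.1 + 1) + 1) m (by omega) (by omega)
      (even_two_mul _) (by
        obtain ⟨v, hv⟩ := hwe
        exact ⟨v - (i.1 + 1), by omega⟩) ⟨2 * d - j.1, by simp only [m]; omega⟩ (by simp only [m]; omega) (by simp only [m]; omega)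
    have h0 : ∫ t in Ioi (0:ℝ), ∑ i, C i * ((t : ℂ) ^ m * PS (Gamma0 2 : Subgroup SL(2, ℤ)) (2 * (i.1 + 1) + 1) (w - 2 * (i.1 + 1) + 1) (t * I)) = 0 := by
      rw [← integral_zero (α := ℝ) (G := ℂ) (μ := volume.restrict (Ioi 0))]
      refine setIntegral_congr_fun measurableSet_Ioi ?_
      intro t ht
      have := h (t * I) (by simpa using ht)
      simp only
      have e := congrArg (fun x => (t : ℂ) ^ m * x) this
      simp only [mul_zero, Finset.mul_sum] at e
      rw [← e]
      refine Finset.sum_congr rfl fun i _ => by ring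
    rw [integral_finset_sum _ (fun i _ => (hPI i).1.const_mul _)] at h0
    simp_rw [integral_const_mul, (hPI _).2, hm] at h0
    have h2 : (0:ℝ) < m.factorial / (2 * Real.pi) ^ (4 * d + 2 - 2 * j.1) := by
      have := Real.pi_pos
      positivity
    have h3 : (2 * ((m.factorial / (2 * Real.pi) ^ (4 * d + 2 - 2 * j.1) : ℝ) : ℂ)) ≠ 0 := mul_ne_zero two_ne_zero (by exact_mod_cast h2.ne')
    refine (mul_eq_zero.1 (?_ : (2 * ((m.factorial / (2 * Real.pi) ^ (4 * d + 2 - 2 * j.1) : ℝ) : ℂ)) * _ = 0)).resolve_left h3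
    rw [Finset.mul_sum, ← h0]
    refine Finset.sum_congr rfl fun i _ => by ring
  intro i
  exact (mul_eq_zero.1 (key i)).resolve_right (lip_ne _)
end PartC5

section PartD
open Complex Filter Topology Set
open UpperHalfPlane hiding I
open CongruenceSubgroup
open scoped MatrixGroups

lemma g02_half (γ : Gamma0 2) : γ.1 1 0 = 2 * (γ.1 1 0 / 2) := by
  have := γ.2
  rw [Gamma0_mem] at this
  have h : (2 : ℤ) ∣ γ.1 1 0 := by
    exact (ZMod.intCast_zmod_eq_zero_iff_dvd _ 2).1 this
  omega

def frg (γ : Gamma0 2) : Gamma0 2 := ⟨⟨!![γ.1 1 1, -(γ.1 1 0 / 2); -2 * γ.1 0 1, γ.1 0 0], by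
  rw [Matrix.det_fin_two_of]
  have h1 := sl_det γ.1
  have h2 := g02_half γ
  rw [h2] at h1
  linarith⟩, by
  refine Gamma0_mem.2 ?_
  show (((-2 * γ.1 0 1 : ℤ)) : ZMod 2) = 0
  push_cast
  rw [show (2 : ZMod 2) = 0 by decide]; simp⟩

lemma frg_frg (γ : Gamma0 2) : frg (frg γ) = γ := by
  apply Subtype.ext
  have h2 := g02_half γ
  refine sl_ext _ _ ?_ ?_ ?_ ?_
  · simp [frg]
  · show -((-2 * γ.1 0 1) / 2) = γ.1 0 1
    omega
  · show -2 * (-(γ.1 1 0 / 2)) = γ.1 1 0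
    omega
  · simp [frg]

def frE : Gamma0 2 ≃ Gamma0 2 := ⟨frg, frg, frg_frg, frg_frg⟩

lemma tm_fr (p q : ℕ) (γ : Gamma0 2) (z : ℂ) (hz : z ≠ 0) :
    tm p q γ.1 (-1 / (2 * z)) = (-2) ^ p * z ^ (p + q) * tm q p (frg γ).1 z := by
  have e : tm q p (frg γ).1 z = ((((γ.1 1 1 : ℤ) : ℂ) * z + ((-(γ.1 1 0 / 2) : ℤ) : ℂ)) ^ q)⁻¹ *
     ((((-2 * γ.1 0 1 : ℤ) : ℂ) * z + ((γ.1 0 0 : ℤ) : ℂ)) ^ p)⁻¹ := rfl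
  rw [e]
  have e1 : ((γ.1 0 0 : ℤ) : ℂ) * (-1 / (2 * z)) + ((γ.1 0 1 : ℤ) : ℂ) = (((-2 * γ.1 0 1 : ℤ) : ℂ) * z + ((γ.1 0 0 : ℤ) : ℂ)) / (-2 * z) := by
    push_cast; field_simp; ring
  have e2 : ((γ.1 1 0 : ℤ) : ℂ) * (-1 / (2 * z)) + ((γ.1 1 1 : ℤ) : ℂ) = (((γ.1 1 1 : ℤ) : ℂ) * z + ((-(γ.1 1 0 / 2) : ℤ) : ℂ)) / z := by
    have : ((γ.1 1 0 : ℤ) : ℂ) = 2 * ((γ.1 1 0 / 2 : ℤ) : ℂ) := by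
      exact_mod_cast g02_half γ
    rw [this]
    push_cast; field_simp; ring
  unfold tm
  rw [e1, e2, div_pow, div_pow, inv_div, inv_div, mul_pow, pow_add]
  simp only [div_eq_mul_inv]
  ring

lemma PS_fr (p q : ℕ) (z : ℂ) (hz : z ≠ 0) :
    PS (Gamma0 2 : Subgroup SL(2, ℤ)) p q (-1 / (2 * z)) = (-2) ^ p * z ^ (p + q) * PS (Gamma0 2 : Subgroup SL(2, ℤ)) q p z := by
  unfold PS
  rw [← tsum_mul_left]
  refine Eq.trans ?_ (frE.tsum_eq (fun γ : Gamma0 2 => (-2) ^ p * z ^ (p + q) * tm q p γ.1 z))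
  exact tsum_congr fun γ => tm_fr p q γ z hz

lemma PS_indep2 (w d : ℕ) (hwe : Even w) (hd : 4 * d + 2 ≤ w) (C : Fin d → ℂ)
    (h : ∀ z : ℂ, 0 < z.im → ∑ i, C i * PS (Gamma0 2 : Subgroup SL(2, ℤ)) (w - 2 * (i.1 + 1) + 1) (2 * (i.1 + 1) + 1) z = 0) :
    ∀ i, C i = 0 := by
  have key : ∀ i, C i * (-2) ^ (w - 2 * (i.1 + 1) + 1) = 0 := by
    refine PS_indep w d hwe hd _ ?_
    intro z hz
    have hz0 : z ≠ 0 := by rintro rfl; simp at hz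
    have := h (-1 / (2 * z)) (by
      rw [div_im]
      have : 0 < normSq (2 * z) := normSq_pos.2 (by simpa using hz0)
      have h3 : (2 * z).im = 2 * z.im := by simp
      have h4 : (2 * z).re = 2 * z.re := by simp
      rw [h3, h4]
      have : (-1 : ℂ).im * (2 * z.re) / normSq (2 * z) - (-1 : ℂ).re * (2 * z.im) / normSq (2 * z) = 2 * z.im / normSq (2 * z) := by
        simp; ring
      rw [this]
      positivity)
    simp_rw [PS_fr _ _ z hz0] at this
    have hz1 : z ^ (w + 2) ≠ 0 := pow_ne_zero _ hz0
    refine (mul_eq_zero.1 (?_ : z ^ (w + 2) * _ = 0)).resolve_left hz1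
    rw [Finset.mul_sum, ← this]
    refine Finset.sum_congr rfl fun i _ => ?_
    rw [show w - 2 * (i.1 + 1) + 1 + (2 * (i.1 + 1) + 1) = w + 2 by omega]
    ring
  intro i
  exact (mul_eq_zero.1 (key i)).resolve_right (pow_ne_zero _ (by norm_num))
end PartD

section PartA1
open Complex Filter Topology Set
open UpperHalfPlane hiding I
open CongruenceSubgroup
open scoped MatrixGroups Pointwise
open Function Matrix.SpecialLinearGroup

def col2 (g : SL(2, ℤ)) : ZMod 2 × ZMod 2 := ((g 0 0 : ℤ), (g 1 0 : ℤ))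

lemma col2_iff (g h : SL(2, ℤ)) : g⁻¹ * h ∈ Gamma0 2 ↔ col2 g = col2 h := by
  rw [Gamma0_mem]
  have e : (g⁻¹ * h) 1 0 = - g 1 0 * h 0 0 + g 0 0 * h 1 0 := by
    rw [coe_mul, coe_inv, Matrix.adjugate_fin_two, Matrix.mul_apply, Fin.sum_univ_two]
    simp
  rw [e]
  have h1 := congrArg (fun x : ℤ => (x : ZMod 2)) (sl_det g)
  have h2 := congrArg (fun x : ℤ => (x : ZMod 2)) (sl_det h)
  simp only [col2, Prod.mk.injEq]
  push_cast at h1 h2 ⊢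
  generalize ((g 0 0 : ℤ) : ZMod 2) = a at *
  generalize ((g 0 1 : ℤ) : ZMod 2) = b at *
  generalize ((g 1 0 : ℤ) : ZMod 2) = c at *
  generalize ((g 1 1 : ℤ) : ZMod 2) = d at *
  generalize ((h 0 0 : ℤ) : ZMod 2) = a' at *
  generalize ((h 0 1 : ℤ) : ZMod 2) = b' at *
  generalize ((h 1 0 : ℤ) : ZMod 2) = c' at *
  generalize ((h 1 1 : ℤ) : ZMod 2) = d' at *
  revert a b c d a' b' c' d'
  decide

lemma col2_ne (g : SL(2, ℤ)) : col2 g ≠ 0 := by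
  have h1 := congrArg (fun x : ℤ => (x : ZMod 2)) (sl_det g)
  intro h
  simp only [col2, Prod.mk_eq_zero] at h
  push_cast at h1
  rw [h.1, h.2] at h1
  revert h1
  simp

lemma g02_index : (Gamma0 2).index = 3 := by
  let φ : SL(2, ℤ) ⧸ Gamma0 2 → {x : ZMod 2 × ZMod 2 // x ≠ 0} := fun q =>
    q.liftOn (fun g => ⟨col2 g, col2_ne g⟩) (fun g h hgh => by
      apply Subtype.ext
      exact (col2_iff g h).1 (QuotientGroup.leftRel_apply.1 hgh))
  have hφ : Function.Bijective φ := by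
    constructor
    · intro x y
      induction x using QuotientGroup.induction_on with | H g => ?_
      induction y using QuotientGroup.induction_on with | H h => ?_
      intro he
      have he' : col2 g = col2 h := congrArg Subtype.val he
      exact QuotientGroup.eq.2 ((col2_iff g h).2 he')
    · have h1 : col2 1 = (1, 0) := by simp [col2]
      have h2 : col2 ModularGroup.S = (0, 1) := by simp [col2, ModularGroup.S]
      have h3 : col2 ⟨!![1, 0; 1, 1], by simp [Matrix.det_fin_two_of]⟩ = (1, 1) := by
        simp [col2]
      have key : ∀ x : ZMod 2 × ZMod 2, x ≠ 0 → x = (1, 0) ∨ x = (0, 1) ∨ x = (1, 1) := by decide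
      rintro ⟨x, hx⟩
      rcases key x hx with rfl | rfl | rfl
      · exact ⟨QuotientGroup.mk 1, Subtype.ext h1⟩
      · exact ⟨QuotientGroup.mk ModularGroup.S, Subtype.ext h2⟩
      · exact ⟨QuotientGroup.mk ⟨!![1, 0; 1, 1], by simp [Matrix.det_fin_two_of]⟩, Subtype.ext h3⟩
  rw [Subgroup.index, Nat.card_congr (Equiv.ofBijective φ hφ), Nat.card_eq_fintype_card]
  decide

abbrev G2 : Subgroup (GL (Fin 2) ℝ) := (Gamma0 2 : Subgroup (GL (Fin 2) ℝ))

lemma cardQ : Nat.card (𝒮ℒ ⧸ (G2.subgroupOf 𝒮ℒ)) = 3 := by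
  rw [← g02_index]
  show (G2).relIndex 𝒮ℒ = _
  rw [G2, MonoidHom.range_eq_map, Subgroup.relIndex_map_map_of_injective _ _ (mapGL_injective), Subgroup.relIndex_top_right]

lemma two_period (r : GL (Fin 2) ℝ) (hr : r ∈ 𝒮ℒ) :
    (2 : ℝ) ∈ (ConjAct.toConjAct (r⁻¹)⁻¹ • G2).strictPeriods := by
  obtain ⟨g, rfl⟩ := hr
  rw [Subgroup.mem_strictPeriods_iff, inv_inv, Subgroup.mem_smul_pointwise_iff_exists]
  have hT : ModularGroup.T ^ (2:ℤ) ∈ CongruenceSubgroup.Gamma 2 := ModularGroup_T_pow_mem_Gamma 2 2 dvd_rfl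
  have h2 : g⁻¹ * ModularGroup.T ^ (2:ℤ) * g ∈ CongruenceSubgroup.Gamma 2 := by
    have := (Gamma_normal 2).conj_mem _ hT g⁻¹
    simpa using this
  refine ⟨mapGL ℝ (g⁻¹ * ModularGroup.T ^ (2:ℤ) * g), ⟨_, ?_, rfl⟩, ?_⟩
  · exact Gamma0_mem.2 (Gamma_mem.1 h2).2.2.1
  · rw [ConjAct.toConjAct_smul, ← map_inv, ← map_mul, ← map_mul]
    rw [show g * (g⁻¹ * ModularGroup.T ^ (2:ℤ) * g) * g⁻¹ = ModularGroup.T ^ (2:ℤ) by group]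
    ext i j
    rw [mapGL_coe_matrix, map_apply_coe, ModularGroup.coe_T_zpow]
    fin_cases i <;> fin_cases j <;> simp

end PartA1

section PartA2
open Complex Filter Topology Set
open UpperHalfPlane hiding I
open CongruenceSubgroup
open scoped MatrixGroups Pointwise ModularForm
open Function Asymptotics

lemma one_per : (1 : ℝ) ∈ G2.strictPeriods := by
  simp [G2]

lemma decay_any {k : ℤ} (f : CuspForm G2 k) (r : GL (Fin 2) ℝ) (hr : r ∈ 𝒮ℒ) :
    ((f : ℍ → ℂ) ∣[k] r⁻¹) =O[atImInfty] fun τ => Real.exp (-Real.pi * τ.im) := by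
  have := CuspFormClass.exp_decay_atImInfty (CuspForm.translate f r⁻¹) (h := 2) (by norm_num) (two_period r hr)
  refine this.congr (fun τ => rfl) (fun τ => ?_)
  congr 1; ring

lemma decay_high {k : ℤ} (f : CuspForm G2 k) (d : ℕ) (h0 : ∀ m ≤ d, (qExpansion 1 f).coeff m = 0) :
    (f : ℍ → ℂ) =O[atImInfty] fun τ => Real.exp (-(2 * Real.pi * (d + 1)) * τ.im) := by
  have han := ModularFormClass.analyticAt_cuspFunction_zero f one_pos one_per
  have hp := hasFPowerSeries_cuspFunction (h := 1) f one_pos han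
    (fun τ => hasSum_qExpansion one_pos (SlashInvariantFormClass.periodic_comp_ofComplex f one_per)
      (ModularFormClass.holo f) (ModularFormClass.bdd_at_infty f) τ)
  have h1 := hp.hasFPowerSeriesAt.isBigO_sub_partialSum_pow (d + 1)
  have h2 := h1.comp_tendsto (qParam_tendsto_atImInfty (h := 1) one_pos)
  refine h2.congr (fun τ => ?_) (fun τ => ?_)
  · simp only [Function.comp, zero_add]
    rw [SlashInvariantFormClass.eq_cuspFunction f τ one_per one_ne_zero]
    have : (qExpansionFormalMultilinearSeries 1 f).partialSum (d + 1) (Periodic.qParam 1 τ) = 0 := by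
      rw [FormalMultilinearSeries.partialSum]
      refine Finset.sum_eq_zero fun m hm => ?_
      rw [FormalMultilinearSeries.apply_eq_prod_smul_coeff, qExpansionFormalMultilinearSeries_coeff,
        h0 m (by simpa [Nat.lt_succ_iff] using hm), smul_zero]
    rw [this, sub_zero]
  · simp only [Function.comp]
    rw [Periodic.norm_qParam, ← Real.exp_nat_mul]
    congr 1
    push_cast
    simp only [coe_im]
    ring

lemma coeff_zero_of_decay {k : ℤ} (N : ModularForm 𝒮ℒ k) (D : ℕ)
    (hN : (N : ℍ → ℂ) =O[atImInfty] fun τ => Real.exp (-(2 * Real.pi * D) * τ.im)) (n : ℕ) (hn : n < D) :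
    (qExpansion 1 N).coeff n = 0 := by
  obtain ⟨C, hC⟩ := hN.bound
  obtain ⟨A, hA⟩ := (atImInfty_mem _).1 hC
  have h1 : (1 : ℝ) ∈ (𝒮ℒ).strictPeriods := by simp
  have hb : ∀ t : ℝ, max A 1 ≤ t → ‖(qExpansion 1 N).coeff n‖ ≤ C * Real.exp (-(2 * Real.pi * (D - n)) * t) := by
    intro t ht
    have ht0 : 0 < t := lt_of_lt_of_le one_pos ((le_max_right _ _).trans ht)
    rw [ModularFormClass.qExpansion_coeff_eq_intervalIntegral N one_pos h1 n ht0]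
    simp only [ofReal_one, div_one, one_mul]
    refine (intervalIntegral.norm_integral_le_of_norm_le_const (C := C * Real.exp (-(2 * Real.pi * (D - n)) * t)) ?_).trans (by simp)
    intro u _
    have h2 := hA ⟨u + t * Complex.I, by simpa using ht0⟩ (by
      show A ≤ (u + t * Complex.I : ℂ).im
      simpa using (le_max_left _ _).trans ht)
    have him : UpperHalfPlane.im ⟨u + t * Complex.I, by simpa using ht0⟩ = t := by
      show (u + t * Complex.I : ℂ).im = t
      simp
    simp only [mem_ofPred_eq, him, Real.norm_eq_abs, Real.abs_exp] at h2
    rw [norm_mul, norm_div, norm_one, norm_pow, Periodic.norm_qParam]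
    have him2 : (u + t * Complex.I : ℂ).im = t := by simp
    rw [him2, ← Real.exp_nat_mul, one_div, ← Real.exp_neg]
    calc _ ≤ Real.exp (-(n * (-2 * Real.pi * t / 1))) * (C * Real.exp (-(2 * Real.pi * D) * t)) := by gcongr
      _ = _ := by
        rw [mul_left_comm, ← Real.exp_add]; congr 2; ring
  have hlim : Tendsto (fun t : ℝ => C * Real.exp (-(2 * Real.pi * (D - n)) * t)) atTop (𝓝 (C * 0)) := by
    refine Tendsto.const_mul _ ?_
    refine Real.tendsto_exp_atBot.comp ?_
    refine Tendsto.const_mul_atTop_of_neg ?_ tendsto_id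
    have : (n : ℝ) < D := by exact_mod_cast hn
    have hpi := Real.pi_pos
    have : 0 < 2 * Real.pi * ((D : ℝ) - n) := by
      have : 0 < (D : ℝ) - n := by linarith
      positivity
    linarith
  rw [mul_zero] at hlim
  have := ge_of_tendsto hlim (eventually_atTop.2 ⟨max A 1, hb⟩)
  exact norm_le_zero_iff.1 this

lemma sturm2 (k d : ℕ) (hk : k / 4 ≤ d + 1) (f : CuspForm G2 (k : ℤ))
    (h0 : ∀ m ≤ d, (qExpansion 1 f).coeff m = 0) : f = 0 := by
  let : Fintype (𝒮ℒ ⧸ (G2.subgroupOf 𝒮ℒ)) := Fintype.ofFinite _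
  have hc : Fintype.card (𝒮ℒ ⧸ (G2.subgroupOf 𝒮ℒ)) = 3 := by
    rw [← Nat.card_eq_fintype_card]; exact cardQ
  have hdec : (ModularForm.norm 𝒮ℒ f : ℍ → ℂ) =O[atImInfty] fun τ => Real.exp (-(2 * Real.pi * (d + 2 : ℕ)) * τ.im) := by
    classical
    let q0 : 𝒮ℒ ⧸ (G2.subgroupOf 𝒮ℒ) := QuotientGroup.mk 1
    let B : (𝒮ℒ ⧸ (G2.subgroupOf 𝒮ℒ)) → ℍ → ℝ := fun q τ =>
      if q = q0 then Real.exp (-(2 * Real.pi * (d + 1)) * τ.im) else Real.exp (-Real.pi * τ.im)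
    have hB : ∀ q ∈ Finset.univ, SlashInvariantForm.quotientFunc (k := (k : ℤ)) f q =O[atImInfty] B q := by
      intro q _
      by_cases hq : q = q0
      · simp only [B, hq, if_true]
        refine (decay_high f d h0).congr_left fun τ => ?_
        show f τ = ((f : ℍ → ℂ) ∣[(k : ℤ)] ((1 : 𝒮ℒ).val)⁻¹) τ
        simp
      · simp only [B, hq, if_false]
        induction q using QuotientGroup.induction_on with | H r => ?_
        exact decay_any f r.1 r.2
    have := IsBigO.finsetProd hB
    refine this.congr (fun τ => ?_) (fun τ => ?_)
    · rw [ModularForm.coe_norm]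
      simp only [Finset.prod_apply]
    · simp only [B]
      rw [← Finset.mul_prod_erase _ _ (Finset.mem_univ q0), if_pos rfl,
        Finset.prod_congr rfl (g := fun _ => Real.exp (-Real.pi * τ.im)) (fun q hq => if_neg (Finset.ne_of_mem_erase hq)),
        Finset.prod_const, Finset.card_erase_of_mem (Finset.mem_univ _), Finset.card_univ, hc,
        ← Real.exp_nat_mul, ← Real.exp_add]
      congr 1
      push_cast
      ring
  have hN : ModularForm.norm 𝒮ℒ f = 0 := by
    apply ModularForm.sturm_bound_levelOne
    refine lt_of_lt_of_le (b := ((d + 2 : ℕ) : ℕ∞)) ?_ (PowerSeries.le_order _ ((d + 2 : ℕ) : ℕ∞) fun i hi => coeff_zero_of_decay _ (d + 2) hdec i (by exact_mod_cast hi))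
    have hkk : ((k : ℤ) * (Nat.card (𝒮ℒ ⧸ (G2.subgroupOf 𝒮ℒ)) : ℤ)).toNat = 3 * k := by
      rw [cardQ]; omega
    rw [hkk]
    norm_cast
    omega
  have := (ModularForm.norm_eq_zero_iff (f := f) 𝒮ℒ).1 hN
  exact DFunLike.coe_injective this
end PartA2

section PartE
open Complex Filter Topology Set
open UpperHalfPlane hiding I
open CongruenceSubgroup
open scoped MatrixGroups

lemma sturm2' (k : ℤ) (K d : ℕ) (hkK : k = K) (hk : K / 4 ≤ d + 1) (f : CuspForm G2 k)
    (h0 : ∀ m ≤ d, (qExpansion 1 f).coeff m = 0) : f = 0 := by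
  subst hkK
  exact sturm2 K d hk f h0

def coeffMap (k : ℤ) (d : ℕ) : CuspForm G2 k →ₗ[ℂ] (Fin d → ℂ) where
  toFun f i := (qExpansion 1 f).coeff (i.1 + 1)
  map_add' f g := by
    funext i
    have hf := ModularFormClass.analyticAt_cuspFunction_zero f one_pos one_per
    have hg := ModularFormClass.analyticAt_cuspFunction_zero g one_pos one_per
    have : qExpansion 1 ⇑(f + g) = qExpansion 1 f + qExpansion 1 g := qExpansion_add hf hg
    simp only [this, map_add, Pi.add_apply]
  map_smul' a f := by
    funext i
    have hf := ModularFormClass.analyticAt_cuspFunction_zero f one_pos one_per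
    have : qExpansion 1 ⇑(a • f) = a • qExpansion 1 f := qExpansion_smul hf a
    simp only [this, map_smul, Pi.smul_apply, RingHom.id_apply]

lemma span_of_indep (k : ℤ) (K d : ℕ) (hkK : k = K) (hk : K / 4 ≤ d + 1) (v : Fin d → CuspForm G2 k)
    (hv : ∀ c : Fin d → ℂ, (∀ z : ℍ, ∑ i, c i * v i z = 0) → ∀ i, c i = 0) (f : CuspForm G2 k) :
    ∃ c : Fin d → ℂ, ∀ z : ℍ, f z = ∑ i, c i * v i z := by
  have hinj : LinearMap.ker (coeffMap k d) = ⊥ := by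
    rw [LinearMap.ker_eq_bot']
    intro f hf
    refine sturm2' k K d hkK hk f ?_
    intro m hm
    rcases m with _ | m
    · exact CuspFormClass.qExpansion_coeff_zero f one_pos one_per
    · exact congrFun hf ⟨m, by omega⟩
  have hap : ∀ (c : Fin d → ℂ) (z : ℍ), (∑ i, c i • v i : CuspForm G2 k) z = ∑ i, c i * v i z := by
    intro c z
    have h1 : ∀ s : Finset (Fin d), (∑ i ∈ s, c i • v i : CuspForm G2 k) z = ∑ i ∈ s, c i * v i z := by
      intro s
      classical
      induction s using Finset.induction_on with
      | empty => simp
      | insert a s ha ih => rw [Finset.sum_insert ha, Finset.sum_insert ha, ← ih]; rfl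
    exact h1 _
  have hli : LinearIndependent ℂ v := by
    rw [Fintype.linearIndependent_iff]
    intro c hc
    refine hv c fun z => ?_
    rw [← hap, hc]; rfl
  have hli2 := hli.map' _ hinj
  have hsp := hli2.span_eq_top_of_card_eq_finrank' (by simp)
  have hm : coeffMap k d f ∈ Submodule.span ℂ (Set.range (coeffMap k d ∘ v)) := by rw [hsp]; trivial
  rw [Submodule.mem_span_range_iff_exists_fun] at hm
  obtain ⟨c, hc⟩ := hm
  refine ⟨c, fun z => ?_⟩
  rw [← hap]
  congr 1
  apply LinearMap.ker_eq_bot.1 hinj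
  rw [← hc]
  simp

lemma RG_eq (w n : ℕ) (hn : n ≤ w) (z : ℂ) :
    RG 2 w n z = (cwn w n)⁻¹ * PS (Gamma0 2 : Subgroup SL(2, ℤ)) (w - n + 1) (n + 1) z := by
  unfold RG PS
  congr 1
  refine tsum_congr fun γ => ?_
  unfold tm
  have e1 : -((w : ℤ) - n + 1) = -((w - n + 1 : ℕ) : ℤ) := by omega
  have e2 : -((n : ℤ) + 1) = -((n + 1 : ℕ) : ℤ) := by omega
  rw [e1, e2, zpow_neg, zpow_neg, zpow_natCast, zpow_natCast]

lemma cwn_ne (w n : ℕ) (hn : n ≤ w) : cwn w n ≠ 0 := by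
  have h1 : (w.choose n : ℂ) ≠ 0 := by exact_mod_cast (Nat.choose_pos hn).ne'
  have h2 : (Real.pi : ℂ) ≠ 0 := by exact_mod_cast Real.pi_ne_zero
  have h3 := I_ne_zero
  have h4 : ((-1 : ℂ)) ^ n ≠ 0 := pow_ne_zero _ (by norm_num)
  unfold cwn
  exact mul_ne_zero (mul_ne_zero h4 (mul_ne_zero (mul_ne_zero two_ne_zero h2) h3)) h1

lemma RG_spans (w d : ℕ) (hk : (w + 2) / 4 ≤ d + 1) (n : Fin d → ℕ) (hn : ∀ i, 2 ≤ n i ∧ n i + 2 ≤ w)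
    (hv : ∀ c : Fin d → ℂ, (∀ z : ℂ, 0 < z.im → ∑ i, c i * RG 2 w (n i) z = 0) → ∀ i, c i = 0)
    (f : CuspForm (Gamma0 2) ((w : ℤ) + 2)) :
    ∃ c : Fin d → ℂ, ∀ z : ℍ, f z = ∑ i, c i * RG 2 w (n i) z := by
  let v : Fin d → CuspForm G2 ((w : ℤ) + 2) := fun i =>
    (cwn w (n i))⁻¹ • PCF (w - n i + 1) (n i + 1) (by have := hn i; omega) (by have := hn i; omega) _
      (by have := hn i; push_cast; omega)
  have hvz : ∀ i (z : ℍ), v i z = RG 2 w (n i) z := by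
    intro i z
    rw [RG_eq w (n i) (by have := hn i; omega)]
    rfl
  obtain ⟨c, hc⟩ := span_of_indep ((w : ℤ) + 2) (w + 2) d (by push_cast; ring) hk v (by
    intro c hc
    refine hv c fun z hz => ?_
    have := hc ⟨z, hz⟩
    simp_rw [hvz] at this
    exact this) f
  refine ⟨c, fun z => ?_⟩
  rw [hc z]
  simp_rw [hvz]
end PartE

theorem R_even_bases (w : ℕ) (hw : 6 ≤ w) (hwe : Even w) (hdw : 1 ≤ (w - 2) / 4) :
    ((∀ c : Fin ((w - 2) / 4) → ℂ,
        (∀ z : ℂ, 0 < z.im → ∑ i, c i * RG 2 w (2 * (i.1 + 1)) z = 0) → ∀ i, c i = 0) ∧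
      ∀ f : CuspForm (CongruenceSubgroup.Gamma0 2) ((w : ℤ) + 2),
        ∃ c : Fin ((w - 2) / 4) → ℂ,
          ∀ z : UpperHalfPlane, f z = ∑ i, c i * RG 2 w (2 * (i.1 + 1)) (z : ℂ)) ∧
    ((∀ c : Fin ((w - 2) / 4) → ℂ,
        (∀ z : ℂ, 0 < z.im → ∑ i, c i * RG 2 w (w - 2 * (i.1 + 1)) z = 0) → ∀ i, c i = 0) ∧
      ∀ f : CuspForm (CongruenceSubgroup.Gamma0 2) ((w : ℤ) + 2),
        ∃ c : Fin ((w - 2) / 4) → ℂ,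
          ∀ z : UpperHalfPlane, f z = ∑ i, c i * RG 2 w (w - 2 * (i.1 + 1)) (z : ℂ)) := by
  obtain ⟨d, hd⟩ : ∃ d, d = (w - 2) / 4 := ⟨_, rfl⟩
  rw [← hd]
  have hd4 : 4 * d + 2 ≤ w := by omega
  have hk : (w + 2) / 4 ≤ d + 1 := by omega
  have l1 : ∀ c : Fin d → ℂ,
      (∀ z : ℂ, 0 < z.im → ∑ i, c i * RG 2 w (2 * (i.1 + 1)) z = 0) → ∀ i, c i = 0 := by
    intro c hc i
    have hle : ∀ i : Fin d, 2 * (i.1 + 1) ≤ w := fun i => by omega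
    have := PS_indep2 w d hwe hd4 (fun i => c i * (cwn w (2 * (i.1 + 1)))⁻¹) (by
      intro z hz
      rw [← hc z hz]
      refine Finset.sum_congr rfl fun i _ => ?_
      rw [RG_eq w _ (hle i), mul_assoc]) i
    exact (mul_eq_zero.1 this).resolve_right (inv_ne_zero (cwn_ne w _ (hle i)))
  have l2 : ∀ c : Fin d → ℂ,
      (∀ z : ℂ, 0 < z.im → ∑ i, c i * RG 2 w (w - 2 * (i.1 + 1)) z = 0) → ∀ i, c i = 0 := by
    intro c hc i
    have hle : ∀ i : Fin d, w - 2 * (i.1 + 1) ≤ w := fun i => by omega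
    have := PS_indep w d hwe hd4 (fun i => c i * (cwn w (w - 2 * (i.1 + 1)))⁻¹) (by
      intro z hz
      rw [← hc z hz]
      refine Finset.sum_congr rfl fun i _ => ?_
      rw [RG_eq w _ (hle i), mul_assoc, show w - (w - 2 * (i.1 + 1)) = 2 * (i.1 + 1) by omega]) i
    exact (mul_eq_zero.1 this).resolve_right (inv_ne_zero (cwn_ne w _ (hle i)))
  refine ⟨⟨l1, ?_⟩, ⟨l2, ?_⟩⟩
  · exact RG_spans w d hk (fun i => 2 * (i.1 + 1)) (fun i => by omega) l1
  · exact RG_spans w d hk (fun i => w - 2 * (i.1 + 1)) (fun i => by omega) l2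
end
end

section
/- Let w ≥ 2 be an even integer and let f ∈ S_{w+2}(Γ₀(2)) be a cusp form of weight w+2 on Γ₀(2). If r_n(f) = 0 for every odd n with 0 ≤ n ≤ w, then f is identically zero on ℍ; likewise, if r_n(f) = 0 for every even n with 0 ≤ n ≤ w, then f is identically zero on ℍ. (Equivalently, the odd and even period polynomial maps r^−, r^+ : S_{w+2}(Γ₀(2)) → {polynomials of degree ≤ w} are both injective.) -/
open MeasureTheory

noncomputable section

/-- Extension of a function on the upper half-plane to `ℂ` (by `0` off `ℍ`). -/
def extH (f : UpperHalfPlane → ℂ) (z : ℂ) : ℂ :=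
  if h : 0 < z.im then f ⟨z, h⟩ else 0

/-- The `n`-th period `r_n(f) = ∫₀^{i∞} f(z) z^n dz`, parametrized by `z = it`. -/
def periodN (n : ℕ) (f : UpperHalfPlane → ℂ) : ℂ :=
  ∫ t in Set.Ioi (0 : ℝ), extH f (Complex.I * t) * (Complex.I * t) ^ n * Complex.I


lemma pm_upper_open : IsOpen {z : ℂ | 0 < z.im} := isOpen_lt continuous_const Complex.continuous_im

lemma pm_upper_convex : Convex ℝ {z : ℂ | 0 < z.im} := convex_halfSpace_im_gt 0

lemma pm_exists_primitive (φ : ℂ → ℂ) (hφ : ∀ z : ℂ, 0 < z.im → DifferentiableAt ℂ φ z) :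
    ∃ P : ℂ → ℂ, ∀ z : ℂ, 0 < z.im → HasDerivAt P (φ z) z := by
  -- Cayley transform
  set ψ : ℂ → ℂ := fun ζ => Complex.I * (1 + ζ) / (1 - ζ) with hψ
  have hne : ∀ ζ ∈ Metric.ball (0:ℂ) 1, (1 - ζ) ≠ 0 := by
    intro ζ hζ h
    have : ζ = 1 := by linear_combination -h
    simp [this] at hζ
  have him : ∀ ζ ∈ Metric.ball (0:ℂ) 1, 0 < (ψ ζ).im := by
    intro ζ hζ
    have h1 : ζ.re ^ 2 + ζ.im ^ 2 < 1 := by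
      have : ‖ζ‖ < 1 := by simpa using hζ
      have h2 : ‖ζ‖ ^ 2 < 1 := by nlinarith [norm_nonneg ζ]
      rw [Complex.sq_norm, Complex.normSq_apply] at h2
      nlinarith
    have h3 : 0 < Complex.normSq (1 - ζ) := Complex.normSq_pos.mpr (hne ζ hζ)
    have : (ψ ζ).im = (1 - (ζ.re ^ 2 + ζ.im ^ 2)) / Complex.normSq (1 - ζ) := by
      simp only [hψ, Complex.div_im]
      simp
      field_simp
      ring
    rw [this]
    apply div_pos _ h3
    linarith
  have hd : DifferentiableOn ℂ (fun ζ => φ (ψ ζ) * (2 * Complex.I / (1 - ζ) ^ 2)) (Metric.ball 0 1) := by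
    intro ζ hζ
    apply DifferentiableAt.differentiableWithinAt
    have h0 := hne ζ hζ
    have h1 : DifferentiableAt ℂ ψ ζ := by
      simp only [hψ]
      fun_prop (disch := assumption)
    have h2 : DifferentiableAt ℂ (fun ζ => φ (ψ ζ)) ζ := (hφ _ (him ζ hζ)).comp ζ h1
    have h3 : (1 - ζ) ^ 2 ≠ 0 := pow_ne_zero _ h0
    have h4 : DifferentiableAt ℂ (fun ζ : ℂ => 2 * Complex.I / (1 - ζ) ^ 2) ζ := by
      fun_prop (disch := assumption)
    exact h2.mul h4
  obtain ⟨G, hG⟩ := hd.isExactOn_ball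
  refine ⟨fun z => G ((z - Complex.I) / (z + Complex.I)), fun z hz => ?_⟩
  have hzi : z + Complex.I ≠ 0 := by
    intro h
    have := congrArg Complex.im h
    simp at this
    linarith
  have hb : (z - Complex.I) / (z + Complex.I) ∈ Metric.ball (0:ℂ) 1 := by
    simp only [Metric.mem_ball, dist_zero_right, norm_div]
    rw [div_lt_one (norm_pos_iff.mpr hzi)]
    apply lt_of_pow_lt_pow_left₀ 2 (norm_nonneg _)
    rw [Complex.sq_norm, Complex.sq_norm, Complex.normSq_apply, Complex.normSq_apply]
    simp
    nlinarith
  have h1 : HasDerivAt (fun z : ℂ => (z - Complex.I) / (z + Complex.I))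
      (2 * Complex.I / (z + Complex.I) ^ 2) z := by
    convert! ((hasDerivAt_id z).sub_const Complex.I).div ((hasDerivAt_id z).add_const Complex.I) hzi using 1
    simp
    ring
  have h2 := (hG _ hb).comp z h1
  convert! h2 using 1
  have h3 : 1 - (z - Complex.I) / (z + Complex.I) = 2 * Complex.I / (z + Complex.I) := by
    field_simp; ring
  have h4 : ψ ((z - Complex.I) / (z + Complex.I)) = z := by
    simp only [hψ, h3]
    have := Complex.I_ne_zero
    field_simp
    ring
  simp only
  rw [h4, h3]
  have := Complex.I_ne_zero
  field_simp

lemma pm_norm_segment (φ P : ℂ → ℂ) (hP : ∀ z : ℂ, 0 < z.im → HasDerivAt P (φ z) z)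
    (C c : ℝ) (hC : 0 ≤ C)
    (hb : ∀ z : ℂ, |z.re| ≤ 2 → 1 / 2 ≤ z.im → ‖φ z‖ ≤ C * Real.exp (-c * z.im))
    (z : ℂ) (hx : |z.re| ≤ 2) (hy : 1 / 2 ≤ z.im) :
    ‖P z - P (Complex.I * z.im)‖ ≤ 2 * C * Real.exp (-c * z.im) := by
  have hcv : Convex ℝ ({u : ℂ | u.im = z.im} ∩ {u : ℂ | |u.re| ≤ 2}) := by
    apply Convex.inter
    · exact convex_hyperplane Complex.imLm.isLinear _
    · have : {u : ℂ | |u.re| ≤ 2} = {u : ℂ | -2 ≤ u.re} ∩ {u : ℂ | u.re ≤ 2} := by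
        ext u; simp [abs_le]
      rw [this]
      exact (convex_halfSpace_re_ge _).inter (convex_halfSpace_re_le _)
  have := hcv.norm_image_sub_le_of_norm_hasDerivWithin_le (f := P) (f' := φ)
    (C := C * Real.exp (-c * z.im)) (x := Complex.I * z.im) (y := z)
    (fun u hu => (hP u (by have := hu.1; simp at this; linarith)).hasDerivWithinAt)
    (fun u hu => by
      have h1 : u.im = z.im := hu.1
      have := hb u hu.2 (by linarith)
      rwa [h1] at this)
    (by simp) ⟨rfl, hx⟩
  refine this.trans ?_
  have h2 : z - Complex.I * z.im = z.re := by
    apply Complex.ext <;> simp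
  rw [h2, Complex.norm_real, Real.norm_eq_abs]
  have : 0 ≤ C * Real.exp (-c * z.im) := by positivity
  nlinarith

lemma pm_norm_vertical (φ P : ℂ → ℂ) (hP : ∀ z : ℂ, 0 < z.im → HasDerivAt P (φ z) z)
    (C c : ℝ) (hc : 0 < c)
    (hb : ∀ z : ℂ, |z.re| ≤ 2 → 1 / 2 ≤ z.im → ‖φ z‖ ≤ C * Real.exp (-c * z.im))
    (a b : ℝ) (ha : 1 / 2 ≤ a) (hab : a ≤ b) :
    ‖P (Complex.I * b) - P (Complex.I * a)‖ ≤ C / c * (Real.exp (-c * a) - Real.exp (-c * b)) := by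
  have hd : ∀ t : ℝ, 1/2 ≤ t → HasDerivAt (fun t : ℝ => P (Complex.I * t) - P (Complex.I * a))
      (φ (Complex.I * t) * Complex.I) t := by
    intro t ht
    have h1 : HasDerivAt (fun t : ℝ => Complex.I * (t:ℂ)) Complex.I t := by
      simpa using (Complex.ofRealCLM.hasDerivAt (x := t)).const_mul Complex.I
    exact ((hP (Complex.I * t) (by simp; linarith)).comp t h1).sub_const _
  have := image_norm_le_of_norm_deriv_right_le_deriv_boundary' (a := a) (b := b)
    (f := fun t : ℝ => P (Complex.I * t) - P (Complex.I * a))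
    (f' := fun t : ℝ => φ (Complex.I * t) * Complex.I)
    (B := fun t => C / c * (Real.exp (-c * a) - Real.exp (-c * t)))
    (B' := fun t => C * Real.exp (-c * t))
    (fun t ht => (hd t (ha.trans ht.1)).continuousAt.continuousWithinAt)
    (fun t ht => (hd t (ha.trans ht.1)).hasDerivWithinAt)
    (by simp) (by fun_prop)
    (fun t ht => by
      have h := (((((hasDerivAt_id t).const_mul (-c)).exp).const_sub (Real.exp (-c * a))).const_mul (C / c))
      have h2 : C / c * -(Real.exp (-c * id t) * (-c * 1)) = C * Real.exp (-c * t) := by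
        simp; field_simp
      rw [h2] at h
      exact h.hasDerivWithinAt)
    (fun t ht => by
      have := hb (Complex.I * t) (by simp) (by simp; linarith [ht.1])
      simpa using this)
  exact this ⟨hab, le_rfl⟩

lemma pm_norm_primitive (φ : ℂ → ℂ) (hφ : ∀ z : ℂ, 0 < z.im → DifferentiableAt ℂ φ z)
    (C c : ℝ) (hC : 0 ≤ C) (hc : 0 < c)
    (hb : ∀ z : ℂ, |z.re| ≤ 2 → 1 / 2 ≤ z.im → ‖φ z‖ ≤ C * Real.exp (-c * z.im)) :
    ∃ P : ℂ → ℂ, ∃ D : ℝ, 0 ≤ D ∧ (∀ z : ℂ, 0 < z.im → HasDerivAt P (φ z) z) ∧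
      ∀ z : ℂ, |z.re| ≤ 2 → 1 / 2 ≤ z.im → ‖P z‖ ≤ D * Real.exp (-c * z.im) := by
  obtain ⟨P, hP⟩ := pm_exists_primitive φ hφ
  have hv := pm_norm_vertical φ P hP C c hc hb
  have hlim : Filter.Tendsto (fun n : ℝ => Real.exp (-c * n)) Filter.atTop (nhds 0) := by
    apply Real.tendsto_exp_atBot.comp
    exact Filter.Tendsto.const_mul_atTop_of_neg (by linarith) Filter.tendsto_id
  have hcs : Cauchy (Filter.map (fun t : ℝ => P (Complex.I * t)) Filter.atTop) := by
    rw [Metric.cauchy_iff]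
    refine ⟨inferInstance, fun ε hε => ?_⟩
    have h1 : Filter.Tendsto (fun n : ℝ => 2 * (C / c * Real.exp (-c * n))) Filter.atTop (nhds 0) := by
      simpa using (hlim.const_mul (C / c)).const_mul 2
    obtain ⟨N, hN, hN2⟩ := ((h1.eventually (gt_mem_nhds hε)).and (Filter.eventually_ge_atTop (1/2))).exists
    have key : ∀ b, N ≤ b → ‖P (Complex.I * b) - P (Complex.I * N)‖ ≤ C / c * Real.exp (-c * N) := by
      intro b hb
      refine (hv N b hN2 hb).trans ?_
      gcongr
      linarith [Real.exp_pos (-c * b)]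
    refine ⟨(fun t : ℝ => P (Complex.I * t)) '' Set.Ici N, Filter.image_mem_map (Filter.Ici_mem_atTop N), ?_⟩
    rintro _ ⟨s, hs, rfl⟩ _ ⟨t, ht, rfl⟩
    have := key s hs
    have := key t ht
    rw [dist_eq_norm]
    have h5 := norm_sub_le_norm_sub_add_norm_sub (P (Complex.I * s)) (P (Complex.I * N)) (P (Complex.I * t))
    rw [norm_sub_rev (P (Complex.I * N))] at h5
    simp only at *
    linarith
  obtain ⟨L, hL⟩ := CompleteSpace.complete hcs
  have hL' : Filter.Tendsto (fun t : ℝ => P (Complex.I * t)) Filter.atTop (nhds L) := hL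
  refine ⟨fun z => P z - L, 2 * C + C / c, by positivity, fun z hz => (hP z hz).sub_const L, ?_⟩
  intro z hx hy
  have h1 := pm_norm_segment φ P hP C c hC hb z hx hy
  have h2 : ‖L - P (Complex.I * z.im)‖ ≤ C / c * Real.exp (-c * z.im) := by
    apply le_of_tendsto ((hL'.sub_const (P (Complex.I * z.im))).norm)
    filter_upwards [Filter.eventually_ge_atTop z.im] with b hb
    refine (hv z.im b hy hb).trans ?_
    gcongr
    linarith [Real.exp_pos (-c * b)]
  have h5 := norm_sub_le_norm_sub_add_norm_sub (P z) (P (Complex.I * z.im)) L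
  rw [norm_sub_rev (P (Complex.I * z.im)) L] at h5
  simp only
  linarith


/-- moments -/
lemma pm_exists_family (F : ℂ → ℂ) (hF : ∀ z : ℂ, 0 < z.im → DifferentiableAt ℂ F z)
    (C : ℝ) (hC : 0 ≤ C)
    (hb : ∀ z : ℂ, |z.re| ≤ 2 → 1 / 2 ≤ z.im → ‖F z‖ ≤ C * Real.exp (-3 * z.im)) :
    ∃ (P : ℕ → ℂ → ℂ) (D : ℕ → ℝ), (∀ k, 0 ≤ D k) ∧
      (∀ k, ∀ z : ℂ, 0 < z.im → HasDerivAt (P k) (F z * z ^ k) z) ∧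
      ∀ k, ∀ z : ℂ, |z.re| ≤ 2 → 1 / 2 ≤ z.im → ‖P k z‖ ≤ D k * Real.exp (-2 * z.im) := by
  have h : ∀ k : ℕ, ∃ P : ℂ → ℂ, ∃ D : ℝ, 0 ≤ D ∧
      (∀ z : ℂ, 0 < z.im → HasDerivAt P (F z * z ^ k) z) ∧
      ∀ z : ℂ, |z.re| ≤ 2 → 1 / 2 ≤ z.im → ‖P z‖ ≤ D * Real.exp (-2 * z.im) := by
    intro k
    apply pm_norm_primitive (fun z => F z * z ^ k) (fun z hz => (hF z hz).mul (by fun_prop))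
      (C * (k.factorial * Real.exp 2)) 2 (by positivity) (by norm_num)
    intro z hx hy
    have h1 : ‖z‖ ≤ 2 + z.im := by
      refine (Complex.norm_le_abs_re_add_abs_im z).trans ?_
      rw [abs_of_nonneg (a := z.im) (by linarith)]
      linarith
    have h2 : ‖z‖ ^ k ≤ k.factorial * Real.exp (2 + z.im) := by
      have := Real.pow_div_factorial_le_exp (2 + z.im) (by linarith) k
      rw [div_le_iff₀ (by positivity)] at this
      calc ‖z‖ ^ k ≤ (2 + z.im) ^ k := by gcongr
        _ ≤ _ := by linarith
    rw [norm_mul, norm_pow]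
    calc ‖F z‖ * ‖z‖ ^ k ≤ (C * Real.exp (-3 * z.im)) * (k.factorial * Real.exp (2 + z.im)) := by
          gcongr; exact hb z hx hy
      _ = C * (k.factorial * Real.exp 2) * Real.exp (-2 * z.im) := by
          have : Real.exp (-2 * z.im) = Real.exp (-3 * z.im) * Real.exp (z.im) := by
            rw [← Real.exp_add]; ring_nf
          rw [this, Real.exp_add]; ring
  choose P D h1 h2 h3 using h
  exact ⟨P, D, h1, h2, h3⟩

/-- the polynomial-valued primitive -/
def pmPhi (w : ℕ) (P : ℕ → ℂ → ℂ) (X z : ℂ) : ℂ :=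
  ∑ k ∈ Finset.range (w + 1), (w.choose k : ℂ) * X ^ (w - k) * (-1) ^ k * P k z

/-- the non-holomorphic weight `-w` function -/
def pmH (w : ℕ) (η : ℂ) (P : ℕ → ℂ → ℂ) (z : ℂ) : ℂ :=
  pmPhi w P z z + η * pmPhi w P (-z) (-(starRingEnd ℂ z))

lemma pmPhi_hasDerivAt (w : ℕ) (F : ℂ → ℂ) (P : ℕ → ℂ → ℂ)
    (hP : ∀ k, ∀ z : ℂ, 0 < z.im → HasDerivAt (P k) (F z * z ^ k) z) (X z : ℂ) (hz : 0 < z.im) :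
    HasDerivAt (pmPhi w P X) (F z * (X - z) ^ w) z := by
  have h : HasDerivAt (fun z => ∑ k ∈ Finset.range (w + 1), (w.choose k : ℂ) * X ^ (w - k) * (-1) ^ k * P k z)
      (∑ k ∈ Finset.range (w + 1), (w.choose k : ℂ) * X ^ (w - k) * (-1) ^ k * (F z * z ^ k)) z :=
    HasDerivAt.fun_sum fun k _ => (hP k z hz).const_mul _
  convert! h using 1
  rw [show X - z = -z + X by ring, add_pow, Finset.mul_sum]
  refine Finset.sum_congr rfl fun k _ => ?_
  rw [neg_pow z k]; ring

lemma pmPhi_bound (w : ℕ) (P : ℕ → ℂ → ℂ) (D : ℕ → ℝ) (hD : ∀ k, 0 ≤ D k)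
    (hb : ∀ k, ∀ z : ℂ, |z.re| ≤ 2 → 1 / 2 ≤ z.im → ‖P k z‖ ≤ D k * Real.exp (-2 * z.im)) :
    ∃ M : ℝ, 0 ≤ M ∧ ∀ X z : ℂ, |z.re| ≤ 2 → 1 / 2 ≤ z.im → ‖X‖ ≤ 2 + z.im →
      ‖pmPhi w P X z‖ ≤ M * Real.exp (-z.im) := by
  refine ⟨∑ k ∈ Finset.range (w + 1), (w.choose k : ℝ) * ((w - k).factorial * Real.exp 2) * D k,
    Finset.sum_nonneg fun k _ => by have := hD k; positivity, ?_⟩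
  intro X z hx hy hX
  rw [pmPhi, Finset.sum_mul]
  refine (norm_sum_le _ _).trans (Finset.sum_le_sum fun k _ => ?_)
  have h2 : ‖X‖ ^ (w - k) ≤ (w - k).factorial * Real.exp (2 + z.im) := by
    have := Real.pow_div_factorial_le_exp (2 + z.im) (by linarith) (w - k)
    rw [div_le_iff₀ (by positivity)] at this
    calc ‖X‖ ^ (w - k) ≤ (2 + z.im) ^ (w - k) := by gcongr
      _ ≤ _ := by linarith
  have h3 := hb k z hx hy
  have h4 := hD k
  simp only [norm_mul, norm_pow, norm_neg, norm_one, one_pow, mul_one, Complex.norm_natCast]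
  calc (w.choose k : ℝ) * ‖X‖ ^ (w - k) * ‖P k z‖
      ≤ (w.choose k : ℝ) * ((w - k).factorial * Real.exp (2 + z.im)) * (D k * Real.exp (-2 * z.im)) := by
        gcongr
    _ = _ := by
      have : Real.exp (-z.im) = Real.exp (-2 * z.im) * Real.exp (z.im) := by
        rw [← Real.exp_add]; ring_nf
      rw [this, Real.exp_add]; ring

lemma pmH_bound (w : ℕ) (η : ℂ) (hη : ‖η‖ ≤ 1) (P : ℕ → ℂ → ℂ) (D : ℕ → ℝ) (hD : ∀ k, 0 ≤ D k)
    (hb : ∀ k, ∀ z : ℂ, |z.re| ≤ 2 → 1 / 2 ≤ z.im → ‖P k z‖ ≤ D k * Real.exp (-2 * z.im)) :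
    ∃ M : ℝ, 0 ≤ M ∧ ∀ z : ℂ, |z.re| ≤ 2 → 1 / 2 ≤ z.im → ‖pmH w η P z‖ ≤ M := by
  obtain ⟨M, hM, h⟩ := pmPhi_bound w P D hD hb
  refine ⟨2 * M, by positivity, fun z hx hy => ?_⟩
  have h1 : ‖z‖ ≤ 2 + z.im := by
    refine (Complex.norm_le_abs_re_add_abs_im z).trans ?_
    rw [abs_of_nonneg (a := z.im) (by linarith)]
    linarith
  have e1 : Real.exp (-z.im) ≤ 1 := by
    rw [Real.exp_le_one_iff]; linarith
  have h2 := h z z hx hy h1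
  have h3 := h (-z) (-(starRingEnd ℂ z)) (by simpa using hx) (by simpa using hy) (by simpa using h1)
  simp at h3
  rw [pmH]
  refine (norm_add_le _ _).trans ?_
  rw [norm_mul]
  have h4 : ‖η‖ * ‖pmPhi w P (-z) (-(starRingEnd ℂ z))‖ ≤ 1 * (M * Real.exp (-z.im)) := by
    gcongr
  nlinarith

lemma pm_const (g : ℂ → ℂ) (hg : ∀ z : ℂ, 0 < z.im → HasDerivAt g 0 z) (L : ℂ)
    (hL : Filter.Tendsto (fun t : ℝ => g (Complex.I * t)) Filter.atTop (nhds L)) (z : ℂ) (hz : 0 < z.im) :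
    g z = L := by
  have key : ∀ u : ℂ, 0 < u.im → g u = g z := by
    intro u hu
    have := pm_upper_convex.norm_image_sub_le_of_norm_hasDerivWithin_le (f := g) (f' := fun _ => 0)
      (C := 0) (x := z) (y := u) (fun v hv => (hg v hv).hasDerivWithinAt) (by simp) hz hu
    simpa [sub_eq_zero] using this
  refine tendsto_nhds_unique (tendsto_const_nhds.congr' ?_) hL
  filter_upwards [Filter.eventually_gt_atTop 0] with t ht
  exact (key _ (by simpa using ht)).symm

lemma pmP_tendsto (P : ℂ → ℂ) (D : ℝ)
    (hb : ∀ z : ℂ, |z.re| ≤ 2 → 1 / 2 ≤ z.im → ‖P z‖ ≤ D * Real.exp (-2 * z.im))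
    (N : ℝ) (hN : |N| ≤ 2) :
    Filter.Tendsto (fun t : ℝ => P (Complex.I * t + N)) Filter.atTop (nhds 0) := by
  have hlim : Filter.Tendsto (fun n : ℝ => D * Real.exp (-2 * n)) Filter.atTop (nhds 0) := by
    rw [show (0:ℝ) = D * 0 by simp]
    apply Filter.Tendsto.const_mul
    apply Real.tendsto_exp_atBot.comp
    exact Filter.Tendsto.const_mul_atTop_of_neg (by norm_num) Filter.tendsto_id
  refine squeeze_zero_norm' ?_ hlim
  filter_upwards [Filter.eventually_ge_atTop (1/2)] with t ht
  have := hb (Complex.I * t + N) (by simpa using hN) (by simpa using ht)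
  simpa using this

lemma pmPhi_tendsto (w : ℕ) (P : ℕ → ℂ → ℂ) (ι : Filter ℝ) (g : ℝ → ℂ) (R : ℕ → ℂ) (X : ℂ)
    (h : ∀ k ≤ w, Filter.Tendsto (fun t : ℝ => P k (g t)) ι (nhds (R k))) :
    Filter.Tendsto (fun t : ℝ => pmPhi w P X (g t)) ι (nhds (pmPhi w (fun k _ => R k) X 0)) := by
  unfold pmPhi
  apply tendsto_finsetSum
  intro k hk
  exact (h k (by simpa [Nat.lt_succ_iff] using hk)).const_mul _

lemma pmPhi_shift (w : ℕ) (F : ℂ → ℂ) (P : ℕ → ℂ → ℂ) (D : ℕ → ℝ)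
    (hP : ∀ k, ∀ z : ℂ, 0 < z.im → HasDerivAt (P k) (F z * z ^ k) z)
    (hb : ∀ k, ∀ z : ℂ, |z.re| ≤ 2 → 1 / 2 ≤ z.im → ‖P k z‖ ≤ D k * Real.exp (-2 * z.im))
    (N : ℝ) (hN : |N| ≤ 2) (hper : ∀ z : ℂ, 0 < z.im → F (z + N) = F z) (X z : ℂ) (hz : 0 < z.im) :
    pmPhi w P (X + N) (z + N) = pmPhi w P X z := by
  have := pm_const (fun z => pmPhi w P (X + N) (z + N) - pmPhi w P X z) (fun z hz => by
    have h1 := (pmPhi_hasDerivAt w F P hP (X + N) (z + N) (by simpa using hz)).comp z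
      ((hasDerivAt_id z).add_const (N:ℂ))
    convert! h1.sub (pmPhi_hasDerivAt w F P hP X z hz) using 1
    rw [hper z hz]; ring) 0 (by
      have h1 := pmPhi_tendsto w P _ (fun t => Complex.I * t + N) (fun _ => 0) (X + N)
        (fun k _ => pmP_tendsto (P k) (D k) (hb k) N hN)
      have h2 := pmPhi_tendsto w P _ (fun t => Complex.I * t + (0:ℝ)) (fun _ => 0) X
        (fun k _ => pmP_tendsto (P k) (D k) (hb k) 0 (by simp))
      simpa [pmPhi] using h1.sub h2) z hz
  simpa [sub_eq_zero] using this

lemma pmH_shift (w : ℕ) (η : ℂ) (F : ℂ → ℂ) (P : ℕ → ℂ → ℂ) (D : ℕ → ℝ)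
    (hP : ∀ k, ∀ z : ℂ, 0 < z.im → HasDerivAt (P k) (F z * z ^ k) z)
    (hb : ∀ k, ∀ z : ℂ, |z.re| ≤ 2 → 1 / 2 ≤ z.im → ‖P k z‖ ≤ D k * Real.exp (-2 * z.im))
    (N : ℝ) (hN : |N| ≤ 2) (hper : ∀ z : ℂ, 0 < z.im → F (z + N) = F z) (z : ℂ) (hz : 0 < z.im) :
    pmH w η P (z + N) = pmH w η P z := by
  unfold pmH
  rw [pmPhi_shift w F P D hP hb N hN hper z z hz]
  have := pmPhi_shift w F P D hP hb N hN hper (-(z + N)) (-(starRingEnd ℂ (z + N))) (by simpa using hz)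
  rw [← this]
  congr 3 <;> simp

lemma pmPhi_inv (w : ℕ) (hwe : Even w) (F Fs : ℂ → ℂ) (P Q : ℕ → ℂ → ℂ) (D : ℕ → ℝ) (R : ℕ → ℂ)
    (hP : ∀ k, ∀ z : ℂ, 0 < z.im → HasDerivAt (P k) (F z * z ^ k) z)
    (hQ : ∀ k, ∀ z : ℂ, 0 < z.im → HasDerivAt (Q k) (Fs z * z ^ k) z)
    (hb : ∀ k, ∀ z : ℂ, |z.re| ≤ 2 → 1 / 2 ≤ z.im → ‖Q k z‖ ≤ D k * Real.exp (-2 * z.im))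
    (hS : ∀ z : ℂ, 0 < z.im → F (-1 / z) = z ^ (w + 2) * Fs z)
    (hR : ∀ k ≤ w, Filter.Tendsto (fun t : ℝ => P k (-1 / (Complex.I * t))) Filter.atTop (nhds (R k)))
    (X z : ℂ) (hX : X ≠ 0) (hz : 0 < z.im) :
    X ^ w * pmPhi w P (-1 / X) (-1 / z) = pmPhi w Q X z + X ^ w * pmPhi w (fun k _ => R k) (-1 / X) 0 := by
  have him : ∀ z : ℂ, 0 < z.im → 0 < (-1 / z).im := by
    intro z hz
    have h0 : z ≠ 0 := by rintro rfl; simp at hz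
    have := Complex.normSq_pos.mpr h0
    have h1 : (-1 / z).im = z.im / Complex.normSq z := by simp [Complex.div_im]; ring
    rw [h1]
    positivity
  have := pm_const (fun z => X ^ w * pmPhi w P (-1 / X) (-1 / z) - pmPhi w Q X z) (fun z hz => by
    have h0 : z ≠ 0 := by rintro rfl; simp at hz
    have hi : HasDerivAt (fun z : ℂ => -1 / z) (1 / z ^ 2) z := by
      have := (hasDerivAt_inv h0).const_mul (-1)
      simp only [← div_eq_mul_inv] at this
      convert! this using 1
      field_simp
    have h1 := ((pmPhi_hasDerivAt w F P hP (-1 / X) (-1 / z) (him z hz)).comp z hi).const_mul (X ^ w)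
    convert! h1.sub (pmPhi_hasDerivAt w Fs Q hQ X z hz) using 1
    rw [hS z hz]
    have e : -1 / X - -1 / z = (X - z) / (X * z) := by field_simp; ring
    rw [e, div_pow, mul_pow]
    field_simp
    ring) (X ^ w * pmPhi w (fun k _ => R k) (-1 / X) 0) (by
      have h1 := pmPhi_tendsto w P _ (fun t => -1 / (Complex.I * t)) R (-1 / X) hR
      have h2 := pmPhi_tendsto w Q _ (fun t => Complex.I * t + (0:ℝ)) (fun _ => 0) X
        (fun k _ => pmP_tendsto (Q k) (D k) (hb k) 0 (by simp))
      simpa [pmPhi] using (h1.const_mul (X ^ w)).sub h2) z hz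
  rw [← this]; ring

lemma pmH_inv (w : ℕ) (hwe : Even w) (η : ℂ) (F Fs : ℂ → ℂ) (P Q : ℕ → ℂ → ℂ) (D : ℕ → ℝ) (R : ℕ → ℂ)
    (hP : ∀ k, ∀ z : ℂ, 0 < z.im → HasDerivAt (P k) (F z * z ^ k) z)
    (hQ : ∀ k, ∀ z : ℂ, 0 < z.im → HasDerivAt (Q k) (Fs z * z ^ k) z)
    (hb : ∀ k, ∀ z : ℂ, |z.re| ≤ 2 → 1 / 2 ≤ z.im → ‖Q k z‖ ≤ D k * Real.exp (-2 * z.im))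
    (hS : ∀ z : ℂ, 0 < z.im → F (-1 / z) = z ^ (w + 2) * Fs z)
    (hR : ∀ k ≤ w, Filter.Tendsto (fun t : ℝ => P k (-1 / (Complex.I * t))) Filter.atTop (nhds (R k)))
    (hη : ∀ k ≤ w, (1 + η * (-1) ^ k) * R k = 0)
    (z : ℂ) (hz : 0 < z.im) :
    z ^ w * pmH w η P (-1 / z) = pmH w η Q z := by
  have h0 : z ≠ 0 := by rintro rfl; simp at hz
  have h1 := pmPhi_inv w hwe F Fs P Q D R hP hQ hb hS hR z z h0 hz
  have h2 := pmPhi_inv w hwe F Fs P Q D R hP hQ hb hS hR (-z) (-(starRingEnd ℂ z)) (neg_ne_zero.mpr h0)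
    (by simpa using hz)
  have h3 : pmPhi w (fun k _ => R k) (-1 / z) 0 + η * pmPhi w (fun k _ => R k) (-1 / -z) 0 = 0 := by
    unfold pmPhi
    rw [Finset.mul_sum, ← Finset.sum_add_distrib]
    apply Finset.sum_eq_zero
    intro k hk
    have hk : k ≤ w := by simpa [Nat.lt_succ_iff] using hk
    have e : (-1 / -z) ^ (w - k) = (-1) ^ k * (-1 / z) ^ (w - k) := by
      rw [show -1 / -z = -1 * (-1 / z) by ring, mul_pow]
      congr 1
      have : Even (w - k) ↔ Even k := by
        rw [Nat.even_sub hk]; simp [hwe]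
      rcases Nat.even_or_odd k with h | h
      · rw [h.neg_one_pow, (this.mpr h).neg_one_pow]
      · rw [h.neg_one_pow, Odd.neg_one_pow]
        rw [← Nat.not_even_iff_odd] at h ⊢
        rwa [this]
    rw [e]
    linear_combination ((w.choose k : ℂ) * (-1 / z) ^ (w - k) * (-1) ^ k) * hη k hk
  unfold pmH
  rw [hwe.neg_pow] at h2
  have e1 : -(starRingEnd ℂ (-1 / z)) = -1 / -(starRingEnd ℂ z) := by
    simp [neg_div]
  have e2 : -(-1 / z) = -1 / -z := by ring
  rw [e1, e2]
  linear_combination h1 + η * h2 + z ^ w * h3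


lemma pm_mvp (G : ℂ → ℂ) (hG : ∀ ζ : ℂ, ‖ζ‖ < 1 → DifferentiableAt ℂ G ζ) (r : ℝ) (hr : |r| < 1) :
    ∫ θ in (0:ℝ)..2 * Real.pi, G (circleMap 0 r θ) = 2 * Real.pi * G 0 := by
  have h : DiffContOnCl ℂ G (Metric.ball 0 |r|) := by
    apply DifferentiableOn.diffContOnCl_ball (U := Metric.ball 0 1)
    · intro ζ hζ
      exact (hG ζ (by simpa using hζ)).differentiableWithinAt
    · exact Metric.closedBall_subset_ball hr
  have := h.circleAverage
  rw [Real.circleAverage_def] at this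
  rw [← this]
  have : (Real.pi : ℂ) ≠ 0 := by exact_mod_cast Real.pi_ne_zero
  simp
  field_simp

lemma pm_mvp_neg (G : ℂ → ℂ) (hG : ∀ ζ : ℂ, ‖ζ‖ < 1 → DifferentiableAt ℂ G ζ) (r : ℝ) (hr : |r| < 1) :
    ∫ θ in (0:ℝ)..2 * Real.pi, G (circleMap 0 r (-θ)) = 2 * Real.pi * G 0 := by
  rw [← pm_mvp G hG r hr]
  have h := intervalIntegral.integral_comp_sub_left (a := 0) (b := 2 * Real.pi)
    (fun θ => G (circleMap 0 r θ)) (2 * Real.pi)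
  simp only [sub_self, sub_zero] at h
  rw [← h]
  congr 1
  ext θ
  congr 1
  have := periodic_circleMap 0 r (-θ)
  rw [← this]
  congr 1
  ring

lemma pm_swap (w : ℕ) (k : ℂ → ℂ) (hk : ∀ ζ : ℂ, ‖ζ‖ < 1 → DifferentiableAt ℂ k ζ) :
    IntervalIntegrable (fun θ => (∫ s in (0:ℝ)..1,
      k (s * circleMap 0 (1/2) (-θ)) * circleMap 0 (1/2) (-θ) * (1 - s / 4) ^ w)) volume 0 (2 * Real.pi) ∧
    ∫ θ in (0:ℝ)..2 * Real.pi, (∫ s in (0:ℝ)..1,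
      k (s * circleMap 0 (1/2) (-θ)) * circleMap 0 (1/2) (-θ) * (1 - s / 4) ^ w) = 0 := by
  have hcont : ContinuousOn (Function.uncurry fun θ s : ℝ =>
      k (s * circleMap 0 (1/2) (-θ)) * circleMap 0 (1/2) (-θ) * (1 - (s:ℂ) / 4) ^ w)
      (Set.Icc 0 (2 * Real.pi) ×ˢ Set.Icc 0 1) := by
    have hc : Continuous fun p : ℝ × ℝ => circleMap 0 (1/2) (-p.1) :=
      (continuous_circleMap 0 (1/2)).comp (by fun_prop)
    have h1 : ContinuousOn (fun p : ℝ × ℝ => k (p.2 * circleMap 0 (1/2) (-p.1)))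
        (Set.Icc 0 (2 * Real.pi) ×ˢ Set.Icc 0 1) := by
      intro p hp
      apply ContinuousAt.continuousWithinAt
      have hc2 : ContinuousAt (fun p : ℝ × ℝ => (p.2 : ℂ) * circleMap 0 (1/2) (-p.1)) p := by
        apply Continuous.continuousAt
        fun_prop
      refine ContinuousAt.comp (g := k) (hk _ ?_).continuousAt hc2
      have h3 := hp.2.1
      have h4 := hp.2.2
      simp [abs_of_nonneg h3]
      linarith
    have h2 : Continuous (fun p : ℝ × ℝ => circleMap 0 (1/2) (-p.1) * (1 - (p.2:ℂ) / 4) ^ w) := by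
      fun_prop
    have := h1.mul h2.continuousOn
    refine this.congr ?_
    intro p hp
    simp [Function.uncurry, mul_assoc]
  have hint : Integrable (Function.uncurry fun θ s : ℝ =>
      k (s * circleMap 0 (1/2) (-θ)) * circleMap 0 (1/2) (-θ) * (1 - (s:ℂ) / 4) ^ w)
      ((volume.restrict (Set.uIoc 0 (2 * Real.pi))).prod (volume.restrict (Set.Ioc 0 1))) := by
    rw [Measure.prod_restrict]
    have := hcont.integrableOn_compact (μ := (volume : Measure ℝ).prod volume) (isCompact_Icc.prod isCompact_Icc)
    refine this.mono_set ?_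
    rw [Set.uIoc_of_le (by positivity)]
    exact Set.prod_mono Set.Ioc_subset_Icc_self Set.Ioc_subset_Icc_self
  have hsw := intervalIntegral_integral_swap hint
  simp only [intervalIntegral.integral_of_le (zero_le_one' ℝ)]
  refine ⟨?_, ?_⟩
  · rw [intervalIntegrable_iff]
    exact hint.integral_prod_left
  rw [hsw]
  apply setIntegral_eq_zero_of_forall_eq_zero
  intro s hs
  have := pm_mvp_neg (fun ω => k (s * ω) * ω * (1 - (s:ℂ) / 4) ^ w) (fun ζ hζ => by
    have h1 : ‖(s:ℂ) * ζ‖ < 1 := by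
      simp [abs_of_nonneg hs.1.le]
      nlinarith [hs.1, hs.2, norm_nonneg ζ]
    have h2 : DifferentiableAt ℂ (fun ω => k (s * ω)) ζ :=
      (hk _ h1).comp ζ (by fun_prop)
    fun_prop) (1/2) (by norm_num [abs_of_pos])
  simpa using this

lemma pmPhi_diff (w : ℕ) (F : ℂ → ℂ) (P : ℕ → ℂ → ℂ)
    (hP : ∀ k, ∀ z : ℂ, 0 < z.im → HasDerivAt (P k) (F z * z ^ k) z) (z : ℂ) (hz : 0 < z.im) :
    DifferentiableAt ℂ (fun z => pmPhi w P z z) z := by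
  unfold pmPhi
  apply DifferentiableAt.fun_sum
  intro k _
  have := (hP k z hz).differentiableAt
  fun_prop

lemma pmPhi_diff_left (w : ℕ) (P : ℕ → ℂ → ℂ) (u : ℂ) :
    Differentiable ℂ (fun X => pmPhi w P X u) := by
  unfold pmPhi
  fun_prop

lemma pm_mean (w m : ℕ) (hwm : w = 2 * m) (η : ℂ) (F : ℂ → ℂ) (P : ℕ → ℂ → ℂ)
    (hF : ∀ z : ℂ, 0 < z.im → DifferentiableAt ℂ F z)
    (hP : ∀ k, ∀ z : ℂ, 0 < z.im → HasDerivAt (P k) (F z * z ^ k) z)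
    (M : ℝ) (hM : ∀ z : ℂ, 0 < z.im → ‖pmH w η P z‖ ≤ M * z.im ^ m) (a : ℂ) (ha : 0 < a.im) :
    ‖pmH w η P a‖ ≤ (3 / 4) ^ m * M * a.im ^ m := by
  set b := starRingEnd ℂ a with hb
  have hba : starRingEnd ℂ b = a := by simp [hb]
  set Z : ℂ → ℂ := fun ζ => (a - b * ζ) / (1 - ζ) with hZ
  set U : ℂ → ℂ := fun ω => (-b + a * ω) / (1 - ω) with hU
  have hne : ∀ ζ : ℂ, ‖ζ‖ < 1 → 1 - ζ ≠ 0 := by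
    intro ζ hζ h
    have : ζ = 1 := by linear_combination -h
    simp [this] at hζ
  have hZim' : ∀ ζ : ℂ, ‖ζ‖ < 1 → (Z ζ).im = a.im * (1 - ‖ζ‖ ^ 2) / ‖1 - ζ‖ ^ 2 := by
    intro ζ hζ
    have h3 : 0 < Complex.normSq (1 - ζ) := Complex.normSq_pos.mpr (hne ζ hζ)
    rw [Complex.sq_norm, Complex.sq_norm]
    simp only [hZ, Complex.div_im]
    rw [Complex.normSq_apply ζ]
    simp [hb]
    field_simp
    ring
  have hsq : ∀ ζ : ℂ, ‖ζ‖ < 1 → 0 < 1 - ‖ζ‖ ^ 2 := by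
    intro ζ hζ
    nlinarith [norm_nonneg ζ]
  have hZim : ∀ ζ : ℂ, ‖ζ‖ < 1 → 0 < (Z ζ).im := by
    intro ζ hζ
    rw [hZim' ζ hζ]
    have := hsq ζ hζ
    have := norm_pos_iff.mpr (hne ζ hζ)
    positivity
  have hUZ : ∀ ζ : ℂ, U (starRingEnd ℂ ζ) = -(starRingEnd ℂ (Z ζ)) := by
    intro ζ
    simp only [hU, hZ, map_div₀, map_sub, map_mul, hba, map_one, ← hb]
    ring
  have hUim : ∀ ω : ℂ, ‖ω‖ < 1 → 0 < (U ω).im := by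
    intro ω hω
    have := hUZ (starRingEnd ℂ ω)
    rw [Complex.conj_conj] at this
    rw [this]
    simpa using hZim (starRingEnd ℂ ω) (by simpa using hω)
  have hZd : ∀ ζ : ℂ, ‖ζ‖ < 1 → DifferentiableAt ℂ Z ζ := by
    intro ζ hζ
    have := hne ζ hζ
    simp only [hZ]
    fun_prop (disch := assumption)
  have hUd : ∀ ω : ℂ, ‖ω‖ < 1 → HasDerivAt U ((a - b) / (1 - ω) ^ 2) ω := by
    intro ω hω
    have h1 := hne ω hω
    convert! (((hasDerivAt_id ω).const_mul a).const_add (-b)).div ((hasDerivAt_id ω).const_sub 1) h1 using 1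
    simp
    ring
  set k : ℂ → ℂ := fun σ => F (U σ) * ((b - a) / (1 - σ)) ^ w * ((a - b) / (1 - σ) ^ 2) with hk
  have hkd : ∀ ζ : ℂ, ‖ζ‖ < 1 → DifferentiableAt ℂ k ζ := by
    intro ζ hζ
    have h0 := hne ζ hζ
    have h1 : DifferentiableAt ℂ (fun ζ => F (U ζ)) ζ :=
      (hF _ (hUim ζ hζ)).comp ζ (hUd ζ hζ).differentiableAt
    have h3 : (1 - ζ) ^ 2 ≠ 0 := pow_ne_zero _ h0
    have h4 : DifferentiableAt ℂ (fun σ : ℂ => ((b - a) / (1 - σ)) ^ w) ζ := by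
      fun_prop (disch := assumption)
    have h5 : DifferentiableAt ℂ (fun σ : ℂ => ((a - b) / (1 - σ) ^ 2)) ζ := by
      fun_prop (disch := assumption)
    exact (h1.mul h4).mul h5
  -- the decomposition on the circle
  have hconj : ∀ θ : ℝ, starRingEnd ℂ (circleMap 0 (1/2) θ) = circleMap 0 (1/2) (-θ) := by
    intro θ
    simp [circleMap, ← Complex.exp_conj]
    exact map_ofNat _ 2
  have hnorm : ∀ θ : ℝ, ‖circleMap 0 (1/2) θ‖ = 1/2 := by
    intro θ; simp
  have hdec : ∀ θ : ℝ, (1 - circleMap 0 (1/2) θ) ^ w * pmH w η P (Z (circleMap 0 (1/2) θ)) =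
      ((1 - circleMap 0 (1/2) θ) ^ w * (pmPhi w P (Z (circleMap 0 (1/2) θ)) (Z (circleMap 0 (1/2) θ)) +
        η * pmPhi w P (-Z (circleMap 0 (1/2) θ)) (-b))) + η * (∫ s in (0:ℝ)..1,
      k (s * circleMap 0 (1/2) (-θ)) * circleMap 0 (1/2) (-θ) * (1 - s / 4) ^ w) := by
    intro θ
    set ζ := circleMap 0 (1/2) θ with hζ
    have hω : circleMap 0 (1/2) (-θ) = starRingEnd ℂ ζ := (hconj θ).symm
    rw [hω]
    set ω := starRingEnd ℂ ζ with hωd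
    have nζ : ‖ζ‖ = 1/2 := hnorm θ
    have nω : ‖ω‖ = 1/2 := by rw [hωd, Complex.norm_conj, nζ]
    have hζω : ζ * ω = 1 / 4 := by
      rw [hωd, Complex.mul_conj, Complex.normSq_eq_norm_sq, nζ]; norm_num
    have n1 := hne ζ (by rw [nζ]; norm_num)
    have hsn : ∀ s : ℝ, s ∈ Set.uIcc (0:ℝ) 1 → ‖(s:ℂ) * ω‖ < 1 := by
      intro s hs
      rw [Set.uIcc_of_le zero_le_one] at hs
      rw [norm_mul, nω]
      simp [abs_of_nonneg hs.1]
      linarith [hs.2]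
    have hder : ∀ s ∈ Set.uIcc (0:ℝ) 1, HasDerivAt (fun s : ℝ => (1 - ζ) ^ w * pmPhi w P (-Z ζ) (U (s * ω)))
        (k (s * ω) * ω * (1 - s / 4) ^ w) s := by
      intro s hs
      have hs1 := hsn s hs
      have n2 := hne _ hs1
      have d1 : HasDerivAt (fun s : ℝ => (s:ℂ) * ω) ω s := by
        simpa using (Complex.ofRealCLM.hasDerivAt (x := s)).mul_const ω
      have d2 := (hUd _ hs1).comp s d1
      have d3 := ((pmPhi_hasDerivAt w F P hP (-Z ζ) _ (hUim _ hs1)).comp s d2).const_mul ((1 - ζ) ^ w)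
      convert! d3 using 1
      simp only [hk]
      have e : (b - a) / (1 - s * ω) * (1 - (s:ℂ) / 4) = (1 - ζ) * (-Z ζ - U (s * ω)) := by
        simp only [hZ, hU]
        rw [show (s:ℂ) / 4 = s * (ζ * ω) by rw [hζω]; ring]
        field_simp
        ring
      calc _ = F (U (s * ω)) * ((b - a) / (1 - s * ω) * (1 - (s:ℂ) / 4)) ^ w * ((a - b) / (1 - s * ω) ^ 2) * ω := by
            rw [mul_pow]; ring
        _ = _ := by rw [e, mul_pow]; ring
    have hcont : ContinuousOn (fun s : ℝ => k (s * ω) * ω * (1 - (s:ℂ) / 4) ^ w) (Set.uIcc 0 1) := by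
      intro s hs
      apply ContinuousAt.continuousWithinAt
      have h1 : ContinuousAt (fun s : ℝ => k (s * ω)) s :=
        ContinuousAt.comp (g := k) (hkd _ (hsn s hs)).continuousAt
          (Continuous.continuousAt (by fun_prop))
      exact (h1.mul continuousAt_const).mul (Continuous.continuousAt (by fun_prop))
    rw [intervalIntegral.integral_eq_sub_of_hasDerivAt hder hcont.intervalIntegrable]
    unfold pmH
    have e0 : U (((0:ℝ):ℂ) * ω) = -b := by simp [hU]
    have e1 : U (((1:ℝ):ℂ) * ω) = -(starRingEnd ℂ (Z ζ)) := by
      rw [← hUZ ζ]; simp [hωd]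
    rw [e0, e1]
    ring
  have hA : ∀ ζ : ℂ, ‖ζ‖ < 1 → DifferentiableAt ℂ (fun ζ => (1 - ζ) ^ w * (pmPhi w P (Z ζ) (Z ζ) +
        η * pmPhi w P (-Z ζ) (-b))) ζ := by
    intro ζ hζ
    have h1 : DifferentiableAt ℂ (fun ζ => pmPhi w P (Z ζ) (Z ζ)) ζ :=
      (pmPhi_diff w F P hP _ (hZim ζ hζ)).comp ζ (hZd ζ hζ)
    have h2 : DifferentiableAt ℂ (fun ζ => pmPhi w P (-Z ζ) (-b)) ζ :=
      ((pmPhi_diff_left w P (-b)) _).comp ζ (hZd ζ hζ).neg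
    exact DifferentiableAt.mul (by fun_prop) (h1.add (h2.const_mul η))
  have hmv := pm_mvp _ hA (1/2) (by norm_num [abs_of_pos])
  obtain ⟨hcH, hsw⟩ := pm_swap w k hkd
  have hcA : Continuous fun θ : ℝ => (1 - circleMap 0 (1/2) θ) ^ w * (pmPhi w P (Z (circleMap 0 (1/2) θ)) (Z (circleMap 0 (1/2) θ)) +
        η * pmPhi w P (-Z (circleMap 0 (1/2) θ)) (-b)) := by
    rw [continuous_iff_continuousAt]
    intro θ
    exact ContinuousAt.comp (f := circleMap 0 (1/2)) (hA _ (by rw [hnorm]; norm_num)).continuousAt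
      (continuous_circleMap 0 (1/2)).continuousAt
  have htot : ∫ θ in (0:ℝ)..2 * Real.pi, (1 - circleMap 0 (1/2) θ) ^ w * pmH w η P (Z (circleMap 0 (1/2) θ))
      = 2 * Real.pi * pmH w η P a := by
    simp only [hdec]
    rw [intervalIntegral.integral_add (hcA.intervalIntegrable _ _) (hcH.const_mul η), hmv,
      intervalIntegral.integral_const_mul, hsw]
    simp [hZ, pmH, hb]
  have hbd : ∀ θ ∈ Set.uIoc (0:ℝ) (2 * Real.pi), ‖(1 - circleMap 0 (1/2) θ) ^ w * pmH w η P (Z (circleMap 0 (1/2) θ))‖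
      ≤ (3 / 4) ^ m * M * a.im ^ m := by
    intro θ _
    have hn := hnorm θ
    set ζ := circleMap 0 (1/2) θ
    have hlt : ‖ζ‖ < 1 := by rw [hn]; norm_num
    have n1 := norm_pos_iff.mpr (hne ζ hlt)
    rw [norm_mul, norm_pow]
    calc ‖1 - ζ‖ ^ w * ‖pmH w η P (Z ζ)‖ ≤ ‖1 - ζ‖ ^ w * (M * (Z ζ).im ^ m) := by
          gcongr; exact hM _ (hZim ζ hlt)
      _ = (3 / 4) ^ m * M * a.im ^ m := by
        rw [hZim' ζ hlt, hn, hwm, pow_mul, div_pow, mul_pow]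
        field_simp
        norm_num
  have hfin := intervalIntegral.norm_integral_le_of_norm_le_const hbd
  rw [htot, norm_mul] at hfin
  have hpi : ‖(2 * Real.pi : ℂ)‖ = 2 * Real.pi := by
    simp [abs_of_pos Real.pi_pos]
  rw [hpi, sub_zero, abs_of_pos Real.two_pi_pos, mul_comm] at hfin
  exact le_of_mul_le_mul_right hfin Real.two_pi_pos


lemma pm_inv_im (z : ℂ) (hz : 0 < z.im) : 0 < (-1 / z).im := by
  have h0 : z ≠ 0 := by rintro rfl; simp at hz
  have := Complex.normSq_pos.mpr h0
  have h1 : (-1 / z).im = z.im / Complex.normSq z := by simp [Complex.div_im]; ring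
  rw [h1]
  positivity

lemma pm_inv_im_eq (z : ℂ) : (-1 / z).im = z.im / ‖z‖ ^ 2 := by
  rw [Complex.sq_norm]
  simp [Complex.div_im]; ring

lemma pm_bounded (h0 h1 : ℂ → ℝ)
    (hT0 : ∀ z : ℂ, 0 < z.im → h0 (z + 1) = h0 z)
    (hT1 : ∀ z : ℂ, 0 < z.im → h1 (z + 2) = h1 z)
    (hS : ∀ z : ℂ, 0 < z.im → h0 (-1 / z) = h1 z) (M : ℝ)
    (hb0 : ∀ z : ℂ, |z.re| ≤ 2 → 1 / 2 ≤ z.im → h0 z ≤ M)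
    (hb1 : ∀ z : ℂ, |z.re| ≤ 2 → 1 / 2 ≤ z.im → h1 z ≤ M) (z : ℂ) (hz : 0 < z.im) : h0 z ≤ M := by
  set K : UpperHalfPlane → ℝ := fun τ => max (h0 τ) (max (h1 τ) (h1 (τ + 1))) with hK
  have hS' : ∀ z : ℂ, 0 < z.im → h1 (-1 / z) = h0 z := by
    intro z hz
    have h0 : z ≠ 0 := by rintro rfl; simp at hz
    rw [← hS _ (pm_inv_im z hz)]
    congr 1
    field_simp
  have KT : ∀ τ, K (ModularGroup.T • τ) = K τ := by
    intro τ
    have hτ := τ.im_pos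
    have e : ((ModularGroup.T • τ : UpperHalfPlane) : ℂ) = τ + 1 := by
      rw [UpperHalfPlane.modular_T_smul]
      simp [add_comm]
    simp only [hK, e]
    rw [hT0 _ hτ, add_assoc, show (1 + 1 : ℂ) = 2 by norm_num, hT1 _ hτ, max_comm (h1 (τ : ℂ))]
  have KS : ∀ τ, K (ModularGroup.S • τ) = K τ := by
    intro τ
    have hτ : 0 < (τ : ℂ).im := τ.im_pos
    have e : ((ModularGroup.S • τ : UpperHalfPlane) : ℂ) = -1 / τ := by
      rw [UpperHalfPlane.modular_S_smul]
      simp [neg_div]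
    simp only [hK, e]
    have hn : (τ : ℂ) ≠ 0 := τ.ne_zero
    have hm : 0 < ((τ : ℂ) - 1).im := by simpa using hτ
    have hn1 : (τ : ℂ) - 1 ≠ 0 := by
      intro h; rw [h] at hm; simp at hm
    have key : h1 (-1 / (τ : ℂ) + 1) = h1 (τ + 1) := by
      have e1 : h1 (τ + 1) = h1 (τ - 1) := by
        rw [← hT1 _ hm]; congr 1; ring
      have e2 : -1 / (τ : ℂ) + 1 = -1 / (-1 / ((τ : ℂ) - 1) - 1) := by
        have : -1 / ((τ : ℂ) - 1) - 1 = - τ / (τ - 1) := by field_simp; ring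
        rw [this]
        field_simp
        ring
      have hp := pm_inv_im _ hm
      rw [e1, e2, hS' _ (by simpa using hp), ← hT0 _ (by simpa using hp), ← hS _ hm]
      congr 1; ring
    rw [key, hS _ hτ, hS' _ hτ, max_left_comm]
  have KG : ∀ g : Matrix.SpecialLinearGroup (Fin 2) ℤ, ∀ τ, K (g • τ) = K τ := by
    intro g
    have hg : g ∈ Subgroup.closure {ModularGroup.S, ModularGroup.T} := by
      rw [SpecialLinearGroup.SL2Z_generators]; trivial
    induction hg using Subgroup.closure_induction with
    | mem x hx =>
      rcases hx with rfl | rfl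
      · exact KS
      · exact KT
    | one => intro τ; simp
    | mul x y _ _ hx hy => intro τ; rw [mul_smul, hx, hy]
    | inv x _ hx => intro τ; rw [← hx, smul_inv_smul]
  obtain ⟨g, hg⟩ := ModularGroup.exists_smul_mem_fd (⟨z, hz⟩ : UpperHalfPlane)
  have h1K := KG g ⟨z, hz⟩
  have h2 : h0 z ≤ K ⟨z, hz⟩ := le_max_left _ _
  refine h2.trans ?_
  rw [← h1K]
  set τ := g • (⟨z, hz⟩ : UpperHalfPlane)
  have h3 := ModularGroup.three_le_four_mul_im_sq_of_mem_fd hg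
  have h4 : 1 / 2 ≤ τ.im := by nlinarith [τ.im_pos]
  have h5 : |τ.re| ≤ 1 / 2 := hg.2
  refine max_le (hb0 _ (by simpa using h5.trans (by norm_num)) (by simpa using h4))
    (max_le (hb1 _ (by simpa using h5.trans (by norm_num)) (by simpa using h4))
      (hb1 _ ?_ (by simpa using h4)))
  have : |τ.re + 1| ≤ |τ.re| + |1| := abs_add_le _ _
  simp at this
  simp
  linarith

lemma pm_iter (w m : ℕ) (hm : 1 ≤ m) (hwm : w = 2 * m) (η : ℂ) (F : ℂ → ℂ) (P : ℕ → ℂ → ℂ)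
    (hF : ∀ z : ℂ, 0 < z.im → DifferentiableAt ℂ F z)
    (hP : ∀ k, ∀ z : ℂ, 0 < z.im → HasDerivAt (P k) (F z * z ^ k) z)
    (M : ℝ) (hM : ∀ z : ℂ, 0 < z.im → ‖pmH w η P z‖ ≤ M * z.im ^ m) (a : ℂ) (ha : 0 < a.im) :
    pmH w η P a = 0 := by
  have h : ∀ n : ℕ, ∀ a : ℂ, 0 < a.im → ‖pmH w η P a‖ ≤ (((3 / 4) ^ m) ^ n * M) * a.im ^ m := by
    intro n
    induction n with
    | zero => simpa using hM
    | succ n ih =>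
      intro a ha
      have := pm_mean w m hwm η F P hF hP _ ih a ha
      rw [pow_succ]
      linarith
  have hlim : Filter.Tendsto (fun n : ℕ => (((3 / 4 : ℝ) ^ m) ^ n * M) * a.im ^ m) Filter.atTop (nhds ((0 * M) * a.im ^ m)) := by
    apply Filter.Tendsto.mul_const
    apply Filter.Tendsto.mul_const
    apply tendsto_pow_atTop_nhds_zero_of_lt_one (by positivity)
    exact pow_lt_one₀ (by norm_num) (by norm_num) (by omega)
  have := ge_of_tendsto' hlim (fun n => h n a ha)
  simpa using this

lemma pm_zero (w : ℕ) (η : ℂ) (hη : η ≠ 0) (F : ℂ → ℂ) (P : ℕ → ℂ → ℂ)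
    (hP : ∀ k, ∀ z : ℂ, 0 < z.im → HasDerivAt (P k) (F z * z ^ k) z)
    (h0 : ∀ z : ℂ, 0 < z.im → pmH w η P z = 0) (z : ℂ) (hz : 0 < z.im) : F z = 0 := by
  set v : ℂ := -(starRingEnd ℂ z) with hv
  have hvim : v.im = z.im := by simp [hv]
  have hvz : -(starRingEnd ℂ v) = z := by simp [hv]
  -- the function of v
  have hE : ∀ u : ℂ, 0 < u.im → pmPhi w P (-u) (-(starRingEnd ℂ u)) = -η⁻¹ * pmPhi w P u u := by
    intro u hu
    have := h0 u hu
    rw [pmH] at this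
    field_simp
    linear_combination this
  obtain ⟨e, he⟩ : ∃ e, HasDerivAt (fun u => -η⁻¹ * pmPhi w P u u) e v :=
    ⟨_, ((pmPhi_diff w F P hP v (hvim ▸ hz)).const_mul _).hasDerivAt⟩
  -- partial derivatives of pmPhi
  have hdir : ∀ d : ℂ, -(deriv (fun X => pmPhi w P X z) (-v)) * d
      + F z * (-v - z) ^ w * (-(starRingEnd ℂ d)) = e * d := by
    intro d
    have l1 : HasDerivAt (fun t : ℝ => v + t * d) d 0 := by
      simpa using ((Complex.ofRealCLM.hasDerivAt (x := (0:ℝ))).mul_const d).const_add v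
    have l2 : HasDerivAt (fun t : ℝ => z + t * (-(starRingEnd ℂ d))) (-(starRingEnd ℂ d)) 0 := by
      simpa using ((Complex.ofRealCLM.hasDerivAt (x := (0:ℝ))).mul_const (-(starRingEnd ℂ d))).const_add z
    have l3 : HasDerivAt (fun t : ℝ => -v + t * (-d)) (-d) 0 := by
      simpa using ((Complex.ofRealCLM.hasDerivAt (x := (0:ℝ))).mul_const (-d)).const_add (-v)
    have hr : HasDerivAt (fun t : ℝ => -η⁻¹ * pmPhi w P (v + t * d) (v + t * d)) (e * d) 0 := by
      have : HasDerivAt (fun u => -η⁻¹ * pmPhi w P u u) e (v + (0:ℝ) * d) := by simpa using he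
      have h2 := this.comp (0:ℝ) l1
      exact h2
    have hl : HasDerivAt (fun t : ℝ => pmPhi w P (-v + t * (-d)) (z + t * (-(starRingEnd ℂ d))))
        (-(deriv (fun X => pmPhi w P X z) (-v)) * d
      + F z * (-v - z) ^ w * (-(starRingEnd ℂ d))) 0 := by
      have hc : ∀ k, HasDerivAt (fun t : ℝ => P k (z + t * (-(starRingEnd ℂ d))))
          (F z * z ^ k * (-(starRingEnd ℂ d))) 0 := by
        intro k
        have : HasDerivAt (P k) (F z * z ^ k) (z + (0:ℝ) * (-(starRingEnd ℂ d))) := by simpa using hP k z hz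
        exact this.comp (0:ℝ) l2
      have hx : ∀ k, HasDerivAt (fun t : ℝ => (-v + t * (-d)) ^ k) (deriv (fun X : ℂ => X ^ k) (-v) * (-d)) 0 := by
        intro k
        have : HasDerivAt (fun X : ℂ => X ^ k) (deriv (fun X : ℂ => X ^ k) (-v)) (-v + (0:ℝ) * (-d)) := by
          have : DifferentiableAt ℂ (fun X : ℂ => X ^ k) (-v) := by fun_prop
          simpa only [Complex.ofReal_zero, zero_mul, add_zero] using this.hasDerivAt
        exact this.comp (0:ℝ) l3
      have hs : HasDerivAt (fun t : ℝ => pmPhi w P (-v + t * (-d)) (z + t * (-(starRingEnd ℂ d))))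
        (∑ k ∈ Finset.range (w + 1), ((w.choose k : ℂ) * (deriv (fun X : ℂ => X ^ (w - k)) (-v) * (-d)) * (-1) ^ k * P k z
          + (w.choose k : ℂ) * (-v) ^ (w - k) * (-1) ^ k * (F z * z ^ k * (-(starRingEnd ℂ d))))) 0 := by
        unfold pmPhi
        apply HasDerivAt.fun_sum
        intro k _
        have := ((((hx (w - k)).const_mul (w.choose k : ℂ)).mul_const ((-1) ^ k))).mul (hc k)
        convert! this using 1
        simp
      convert! hs using 1
      have hd1 : HasDerivAt (fun X => pmPhi w P X z) (∑ k ∈ Finset.range (w + 1), ((w.choose k : ℂ) * (deriv (fun X : ℂ => X ^ (w - k)) (-v)) * (-1) ^ k * P k z)) (-v) := by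
        unfold pmPhi
        apply HasDerivAt.fun_sum
        intro k _
        have : DifferentiableAt ℂ (fun X : ℂ => X ^ (w - k)) (-v) := by fun_prop
        exact ((this.hasDerivAt.const_mul _).mul_const _).mul_const _
      rw [hd1.deriv, Finset.sum_add_distrib]
      congr 1
      · rw [neg_mul, Finset.sum_mul, ← Finset.sum_neg_distrib]
        refine Finset.sum_congr rfl fun k _ => ?_
        ring
      · rw [show -v - z = -z + -v by ring, add_pow, Finset.mul_sum, Finset.sum_mul]
        refine Finset.sum_congr rfl fun k _ => ?_
        rw [neg_pow z k]; ring
    have hev : (fun t : ℝ => pmPhi w P (-v + t * (-d)) (z + t * (-(starRingEnd ℂ d)))) =ᶠ[nhds 0]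
        (fun t : ℝ => -η⁻¹ * pmPhi w P (v + t * d) (v + t * d)) := by
      have hcont : ContinuousAt (fun t : ℝ => (v + t * d).im) 0 := by
        apply Continuous.continuousAt; fun_prop
      have := hcont.eventually_mem (s := Set.Ioi 0) (Ioi_mem_nhds (by simpa [hvim] using hz))
      filter_upwards [this] with t ht
      rw [← hE _ ht]
      congr 1
      · ring
      · rw [map_add, neg_add, hvz]; simp
    exact (hl.congr_of_eventuallyEq hev.symm).unique hr
  have q1 := hdir 1
  have q2 := hdir Complex.I
  simp at q1 q2
  have : F z * (-v - z) ^ w = 0 := by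
    have hI : Complex.I * (2 * (F z * (-v - z) ^ w)) = 0 := by
      linear_combination q2 - Complex.I * q1
    simpa using hI
  rcases mul_eq_zero.mp this with h | h
  · exact h
  · exfalso
    have h' : -v - z = 0 := by
      by_contra hne
      exact pow_ne_zero w hne h
    have := congrArg Complex.im h'
    simp [hvim] at this
    linarith

lemma pm_main (w : ℕ) (hw : 2 ≤ w) (hwe : Even w) (η : ℂ) (hη1 : ‖η‖ = 1) (F Fs : ℂ → ℂ) (P Q : ℕ → ℂ → ℂ)
    (D D' : ℕ → ℝ) (hD : ∀ k, 0 ≤ D k) (hD' : ∀ k, 0 ≤ D' k) (R : ℕ → ℂ)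
    (hF : ∀ z : ℂ, 0 < z.im → DifferentiableAt ℂ F z)
    (hP : ∀ k, ∀ z : ℂ, 0 < z.im → HasDerivAt (P k) (F z * z ^ k) z)
    (hQ : ∀ k, ∀ z : ℂ, 0 < z.im → HasDerivAt (Q k) (Fs z * z ^ k) z)
    (hbP : ∀ k, ∀ z : ℂ, |z.re| ≤ 2 → 1 / 2 ≤ z.im → ‖P k z‖ ≤ D k * Real.exp (-2 * z.im))
    (hbQ : ∀ k, ∀ z : ℂ, |z.re| ≤ 2 → 1 / 2 ≤ z.im → ‖Q k z‖ ≤ D' k * Real.exp (-2 * z.im))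
    (hT : ∀ z : ℂ, 0 < z.im → F (z + 1) = F z)
    (hT2 : ∀ z : ℂ, 0 < z.im → Fs (z + 2) = Fs z)
    (hS : ∀ z : ℂ, 0 < z.im → F (-1 / z) = z ^ (w + 2) * Fs z)
    (hR : ∀ k ≤ w, Filter.Tendsto (fun t : ℝ => P k (-1 / (Complex.I * t))) Filter.atTop (nhds (R k)))
    (hη : ∀ k ≤ w, (1 + η * (-1) ^ k) * R k = 0)
    (z : ℂ) (hz : 0 < z.im) : F z = 0 := by
  obtain ⟨m, hm⟩ := hwe
  have hwm : w = 2 * m := by omega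
  have hwe : Even w := ⟨m, hm⟩
  obtain ⟨M0, hM0, b0⟩ := pmH_bound w η hη1.le P D hD hbP
  obtain ⟨M1, hM1, b1⟩ := pmH_bound w η hη1.le Q D' hD' hbQ
  have hpow : ∀ z : ℂ, 1 / 2 ≤ z.im → ∀ A : ℝ, 0 ≤ A → A / z.im ^ m ≤ A * 2 ^ m := by
    intro z hz A hA
    rw [div_eq_mul_inv, ← inv_pow]
    have : z.im⁻¹ ≤ 2 := by
      rw [inv_le_comm₀ (by linarith) (by norm_num)]; linarith
    have : 0 ≤ z.im⁻¹ := by rw [inv_nonneg]; linarith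
    gcongr
  have hbd := pm_bounded (fun z => ‖pmH w η P z‖ / z.im ^ m) (fun z => ‖pmH w η Q z‖ / z.im ^ m)
    (fun z hz => by
      have := pmH_shift w η F P D hP hbP 1 (by norm_num) (by simpa using hT) z hz
      simp at this
      simp [this])
    (fun z hz => by
      have := pmH_shift w η Fs Q D' hQ hbQ 2 (by norm_num) (by simpa using hT2) z hz
      simp at this
      simp [this])
    (fun z hz => by
      have := pmH_inv w hwe η F Fs P Q D' R hP hQ hbQ hS hR hη z hz
      have h0 : z ≠ 0 := by rintro rfl; simp at hz
      have hn := norm_pos_iff.mpr h0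
      rw [← this, pm_inv_im_eq, norm_mul, norm_pow, hwm, pow_mul, div_pow]
      field_simp)
    ((M0 + M1) * 2 ^ m)
    (fun z hx hy => by
      have := hpow z hy (M0 + M1) (by positivity)
      refine le_trans ?_ this
      have := b0 z hx hy
      have : 0 < z.im := by linarith
      gcongr
      linarith)
    (fun z hx hy => by
      have := hpow z hy (M0 + M1) (by positivity)
      refine le_trans ?_ this
      have := b1 z hx hy
      have : 0 < z.im := by linarith
      gcongr
      linarith)
  have h0 := pm_iter w m (by omega) hwm η F P hF hP ((M0 + M1) * 2 ^ m) (fun z hz => by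
    have := hbd z hz
    rwa [div_le_iff₀ (by positivity)] at this)
  exact pm_zero w η (by rintro rfl; simp at hη1) F P hP h0 z hz


lemma pm_period (w k : ℕ) (F Fs : ℂ → ℂ) (hF : ∀ z : ℂ, 0 < z.im → DifferentiableAt ℂ F z)
    (C C' : ℝ) (hC : 0 ≤ C) (hC' : 0 ≤ C')
    (hb : ∀ z : ℂ, |z.re| ≤ 2 → 1 / 2 ≤ z.im → ‖F z‖ ≤ C * Real.exp (-3 * z.im))
    (hb' : ∀ z : ℂ, |z.re| ≤ 2 → 1 / 2 ≤ z.im → ‖Fs z‖ ≤ C' * Real.exp (-3 * z.im))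
    (hS : ∀ z : ℂ, 0 < z.im → F (-1 / z) = z ^ (w + 2) * Fs z)
    (P : ℂ → ℂ) (D : ℝ) (hP : ∀ z : ℂ, 0 < z.im → HasDerivAt P (F z * z ^ k) z)
    (hbP : ∀ z : ℂ, |z.re| ≤ 2 → 1 / 2 ≤ z.im → ‖P z‖ ≤ D * Real.exp (-2 * z.im)) :
    Filter.Tendsto (fun t : ℝ => P (-1 / (Complex.I * t))) Filter.atTop
      (nhds (-(∫ t in Set.Ioi (0 : ℝ), F (Complex.I * t) * (Complex.I * t) ^ k * Complex.I))) := by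
  set G : ℝ → ℂ := fun t => F (Complex.I * t) * (Complex.I * t) ^ k * Complex.I with hG
  have hGc : ContinuousOn G (Set.Ioi 0) := by
    intro t ht
    apply ContinuousAt.continuousWithinAt
    have h1 : ContinuousAt (fun t : ℝ => F (Complex.I * t)) t :=
      ContinuousAt.comp (g := F) (hF _ (by simpa using ht)).continuousAt
        (Continuous.continuousAt (by fun_prop))
    exact (h1.mul (Continuous.continuousAt (by fun_prop))).mul continuousAt_const
  have hexp : ∀ (n : ℕ) (x : ℝ), 0 ≤ x → x ^ n * Real.exp (-x) ≤ n.factorial := by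
    intro n x hx
    have := Real.pow_div_factorial_le_exp x hx n
    rw [div_le_iff₀ (by positivity)] at this
    rw [Real.exp_neg, ← div_eq_mul_inv, div_le_iff₀ (Real.exp_pos x)]
    linarith
  have hGb : ∀ t : ℝ, 0 < t → ‖G t‖ ≤ (C * k.factorial + C' * (w + 2).factorial * Real.exp 2) * Real.exp (-2 * t) := by
    intro t ht
    have hn : ‖G t‖ = ‖F (Complex.I * t)‖ * t ^ k := by
      simp [hG, abs_of_pos ht]
    rw [hn, add_mul]
    rcases le_total 1 t with h | h
    · have h1 := hb (Complex.I * t) (by simp) (by simp; linarith)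
      simp at h1
      have h2 := hexp k t ht.le
      calc ‖F (Complex.I * t)‖ * t ^ k ≤ C * Real.exp (-(3 * t)) * t ^ k := by gcongr
        _ = C * (t ^ k * Real.exp (-t)) * Real.exp (-2 * t) := by
            rw [show -(3 * t) = -t + -2 * t by ring, Real.exp_add]; ring
        _ ≤ C * k.factorial * Real.exp (-2 * t) := by gcongr
        _ ≤ _ := by
            have : 0 ≤ C' * (w + 2).factorial * Real.exp 2 * Real.exp (-2 * t) := by positivity
            linarith
    · have hs := hS (Complex.I * (t⁻¹ : ℝ)) (by simpa using ht)
      have e : -1 / (Complex.I * (t⁻¹ : ℝ)) = Complex.I * t := by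
        have : (t : ℂ) ≠ 0 := by exact_mod_cast ht.ne'
        push_cast
        field_simp
        simp
      have ht1 : 1 ≤ t⁻¹ := (one_le_inv₀ ht).mpr h
      have h1 := hb' (Complex.I * (t⁻¹ : ℝ)) (by simp) (by simp only [Complex.mul_im, Complex.I_re, Complex.I_im, Complex.ofReal_re, Complex.ofReal_im]; linarith)
      have hi : (Complex.I * (t⁻¹ : ℝ)).im = t⁻¹ := by simp
      rw [hi] at h1
      rw [← e, hs, norm_mul, norm_pow]
      have hn2 : ‖Complex.I * (t⁻¹ : ℝ)‖ = t⁻¹ := by simp [abs_of_pos ht]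
      rw [hn2]
      have h2 := hexp (w + 2) t⁻¹ (by positivity)
      have h3 : t ^ k ≤ 1 := pow_le_one₀ ht.le h
      have h4 : Real.exp (-3 * t⁻¹) ≤ Real.exp (-t⁻¹) := by
        rw [Real.exp_le_exp]; linarith
      have h5 : 1 ≤ Real.exp 2 * Real.exp (-2 * t) := by
        rw [← Real.exp_add, Real.one_le_exp_iff]; linarith
      calc t⁻¹ ^ (w + 2) * ‖Fs (Complex.I * (t⁻¹ : ℝ))‖ * t ^ k
          ≤ t⁻¹ ^ (w + 2) * (C' * Real.exp (-t⁻¹)) * 1 := by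
            gcongr
            exact h1.trans (by gcongr)
        _ = C' * (t⁻¹ ^ (w + 2) * Real.exp (-t⁻¹)) := by ring
        _ ≤ C' * (w + 2).factorial := by gcongr
        _ ≤ C' * (w + 2).factorial * (Real.exp 2 * Real.exp (-2 * t)) :=
            le_mul_of_one_le_right (by positivity) h5
        _ ≤ _ := by
            have : 0 ≤ C * k.factorial * Real.exp (-2 * t) := by positivity
            linarith
  have hGi : IntegrableOn G (Set.Ioi 0) := by
    refine Integrable.mono' ((exp_neg_integrableOn_Ioi 0 (b := 2) (by norm_num)).const_mul
      (C * k.factorial + C' * (w + 2).factorial * Real.exp 2)) (hGc.aestronglyMeasurable measurableSet_Ioi) ?_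
    filter_upwards [ae_restrict_mem measurableSet_Ioi] with t ht
    exact hGb t ht
  have hval : ∀ a : ℝ, 0 < a → ∫ t in Set.Ioi a, G t = - P (Complex.I * a) := by
    intro a ha
    have := integral_Ioi_of_hasDerivAt_of_tendsto' (f := fun t : ℝ => P (Complex.I * t)) (f' := G) (a := a) (m := 0)
      (fun t ht => by
        have h0 : 0 < (Complex.I * t).im := by simpa using ha.trans_le ht
        have d1 : HasDerivAt (fun s : ℝ => Complex.I * (s:ℂ)) Complex.I t := by
          simpa using (Complex.ofRealCLM.hasDerivAt (x := t)).const_mul Complex.I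
        exact (hP _ h0).comp t d1)
      (hGi.mono_set (Set.Ioi_subset_Ioi ha.le))
      (by simpa using pmP_tendsto P D hbP 0 (by simp))
    rw [this]; simp
  have hinv : Filter.Tendsto (fun t : ℝ => t⁻¹) Filter.atTop (nhds 0) := tendsto_inv_atTop_zero
  have hlim := (aecover_Ioi_of_Ioi (μ := volume) hinv).integral_tendsto_of_countably_generated hGi
  refine hlim.neg.congr' ?_
  filter_upwards [Filter.eventually_gt_atTop 0] with t ht
  have hti : 0 < t⁻¹ := by positivity
  rw [Measure.restrict_restrict measurableSet_Ioi, Set.inter_eq_left.mpr (Set.Ioi_subset_Ioi hti.le), hval _ hti, neg_neg]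
  congr 1
  have : (t : ℂ) ≠ 0 := by exact_mod_cast ht.ne'
  push_cast
  field_simp
  simp

lemma pm_decay (g : UpperHalfPlane → ℂ) (F : ℂ → ℂ) (hFg : ∀ τ : UpperHalfPlane, F τ = g τ)
    (hF : ∀ z : ℂ, 0 < z.im → DifferentiableAt ℂ F z)
    (hO : g =O[UpperHalfPlane.atImInfty] fun τ => Real.exp (-2 * Real.pi * τ.im / 2)) :
    ∃ C : ℝ, 0 ≤ C ∧ ∀ z : ℂ, |z.re| ≤ 2 → 1 / 2 ≤ z.im → ‖F z‖ ≤ C * Real.exp (-3 * z.im) := by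
  rw [Asymptotics.isBigO_iff] at hO
  obtain ⟨c, hc⟩ := hO
  rw [UpperHalfPlane.atImInfty, Filter.eventually_comap, Filter.eventually_atTop] at hc
  obtain ⟨A, hA⟩ := hc
  have hcont : ContinuousOn (fun z => F z * Complex.exp (3 * z.im)) (Set.Icc (-2) 2 ×ℂ Set.Icc (1/2) A) := by
    intro z hz
    apply ContinuousAt.continuousWithinAt
    have h1 := (hF z (by have := hz.2.1; linarith)).continuousAt
    exact h1.mul (Continuous.continuousAt (by fun_prop))
  obtain ⟨B, hB⟩ := (isCompact_Icc.reProdIm isCompact_Icc).exists_bound_of_continuousOn hcont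
  refine ⟨|c| + |B|, by positivity, fun z hx hy => ?_⟩
  have hz : 0 < z.im := by linarith
  rcases le_total A z.im with h | h
  · have h1 := hA z.im h ⟨z, hz⟩ rfl
    rw [← hFg] at h1
    refine h1.trans ?_
    rw [Real.norm_eq_abs, abs_of_pos (Real.exp_pos _)]
    gcongr
    · exact (le_abs_self c).trans (by linarith [abs_nonneg B])
    · change -2 * Real.pi * z.im / 2 ≤ _
      nlinarith [Real.pi_gt_three]
  · have h1 := hB z ⟨abs_le.mp hx, hy, h⟩
    rw [norm_mul, Complex.norm_exp] at h1
    simp at h1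
    have h2 : ‖F z‖ = ‖F z‖ * Real.exp (3 * z.im) * Real.exp (-3 * z.im) := by
      rw [mul_assoc, ← Real.exp_add]; simp
    rw [h2]
    gcongr
    refine h1.trans ((le_abs_self B).trans (by linarith [abs_nonneg c]))


lemma extH_of_pos (f : UpperHalfPlane → ℂ) (z : ℂ) (hz : 0 < z.im) : extH f z = f ⟨z, hz⟩ := by
  simp [extH, hz]

lemma extH_diff (f : UpperHalfPlane → ℂ) (hf : MDifferentiable (modelWithCornersSelf ℂ ℂ) (modelWithCornersSelf ℂ ℂ) f)
    (z : ℂ) (hz : 0 < z.im) : DifferentiableAt ℂ (extH f) z := by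
  have h := (UpperHalfPlane.mdifferentiable_iff.mp hf).differentiableAt (pm_upper_open.mem_nhds hz)
  refine h.congr_of_eventuallyEq ?_
  filter_upwards [pm_upper_open.mem_nhds hz] with u hu
  rw [extH_of_pos f u hu, Function.comp_apply, UpperHalfPlane.ofComplex_apply_of_im_pos hu]

lemma extH_decay (g : UpperHalfPlane → ℂ)
    (hg : MDifferentiable (modelWithCornersSelf ℂ ℂ) (modelWithCornersSelf ℂ ℂ) g)
    (h0 : UpperHalfPlane.IsZeroAtImInfty g)
    (hper : ∀ z : ℂ, 0 < z.im → extH g (z + 2) = extH g z) :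
    ∃ C : ℝ, 0 ≤ C ∧ ∀ z : ℂ, |z.re| ≤ 2 → 1 / 2 ≤ z.im → ‖extH g z‖ ≤ C * Real.exp (-3 * z.im) := by
  refine pm_decay g (extH g) (fun τ => extH_of_pos g τ τ.im_pos) (extH_diff g hg) ?_
  refine UpperHalfPlane.IsZeroAtImInfty.exp_decay_atImInfty h0 (h := 2) (by norm_num) ?_ hg h0.isBoundedAtImInfty
  intro z
  by_cases hz : 0 < z.im
  · have hz' : 0 < (z + (2 : ℝ)).im := by simpa using hz
    rw [Function.comp_apply, Function.comp_apply, UpperHalfPlane.ofComplex_apply_of_im_pos hz,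
      UpperHalfPlane.ofComplex_apply_of_im_pos hz', ← extH_of_pos g, ← extH_of_pos g]
    exact_mod_cast hper z hz
  · have hz1 : z.im ≤ 0 := not_lt.mp hz
    have hz' : (z + (2 : ℝ)).im ≤ 0 := by simpa using hz1
    rw [Function.comp_apply, Function.comp_apply, UpperHalfPlane.ofComplex_apply_of_im_nonpos hz',
      UpperHalfPlane.ofComplex_apply_of_im_nonpos hz1]

lemma pm_final (w : ℕ) (hw : 2 ≤ w) (hwe : Even w) (η : ℂ) (hη1 : ‖η‖ = 1)
    (f : CuspForm (CongruenceSubgroup.Gamma0 2) ((w : ℤ) + 2))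
    (hη : ∀ k ≤ w, (1 + η * (-1) ^ k) * periodN k f = 0) (τ : UpperHalfPlane) : f τ = 0 := by
  set g : UpperHalfPlane → ℂ := SlashAction.map ((w : ℤ) + 2) ModularGroup.S (f : UpperHalfPlane → ℂ) with hg
  have hfd : MDifferentiable (modelWithCornersSelf ℂ ℂ) (modelWithCornersSelf ℂ ℂ) (f : UpperHalfPlane → ℂ) := f.holo'
  have hgd : MDifferentiable (modelWithCornersSelf ℂ ℂ) (modelWithCornersSelf ℂ ℂ) g := by
    rw [hg, ModularForm.SL_slash]
    exact MDifferentiable.slash hfd _ _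
  have hf0 : UpperHalfPlane.IsZeroAtImInfty (f : UpperHalfPlane → ℂ) := CuspFormClass.zero_at_infty f
  have hg0 : UpperHalfPlane.IsZeroAtImInfty g := CuspFormClass.zero_at_infty_slash f ModularGroup.S
  have hT : ∀ z : ℂ, 0 < z.im → extH f (z + 1) = extH f z := by
    intro z hz
    have hz' : 0 < (z + 1).im := by simpa using hz
    rw [extH_of_pos f z hz, extH_of_pos f _ hz']
    have := SlashInvariantForm.vAdd_apply_of_mem_strictPeriods f ⟨z, hz⟩ (h := 1) (by simp)
    rw [← this]
    congr 1
    ext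
    simp [add_comm]
  have hT' : ∀ z : ℂ, 0 < z.im → extH f (z + 2) = extH f z := by
    intro z hz
    rw [show z + 2 = z + 1 + 1 by ring, hT _ (by simpa using hz), hT z hz]
  have hT2 : ∀ z : ℂ, 0 < z.im → extH g (z + 2) = extH g z := by
    intro z hz
    have hz' : 0 < (z + 2).im := by simpa using hz
    rw [extH_of_pos g z hz, extH_of_pos g _ hz']
    have hinv : SlashAction.map ((w : ℤ) + 2) (ModularGroup.T ^ (2 : ℤ)) g = g := by
      set γ : Matrix.SpecialLinearGroup (Fin 2) ℤ := ⟨!![1, 0; -2, 1], by simp⟩ with hγ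
      have hm : ModularGroup.S * ModularGroup.T ^ (2 : ℤ) = γ * ModularGroup.S := by
        apply Subtype.ext
        rw [Matrix.SpecialLinearGroup.coe_mul, Matrix.SpecialLinearGroup.coe_mul, ModularGroup.coe_T_zpow,
          ModularGroup.coe_S]
        simp [hγ]
      have hγm : γ ∈ CongruenceSubgroup.Gamma0 2 := by
        rw [CongruenceSubgroup.Gamma0_mem]
        decide
      have h1 : SlashAction.map ((w : ℤ) + 2) γ (f : UpperHalfPlane → ℂ) = f := by
        rw [ModularForm.SL_slash]
        exact SlashInvariantForm.slash_action_eqn f _ (Subgroup.mem_map_of_mem _ hγm)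
      rw [hg, ← SlashAction.slash_mul, hm, SlashAction.slash_mul, h1]
    have := (ModularForm.slash_action_eq'_iff _ g _ ⟨z, hz⟩).mp (congrFun hinv ⟨z, hz⟩)
    rw [ModularGroup.coe_T_zpow, UpperHalfPlane.modular_T_zpow_smul] at this
    simp at this
    rw [← this]
    congr 1
    ext
    simp [add_comm]
  have hS : ∀ z : ℂ, 0 < z.im → extH f (-1 / z) = z ^ (w + 2) * extH g z := by
    intro z hz
    have hz0 : z ≠ 0 := by rintro rfl; simp at hz
    rw [extH_of_pos g z hz, extH_of_pos f _ (pm_inv_im z hz), hg, SlashInvariantForm.slash_S_apply]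
    have e : (UpperHalfPlane.mk _ (UpperHalfPlane.im_inv_neg_coe_pos ⟨z, hz⟩)) = ⟨-1 / z, pm_inv_im z hz⟩ := by
      ext
      simp [neg_div]
    rw [e, zpow_neg]
    have : (z : ℂ) ^ ((w : ℤ) + 2) = z ^ (w + 2) := by exact_mod_cast zpow_natCast z (w + 2)
    change _ = z ^ (w + 2) * (_ * (z ^ ((w : ℤ) + 2))⁻¹)
    rw [this]
    field_simp
  have hF := extH_diff f hfd
  have hFs := extH_diff g hgd
  obtain ⟨C, hC, hb⟩ := extH_decay f hfd hf0 hT'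
  obtain ⟨C', hC', hb'⟩ := extH_decay g hgd hg0 hT2
  obtain ⟨P, D, hD, hP, hbP⟩ := pm_exists_family (extH f) hF C hC hb
  obtain ⟨Q, D', hD', hQ, hbQ⟩ := pm_exists_family (extH g) hFs C' hC' hb'
  have := pm_main w hw hwe η hη1 (extH f) (extH g) P Q D D' hD hD' (fun k => -periodN k f) hF hP hQ hbP hbQ hT hT2 hS
    (fun k _ => pm_period w k (extH f) (extH g) hF C C' hC hC' hb hb' hS (P k) (D k) (hP k) (hbP k))
    (fun k hk => by rw [mul_neg, hη k hk, neg_zero]) τ τ.im_pos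
  rwa [extH_of_pos f τ τ.im_pos] at this

theorem period_maps_injective (w : ℕ) (hw : 2 ≤ w) (hwe : Even w)
    (f : CuspForm (CongruenceSubgroup.Gamma0 2) ((w : ℤ) + 2)) :
    ((∀ n, n ≤ w → Odd n → periodN n f = 0) → ∀ z, f z = 0) ∧
    ((∀ n, n ≤ w → Even n → periodN n f = 0) → ∀ z, f z = 0) := by
  constructor
  · intro h z
    refine pm_final w hw hwe (-1) (by simp) f (fun k hk => ?_) z
    rcases Nat.even_or_odd k with he | ho
    · simp [he.neg_one_pow]
    · simp [h k hk ho]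
  · intro h z
    refine pm_final w hw hwe 1 (by simp) f (fun k hk => ?_) z
    rcases Nat.even_or_odd k with he | ho
    · simp [h k hk he]
    · simp [ho.neg_one_pow]
end
end
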